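/- arXiv:math/0109206 — 2 statements merged into one kernel-verified Lean document; each statement's English description precedes it below -/
import Mathlib

section
/- (Main theorem, dense-subspace form) Let 0 < p < 1. Let B = {f ∈ E^p : ‖f‖_{E^p} ≤ 1}, regarded as a subset of the complex vector space of functions ℂ → ℂ, and let μ be the Minkowski functional (gauge) of the convex hull of B. Then there exist constants c, C > 0 such that for every f ∈ E^p: c·μ(f) ≤ ∫_ℂ e^{-π|Im z|} |Im z|^{1/p-2} |f(z)| dA(z) ≤ C·μ(f); that is, the Banach envelope norm of E^p is equivalent on E^p to the weighted Bergman-type norm ∫_ℂ e^{-π|Im z|} |Im z|^{1/p-2} |f(z)| dA(z). -/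
open MeasureTheory Real Complex
open scoped ENNReal NNReal

/-- An entire function of exponential type `π`. -/
def ExpTypePi (f : ℂ → ℂ) : Prop :=
  Differentiable ℂ f ∧
    ∀ ε > 0, ∃ C > 0, ∀ z : ℂ, ‖f z‖ ≤ C * Real.exp ((Real.pi + ε) * ‖z‖)


lemma jensen_disc {G : ℂ → ℂ} {R s : ℝ} (hR : 0 < R) (hs : 0 < s)
    (hG : AnalyticOnNhd ℂ G (Metric.closedBall 0 R)) :
    ‖G 0‖ ^ s ≤ Real.circleAverage (fun z => ‖G z‖ ^ s) 0 R := by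
  by_cases h0 : G 0 = 0
  · rw [h0, norm_zero, Real.zero_rpow hs.ne']
    exact circleAverage_nonneg_of_nonneg fun x _ => by positivity
  have hRabs : |R| = R := abs_of_pos hR
  have hJ := AnalyticOnNhd.circleAverage_log_norm (c := 0) (R := R) (f := G) hR.ne'
    (by rwa [hRabs]) h0
  have hsum : 0 ≤ ∑ᶠ u, MeromorphicOn.divisor G (Metric.closedBall 0 |R|) u * Real.log (R * ‖(0:ℂ) - u‖⁻¹) := by
    apply finsum_nonneg
    intro u
    by_cases hu : u ∈ Metric.closedBall (0:ℂ) |R|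
    · refine mul_nonneg ?_ ?_
      · exact mod_cast (MeromorphicOn.AnalyticOnNhd.divisor_nonneg (by rwa [hRabs])) u
      · by_cases hu0 : u = 0
        · simp [hu0]
        · have h1 : ‖u‖ ≤ R := by simpa [hRabs] using hu
          have h2 : 0 < ‖u‖ := norm_pos_iff.2 hu0
          apply Real.log_nonneg
          rw [zero_sub, norm_neg, ← div_eq_mul_inv, le_div_iff₀ h2]
          linarith
    · rw [Function.locallyFinsuppWithin.apply_eq_zero_of_notMem _ hu]; simp
  have hle : Real.log ‖G 0‖ ≤ Real.circleAverage (fun z => Real.log ‖G z‖) 0 R := by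
    rw [hJ]; linarith
  have hcont : Continuous fun θ : ℝ => G (circleMap 0 R θ) := by
    apply ContinuousOn.comp_continuous (s := Metric.closedBall 0 R) hG.continuousOn
      (continuous_circleMap 0 R)
    intro θ
    exact circleMap_mem_closedBall 0 hR.le θ
  have hmeas : Measurable fun θ : ℝ => Real.log ‖G (circleMap 0 R θ)‖ :=
    Real.measurable_log.comp hcont.norm.measurable
  have hint1 : Integrable (fun θ : ℝ => Real.log ‖G (circleMap 0 R θ)‖)
      (volume.restrict (Set.Ioc 0 (2 * π))) := by
    have h1 : CircleIntegrable (fun z => Real.log ‖G z‖) 0 R := by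
      apply MeromorphicOn.circleIntegrable_log_norm
      intro z hz
      exact (hG z (by rw [hRabs] at hz; exact Metric.sphere_subset_closedBall hz)).meromorphicAt
    have := h1.1
    exact this
  obtain ⟨K, hK⟩ : ∃ K, ∀ θ ∈ Set.Icc (0:ℝ) (2*π), ‖G (circleMap 0 R θ)‖ ≤ K := by
    obtain ⟨K, hK⟩ := isCompact_Icc.exists_bound_of_continuousOn (hcont.continuousOn (s := Set.Icc (0:ℝ) (2*π)))
    exact ⟨K, hK⟩
  have hint2 : Integrable ((fun x => Real.exp (s * x)) ∘ (fun θ : ℝ => Real.log ‖G (circleMap 0 R θ)‖))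
      (volume.restrict (Set.Ioc 0 (2 * π))) := by
    refine Measure.integrableOn_of_bounded (M := max 1 (K ^ s)) measure_Ioc_lt_top.ne ?_ ?_
    · exact ((Real.measurable_exp.comp (measurable_const.mul measurable_id)).comp hmeas).aestronglyMeasurable
    · refine (ae_restrict_iff' measurableSet_Ioc).2 (Filter.Eventually.of_forall fun θ hθ => ?_)
      simp only [Function.comp]
      rw [Real.norm_of_nonneg (Real.exp_pos _).le]
      by_cases hz : G (circleMap 0 R θ) = 0
      · simp [hz]
      · have hp : 0 < ‖G (circleMap 0 R θ)‖ := norm_pos_iff.2 hz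
        rw [mul_comm, ← Real.rpow_def_of_pos hp]
        exact le_max_of_le_right (Real.rpow_le_rpow hp.le (hK θ ⟨hθ.1.le, hθ.2⟩) hs.le)
  have h2pi : (0:ℝ) < 2 * π := by positivity
  have : NeZero (volume.restrict (Set.Ioc 0 (2 * π))) := ⟨by
    rw [Ne, Measure.restrict_eq_zero]; simp [Real.pi_pos]⟩
  have hconv : ConvexOn ℝ Set.univ (fun x => Real.exp (s * x)) := by
    have := convexOn_exp.comp_linearMap (LinearMap.mul ℝ ℝ s)
    exact this
  have key := ConvexOn.map_average_le (μ := volume.restrict (Set.Ioc 0 (2 * π))) hconv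
    (by fun_prop) isClosed_univ (by simp) hint1 hint2
  have e1 : Real.circleAverage (fun z => Real.log ‖G z‖) 0 R
     = ⨍ θ in Set.Ioc 0 (2*π), Real.log ‖G (circleMap 0 R θ)‖ := by
    rw [circleAverage_eq_intervalAverage, Set.uIoc_of_le h2pi.le]
  have e2 : Real.circleAverage (fun z => ‖G z‖ ^ s) 0 R
     = ⨍ θ in Set.Ioc 0 (2*π), Real.exp (s * Real.log ‖G (circleMap 0 R θ)‖) := by
    rw [circleAverage_congr_codiscreteWithin (f₂ := fun z => Real.exp (s * Real.log ‖G z‖)) _ hR.ne',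
      circleAverage_eq_intervalAverage, Set.uIoc_of_le h2pi.le]
    have hz : ∀ᶠ x in Filter.codiscreteWithin (Metric.closedBall (0:ℂ) R), G x ≠ 0 := by
      rcases hG.eqOn_zero_or_eventually_ne_zero_of_preconnected
        (convex_closedBall (0:ℂ) R).isPreconnected with h | h
      · exact absurd (h (Metric.mem_closedBall_self hR.le)) h0
      · exact h
    rw [hRabs]
    filter_upwards [Filter.codiscreteWithin_mono Metric.sphere_subset_closedBall hz] with x hx
    rw [mul_comm, ← Real.rpow_def_of_pos (norm_pos_iff.2 hx)]
  rw [e2]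
  refine le_trans ?_ key
  rw [← e1, Real.rpow_def_of_pos (norm_pos_iff.2 h0), mul_comm]
  gcongr

lemma circleMap_arctan (t : ℝ) :
    circleMap 0 1 (π - 2 * Real.arctan t) = (t * I - 1) / (t * I + 1) := by
  have h1 : (t * I + 1 : ℂ) ≠ 0 := by
    intro h; have := congrArg Complex.re h; simp at this
  have hq : 0 < 1 + t ^ 2 := by positivity
  have hsq : (Real.sqrt (1 + t^2) : ℂ) ^ 2 = 1 + t^2 := by
    rw [← Complex.ofReal_pow, Real.sq_sqrt hq.le]; push_cast; ring
  have hs0 : (Real.sqrt (1 + t^2) : ℂ) ≠ 0 := by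
    exact_mod_cast (Real.sqrt_pos.2 hq).ne'
  have e : Complex.exp (-(Real.arctan t) * I) = (1 - t * I) / Real.sqrt (1 + t^2) := by
    rw [Complex.exp_mul_I, Complex.cos_neg, Complex.sin_neg, ← Complex.ofReal_cos, ← Complex.ofReal_sin, Real.cos_arctan,
      Real.sin_arctan]
    push_cast
    field_simp
    ring
  rw [circleMap]
  have : ((π - 2 * Real.arctan t : ℝ) : ℂ) * I = π * I + (-(Real.arctan t) * I + -(Real.arctan t) * I) := by
    push_cast; ring
  rw [this, Complex.exp_add, Complex.exp_add, Complex.exp_pi_mul_I, e]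
  have hI : I ^ 2 = -1 := Complex.I_sq
  field_simp
  rw [hsq]
  simp only [ofReal_one]
  linear_combination ((t:ℂ)^2 - t^3*I) * hI

lemma half_plane_bounded {H : ℂ → ℂ} {K s : ℝ} (hs : 0 < s)
    (hd : DifferentiableOn ℂ H {z | 0 < z.re}) (hc : ContinuousOn H {z | 0 ≤ z.re})
    (hb : ∀ z : ℂ, 0 ≤ z.re → ‖H z‖ ≤ K) :
    ENNReal.ofReal (‖H 1‖ ^ s) ≤
      ∫⁻ t : ℝ, ENNReal.ofReal (1 / (π * (1 + t ^ 2)) * ‖H (t * I)‖ ^ s) := by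
  have hK : 0 ≤ K := (norm_nonneg _).trans (hb 0 (by simp))
  set c : ℂ → ℂ := fun w => (1 + w) / (1 - w) with hcdef
  have hcre : ∀ w : ℂ, w ≠ 1 → (c w).re = (1 - ‖w‖^2) / ‖1 - w‖^2 := by
    intro w hw
    have h1 : (1 - w) ≠ 0 := sub_ne_zero.2 (Ne.symm hw)
    have h2 : Complex.normSq (1 - w) ≠ 0 := by simpa using h1
    simp only [hcdef, Complex.div_re, ← Complex.normSq_eq_norm_sq]
    rw [← add_div]
    congr 1
    simp [Complex.normSq_apply]; ring
  have hcpos : ∀ w : ℂ, ‖w‖ < 1 → 0 < (c w).re := by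
    intro w hw
    have hw1 : w ≠ 1 := by rintro rfl; simp at hw
    rw [hcre w hw1]
    have : 0 < ‖1 - w‖ := norm_pos_iff.2 (sub_ne_zero.2 (Ne.symm hw1))
    have : ‖w‖^2 < 1 := by nlinarith [norm_nonneg w]
    apply div_pos <;> [linarith; positivity]
  have hcnn : ∀ w : ℂ, ‖w‖ ≤ 1 → w ≠ 1 → 0 ≤ (c w).re := by
    intro w hw hw1
    rw [hcre w hw1]
    have : ‖w‖^2 ≤ 1 := by nlinarith [norm_nonneg w]
    apply div_nonneg <;> [linarith; positivity]
  have hccont : ∀ w : ℂ, w ≠ 1 → ContinuousAt c w := by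
    intro w hw
    exact ContinuousAt.div (by fun_prop) (by fun_prop) (sub_ne_zero.2 (Ne.symm hw))
  have hr : ∀ r : ℝ, 0 < r → r < 1 → ‖H 1‖ ^ s ≤ (2 * π)⁻¹ * ∫ θ in 0..2*π, ‖H (c (circleMap 0 r θ))‖ ^ s := by
    intro r hr0 hr1
    have hA : AnalyticOnNhd ℂ (fun w => H (c w)) (Metric.closedBall 0 r) := by
      have : DifferentiableOn ℂ (fun w => H (c w)) (Metric.ball 0 1) := by
        apply hd.comp (t := {z | 0 < z.re})
        · intro w hw
          have hw' : ‖w‖ < 1 := by simpa using hw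
          have hw1 : w ≠ 1 := by rintro rfl; simp at hw'
          exact (DifferentiableAt.div (by fun_prop) (by fun_prop) (sub_ne_zero.2 (Ne.symm hw1))).differentiableWithinAt
        · intro w hw
          exact hcpos w (by simpa using hw)
      exact (this.analyticOnNhd Metric.isOpen_ball).mono (Metric.closedBall_subset_ball hr1)
    have := jensen_disc hr0 hs hA
    simpa [hcdef, circleAverage_def] using this
  have hne1 : ∀ r : ℝ, ∀ θ ∈ Set.Ioo 0 (2*π), 0 < r → r ≤ 1 → circleMap 0 r θ ≠ 1 := by
    intro r θ hθ hr0 hr1 h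
    have hn : ‖circleMap 0 r θ‖ = 1 := by rw [h]; simp
    have : r = 1 := by simpa [abs_of_pos hr0] using hn
    subst this
    rw [circleMap] at h
    simp only [ofReal_one, one_mul, zero_add] at h
    rw [Complex.exp_eq_one_iff] at h
    obtain ⟨n, hn⟩ := h
    have h3 : θ = n * (2 * π) := by
      have := congrArg Complex.im hn
      simpa using this
    have hpi := Real.pi_pos
    have h4 : (0:ℝ) < n := by
      by_contra hcon
      push Not at hcon
      have := hθ.1
      nlinarith
    have h5 : (n:ℝ) < 1 := by
      by_contra hcon
      push Not at hcon
      have := hθ.2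
      nlinarith
    have h6 : (0:ℤ) < n := by exact_mod_cast h4
    have h7 : n < (1:ℤ) := by exact_mod_cast h5
    omega
  have hlim : Filter.Tendsto (fun r : ℝ => ∫ θ in 0..2*π, ‖H (c (circleMap 0 r θ))‖ ^ s)
      (nhdsWithin 1 (Set.Iio 1)) (nhds (∫ θ in 0..2*π, ‖H (c (circleMap 0 1 θ))‖ ^ s)) := by
    have hIoo : ∀ᶠ r : ℝ in nhdsWithin 1 (Set.Iio 1), r ∈ Set.Ioo (0:ℝ) 1 := Ioo_mem_nhdsLT (by norm_num)
    have hae : ∀ᵐ θ : ℝ, θ ≠ 2 * π := by simp [ae_iff]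
    apply intervalIntegral.tendsto_integral_filter_of_dominated_convergence (fun _ => K ^ s)
    · filter_upwards [hIoo] with r hr
      apply Continuous.aestronglyMeasurable
      have : Continuous fun θ => H (c (circleMap 0 r θ)) := by
        have hcm : ∀ θ, ‖circleMap 0 r θ‖ < 1 := by intro θ; simp [abs_of_pos hr.1, hr.2]
        apply hc.comp_continuous
        · rw [continuous_iff_continuousAt]
          intro θ
          have hw1 : circleMap 0 r θ ≠ 1 := by intro h; have := hcm θ; rw [h] at this; simp at this
          exact ContinuousAt.comp (hccont _ hw1) (continuous_circleMap 0 r).continuousAt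
        · intro θ
          exact (hcpos _ (hcm θ)).le
      exact this.norm.rpow_const (fun _ => Or.inr hs.le)
    · filter_upwards [hIoo] with r hr
      filter_upwards with θ hθ
      rw [Real.norm_of_nonneg (by positivity)]
      have hcm : ‖circleMap 0 r θ‖ < 1 := by simp [abs_of_pos hr.1, hr.2]
      exact Real.rpow_le_rpow (norm_nonneg _) (hb _ (hcpos _ hcm).le) hs.le
    · simp
    · filter_upwards [hae] with θ hθ2 hθ
      rw [Set.uIoc_of_le (by positivity)] at hθ
      have hθ' : θ ∈ Set.Ioo 0 (2*π) := ⟨hθ.1, lt_of_le_of_ne hθ.2 hθ2⟩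
      have hw1 := hne1 1 θ hθ' one_pos le_rfl
      have hcont0 : ContinuousWithinAt H {z | 0 ≤ z.re} (c (circleMap 0 1 θ)) :=
        hc _ (hcnn _ (by simp) hw1)
      have ht : Filter.Tendsto (fun r : ℝ => c (circleMap 0 r θ)) (nhdsWithin 1 (Set.Iio 1))
          (nhdsWithin (c (circleMap 0 1 θ)) {z | 0 ≤ z.re}) := by
        apply tendsto_nhdsWithin_of_tendsto_nhds_of_eventually_within
        · apply Filter.Tendsto.mono_left _ nhdsWithin_le_nhds
          have : ContinuousAt (fun r : ℝ => c (circleMap 0 r θ)) 1 := by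
            apply ContinuousAt.comp (f := fun r : ℝ => circleMap 0 r θ) (hccont _ hw1)
            unfold circleMap
            fun_prop
          exact this
        · filter_upwards [hIoo] with r hr
          exact (hcpos _ (by simp [abs_of_pos hr.1, hr.2])).le
      have := (hcont0.tendsto.comp ht).norm.rpow_const (p := s) (Or.inr hs.le)
      simpa using this
  have hfin : ‖H 1‖ ^ s ≤ (2 * π)⁻¹ * ∫ θ in 0..2*π, ‖H (c (circleMap 0 1 θ))‖ ^ s := by
    refine ge_of_tendsto (hlim.const_mul _) ?_
    filter_upwards [Ioo_mem_nhdsLT (show (0:ℝ) < 1 by norm_num)] with r hr'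
    exact hr r hr'.1 hr'.2
  have himg : (fun t : ℝ => π - 2 * Real.arctan t) '' Set.univ = Set.Ioo 0 (2*π) := by
    ext θ
    simp only [Set.image_univ, Set.mem_range, Set.mem_Ioo]
    constructor
    · rintro ⟨t, rfl⟩
      have := Real.arctan_lt_pi_div_two t
      have := Real.neg_pi_div_two_lt_arctan t
      constructor <;> linarith
    · rintro ⟨h1, h2⟩
      refine ⟨Real.tan ((π - θ)/2), ?_⟩
      rw [Real.arctan_tan (by linarith) (by linarith)]
      ring
  have hcv : ∫ θ in 0..2*π, ‖H (c (circleMap 0 1 θ))‖ ^ s = ∫ t : ℝ, 2 / (1 + t^2) * ‖H (t * I)‖ ^ s := by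
    rw [intervalIntegral.integral_of_le (by positivity), integral_Ioc_eq_integral_Ioo, ← himg,
      integral_image_eq_integral_abs_deriv_smul (f' := fun t => - (2 * (1 / (1 + t^2)))) MeasurableSet.univ]
    · rw [setIntegral_univ]
      congr 1; ext t
      have e1 : c (circleMap 0 1 (π - 2 * Real.arctan t)) = t * I := by
        have h1 : (t * I + 1 : ℂ) ≠ 0 := by
          intro h; have := congrArg Complex.re h; simp at this
        have h2 : 1 - (t * I - 1) / (t * I + 1) = 2 / (t * I + 1) := by field_simp; ring
        simp only [hcdef]
        rw [circleMap_arctan, h2]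
        field_simp
        ring
      rw [e1, abs_neg, abs_of_pos (by positivity), smul_eq_mul]
      ring
    · intro t _
      exact (((Real.hasDerivAt_arctan t).const_mul 2).const_sub π).hasDerivWithinAt
    · intro a _ b _ hab
      simp only at hab
      exact Real.arctan_injective (by linarith)
  have hIntg : Integrable fun t : ℝ => 1 / (π * (1 + t ^ 2)) * ‖H (t * I)‖ ^ s := by
    have h1 : Integrable fun t : ℝ => (1 + t^2)⁻¹ * (π⁻¹ * K ^ s) := integrable_inv_one_add_sq.mul_const _
    have hcH : Continuous fun t : ℝ => H (t * I) :=
      hc.comp_continuous (by fun_prop) (by intro t; simp)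
    refine h1.mono' ?_ (Filter.Eventually.of_forall fun t => ?_)
    · apply Continuous.aestronglyMeasurable
      apply Continuous.mul
      · apply Continuous.div continuous_const (by fun_prop)
        intro t; positivity
      · exact hcH.norm.rpow_const (fun _ => Or.inr hs.le)
    · rw [Real.norm_of_nonneg (by positivity)]
      have : ‖H (t*I)‖ ^ s ≤ K ^ s := Real.rpow_le_rpow (norm_nonneg _) (hb _ (by simp)) hs.le
      calc 1 / (π * (1 + t ^ 2)) * ‖H (t * I)‖ ^ s ≤ 1 / (π * (1 + t ^ 2)) * K ^ s := by gcongr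
        _ = _ := by field_simp
  rw [← ofReal_integral_eq_lintegral_ofReal hIntg (Filter.Eventually.of_forall fun t => by positivity)]
  apply ENNReal.ofReal_le_ofReal
  refine hfin.trans (le_of_eq ?_)
  rw [hcv, ← integral_const_mul]
  congr 1; ext t
  field_simp


lemma kappa_bound : ∃ κ : ℝ, 0 < κ ∧ ∀ z : ℂ, 0 ≤ z.re →
    κ * ‖z‖ ^ (3/4:ℝ) ≤ (z ^ (((3/4:ℝ)) : ℂ)).re := by
  refine ⟨Real.cos (3*π/8), Real.cos_pos_of_mem_Ioo ⟨by linarith [pi_pos], by linarith [pi_pos]⟩, ?_⟩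
  intro z hz
  rw [cpow_ofReal_re, mul_comm]
  refine mul_le_mul_of_nonneg_left ?_ (by positivity)
  have h := abs_arg_le_pi_div_two_iff.2 hz
  rw [← Real.cos_abs (arg z * _)]
  rw [abs_mul, abs_of_pos (by norm_num : (0:ℝ) < 3/4)]
  apply Real.cos_le_cos_of_nonneg_of_le_pi (by positivity) (by linarith [pi_pos])
  linarith

lemma exp_bound_aux (B δ : ℝ) (hB : 0 ≤ B) (hδ : 0 < δ) (w : ℝ) (hw : 0 ≤ w) :
    B * w^2 - δ * w^3 ≤ B * (B/δ)^2 := by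
  rcases le_total w (B/δ) with h | h
  · have : w^2 ≤ (B/δ)^2 := by gcongr
    have h3 : 0 ≤ δ * w^3 := by positivity
    nlinarith
  · rw [div_le_iff₀ hδ] at h
    have : 0 ≤ B * (B/δ)^2 := by positivity
    nlinarith [mul_nonneg (sq_nonneg w) (sub_nonneg.2 h)]

lemma half_plane_growth {H : ℂ → ℂ} {C B s : ℝ} (hs : 0 < s) (hC : 0 ≤ C) (hB : 0 ≤ B)
    (hd : DifferentiableOn ℂ H {z | 0 < z.re}) (hc : ContinuousOn H {z | 0 ≤ z.re})
    (hb : ∀ z : ℂ, 0 ≤ z.re → ‖H z‖ ≤ C * Real.exp (B * ‖z‖ ^ (1/2:ℝ))) :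
    ENNReal.ofReal (‖H 1‖ ^ s) ≤
      ∫⁻ t : ℝ, ENNReal.ofReal (1 / (π * (1 + t^2)) * ‖H (t * I)‖ ^ s) := by
  obtain ⟨κ, hκ, hk⟩ := kappa_bound
  have key : ∀ ε : ℝ, 0 < ε → ENNReal.ofReal ((‖H 1‖ * Real.exp (-ε)) ^ s) ≤
      ∫⁻ t : ℝ, ENNReal.ofReal (1 / (π * (1 + t^2)) * ‖H (t * I)‖ ^ s) := by
    intro ε hε
    set G : ℂ → ℂ := fun z => H z * Complex.exp (-ε * z ^ ((3/4:ℝ) : ℂ)) with hG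
    have hGn : ∀ z, ‖G z‖ = ‖H z‖ * Real.exp (-(ε * (z ^ ((3/4:ℝ) : ℂ)).re)) := by
      intro z
      rw [hG]; simp only [norm_mul, Complex.norm_exp]
      congr 2
      simp [Complex.mul_re]
    have h1 := half_plane_bounded (H := G) (K := C * Real.exp (B * (B/(ε*κ))^2)) hs ?_ ?_ ?_
    · refine le_trans (le_of_eq ?_) (h1.trans ?_)
      · rw [hGn]; simp
      · refine lintegral_mono fun t => ENNReal.ofReal_le_ofReal ?_
        refine mul_le_mul_of_nonneg_left ?_ (by positivity)
        refine Real.rpow_le_rpow (norm_nonneg _) ?_ hs.le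
        rw [hGn]
        refine mul_le_of_le_one_right (norm_nonneg _) ?_
        rw [Real.exp_le_one_iff, neg_nonpos]
        refine mul_nonneg hε.le (le_trans ?_ (hk _ (by simp)))
        positivity
    · refine hd.mul ?_
      intro z hz
      refine DifferentiableAt.differentiableWithinAt ?_
      refine DifferentiableAt.cexp ?_
      refine DifferentiableAt.const_mul ?_ _
      refine DifferentiableAt.cpow_const ?_ ?_
      · exact differentiableAt_id
      · left; exact hz
    · refine hc.mul ?_
      intro z hz
      refine ContinuousAt.continuousWithinAt ?_
      refine ContinuousAt.cexp ?_
      refine ContinuousAt.mul continuousAt_const ?_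
      by_cases hz0 : z = 0
      · subst hz0
        exact continuousAt_cpow_const_of_re_pos (Or.inl (le_refl _)) (by simp)
      · exact continuousAt_cpow_const_of_re_pos (Or.inl hz) (by simp)
    · intro z hz
      rw [hGn]
      calc _ ≤ (C * Real.exp (B * ‖z‖ ^ (1/2:ℝ))) * Real.exp (-(ε * (κ * ‖z‖ ^ (3/4:ℝ)))) := by
            gcongr
            · exact hb z hz
            · exact hk z hz
        _ = C * Real.exp (B * ‖z‖ ^ (1/2:ℝ) - ε * κ * ‖z‖ ^ (3/4:ℝ)) := by
            rw [mul_assoc, ← Real.exp_add]; ring_nf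
        _ ≤ _ := by
            gcongr
            have e1 : ‖z‖ ^ (1/2:ℝ) = (‖z‖ ^ (1/4:ℝ))^2 := by
              rw [← Real.rpow_natCast, ← Real.rpow_mul (norm_nonneg _)]; norm_num
            have e2 : ‖z‖ ^ (3/4:ℝ) = (‖z‖ ^ (1/4:ℝ))^3 := by
              rw [← Real.rpow_natCast, ← Real.rpow_mul (norm_nonneg _)]; norm_num
            rw [e1, e2]
            exact exp_bound_aux B (ε*κ) hB (by positivity) _ (by positivity)
  have hlim : Filter.Tendsto (fun ε : ℝ => ENNReal.ofReal ((‖H 1‖ * Real.exp (-ε)) ^ s))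
      (nhdsWithin 0 (Set.Ioi 0)) (nhds (ENNReal.ofReal ((‖H 1‖ * Real.exp (-0)) ^ s))) := by
    refine Filter.Tendsto.mono_left ?_ nhdsWithin_le_nhds
    refine Continuous.tendsto (f := fun ε : ℝ => ENNReal.ofReal ((‖H 1‖ * Real.exp (-ε)) ^ s)) ?_ 0
    refine ENNReal.continuous_ofReal.comp ?_
    exact (by fun_prop : Continuous fun ε : ℝ => ‖H 1‖ * Real.exp (-ε)).rpow_const (fun _ => Or.inr hs.le)
  simp only [neg_zero, Real.exp_zero, mul_one] at hlim
  refine le_of_tendsto hlim ?_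
  filter_upwards [self_mem_nhdsWithin] with ε hε using key ε hε

lemma ExpTypePi.neg {f : ℂ → ℂ} (hf : ExpTypePi f) : ExpTypePi (fun z => f (-z)) := by
  refine ⟨hf.1.comp differentiable_neg, fun ε hε => ?_⟩
  obtain ⟨C, hC, h⟩ := hf.2 ε hε
  exact ⟨C, hC, fun z => by simpa using h (-z)⟩

lemma ExpTypePi.conj {f : ℂ → ℂ} (hf : ExpTypePi f) :
    ExpTypePi (fun z => starRingEnd ℂ (f (starRingEnd ℂ z))) := by
  refine ⟨fun z => ?_, fun ε hε => ?_⟩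
  · have := (hf.1 (starRingEnd ℂ z)).star_star
    simpa [Function.comp_def] using this
  obtain ⟨C, hC, h⟩ := hf.2 ε hε
  exact ⟨C, hC, fun z => by simpa using h (starRingEnd ℂ z)⟩


lemma root_aux {z w : ℂ} (h : 0 < z.re + z.im) (hw : w = -2 * I * z^2) :
    (1 + I)/2 * w ^ (2⁻¹ : ℂ) = z := by
  have h1 : ((1 - I) * z) ^ (2:ℕ) = w := by
    rw [hw, mul_pow]
    have : (1 - I)^2 = -2 * I := by ring_nf; simp; ring
    rw [this]
  rw [← h1, sq_cpow_two_inv (by simpa using h)]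
  have : (1 + I)/2 * (1 - I) = 1 := by ring_nf; simp; norm_num
  rw [← mul_assoc, this, one_mul]

lemma quarter_aux {f : ℂ → ℂ} (hf : ExpTypePi f) {p : ℝ} (hp : 0 < p) :
    ∃ C : ℝ, 0 < C ∧ ∀ a : ℝ, 0 < a →
      ENNReal.ofReal ((‖f (a + I)‖ * Real.exp (-(π+1))) ^ p) ≤
        (∫⁻ x : ℝ, (‖f x‖₊ : ℝ≥0∞) ^ p) + ENNReal.ofReal (C ^ p) := by
  obtain ⟨C, hC, hfC⟩ := hf.2 1 one_pos
  refine ⟨C, hC, fun a ha => ?_⟩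
  set F : ℂ → ℂ := fun z => f z * Complex.exp (I * (π+1) * z) with hF
  have hFn : ∀ z, ‖F z‖ = ‖f z‖ * Real.exp (-((π+1) * z.im)) := by
    intro z
    simp only [hF, norm_mul, Complex.norm_exp]
    congr 2
    simp [Complex.mul_re]
  have hFd : Differentiable ℂ F := by
    refine hf.1.mul ?_
    fun_prop
  set W : ℂ → ℂ := fun ζ => -2 * I * (a^2 - 1 + 2*a*I*ζ) with hW
  have hWre : ∀ ζ, (W ζ).re = 4 * a * ζ.re := by
    intro ζ; simp [hW, pow_two]; ring
  set H : ℂ → ℂ := fun ζ => F ((1 + I)/2 * (W ζ) ^ (2⁻¹ : ℂ)) with hH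
  have hH1 : H 1 = F (a + I) := by
    simp only [hH]; rw [root_aux (z := a + I)]
    · simp; linarith
    · simp only [hW]; ring_nf; simp; ring
  have hWn : ∀ ζ, ‖W ζ‖ ≤ 4 * a * ‖ζ‖ + 2 * |a^2-1| := by
    intro ζ
    have : W ζ = ((4*a : ℝ) : ℂ) * ζ + (-2 * I) * ((a^2-1 : ℝ) : ℂ) := by
      simp only [hW]; push_cast; ring_nf; simp
    rw [this]
    refine (norm_add_le _ _).trans ?_
    rw [norm_mul, norm_mul, norm_real, norm_real, Real.norm_eq_abs, Real.norm_eq_abs, abs_of_pos (by positivity : 0 < 4*a)]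
    simp
  have main := half_plane_growth (H := H) (C := C * Real.exp ((2*(π+1)) * (2 * |a^2-1|)^(1/2:ℝ)))
    (B := (2*(π+1)) * (4*a)^(1/2:ℝ)) hp (by positivity) (by positivity) ?_ ?_ ?_
  · rw [hH1, hFn] at main
    have e : -((π+1) * ((a:ℂ) + I).im) = -(π+1) := by simp
    rw [e] at main
    refine main.trans ?_
    set t0 : ℝ := (a^2-1)/(2*a) with ht0
    rw [← lintegral_add_compl _ (measurableSet_Iio (a := t0))]
    refine add_le_add ?_ ?_
    · set φ : ℝ → ℝ := fun x => (a^2 - 1 - x^2)/(2*a) with hφ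
      have him : φ '' Set.Ioi 0 = Set.Iio t0 := by
        ext t
        simp only [Set.mem_image, Set.mem_Ioi, Set.mem_Iio, hφ, ht0]
        constructor
        · rintro ⟨x, hx, rfl⟩
          refine div_lt_div_of_pos_right ?_ (by positivity)
          nlinarith
        · intro ht
          rw [lt_div_iff₀ (by positivity)] at ht
          refine ⟨√(a^2-1-t*(2*a)), Real.sqrt_pos.2 (by linarith), ?_⟩
          rw [Real.sq_sqrt (by linarith)]
          field_simp
          ring
      have hder : ∀ x ∈ Set.Ioi (0:ℝ), HasDerivWithinAt φ (-(2*x)/(2*a)) (Set.Ioi 0) x := by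
        intro x _
        have : HasDerivAt φ ((0 - 2*x)/(2*a)) x := by
          have h2 : HasDerivAt (fun x : ℝ => x^2) (2*x) x := by simpa using hasDerivAt_pow 2 x
          exact ((hasDerivAt_const x (a^2-1)).sub h2).div_const (2*a)
        rw [zero_sub] at this
        exact this.hasDerivWithinAt
      have hinj : Set.InjOn φ (Set.Ioi 0) := by
        intro x hx y hy hxy
        simp only [hφ] at hxy
        have h3 : x^2 = y^2 := by field_simp at hxy; linarith
        exact (pow_left_inj₀ (le_of_lt hx) (le_of_lt hy) two_ne_zero).1 h3
      rw [← him, lintegral_image_eq_lintegral_abs_deriv_mul measurableSet_Ioi hder hinj]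
      refine le_trans ?_ (setLIntegral_le_lintegral (Set.Ioi 0) _)
      refine setLIntegral_mono' measurableSet_Ioi fun x hx => ?_
      have hx0 : (0:ℝ) < x := hx
      have hHx : H ((φ x : ℝ) * I) = F x := by
        simp only [hH]; rw [root_aux (z := x)]
        · simpa using hx0
        · simp only [hW, hφ]; 
          have hac : (a:ℂ) ≠ 0 := by exact_mod_cast ha.ne'
          push_cast
          field_simp
          ring_nf; simp
      rw [hHx, hFn]
      simp only [ofReal_im, mul_zero, neg_zero, Real.exp_zero, mul_one]
      have hpow : (‖f x‖₊ : ℝ≥0∞) ^ p = ENNReal.ofReal (‖f x‖ ^ p) := by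
        rw [← ENNReal.ofReal_rpow_of_nonneg (norm_nonneg _) hp.le, ofReal_norm]; rfl
      rw [hpow, ← ENNReal.ofReal_mul (abs_nonneg _)]
      refine ENNReal.ofReal_le_ofReal ?_
      rw [← mul_assoc]
      refine mul_le_of_le_one_left (by positivity) ?_
      have e1 : |-(2*x)/(2*a)| = x/a := by
        rw [neg_div, abs_neg, abs_of_pos (by positivity)]; field_simp
      rw [e1]
      have e2 : x/a * (1/(π*(1+(φ x)^2))) = 4*a*x/(π*(4*a^2 + (a^2-1-x^2)^2)) := by
        simp only [hφ]; field_simp; ring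
      rw [e2, div_le_one (by positivity)]
      have : 4*a*x ≤ 1 * (4*a^2 + (a^2-1-x^2)^2) := by
        nlinarith [sq_nonneg (a^2-1-x^2), sq_nonneg (a-x), sq_nonneg (a^2 - x^2), sq_nonneg (2*a^2-1-2*x^2), sq_nonneg ((x-a)*(x+a)), mul_nonneg (sq_nonneg (x-a)) (sq_nonneg (x+a)), mul_pos ha hx0]
      refine this.trans ?_
      gcongr
      linarith [pi_gt_three]
    · have hle : ∀ t ∈ (Set.Iio t0)ᶜ, ENNReal.ofReal (1 / (π * (1 + t^2)) * ‖H (t * I)‖ ^ p) ≤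
          ENNReal.ofReal (C^p) * ENNReal.ofReal (1 / (π * (1 + t^2))) := by
        intro t ht
        have ht' : t0 ≤ t := by simpa using ht
        rw [← ENNReal.ofReal_mul (by positivity), mul_comm (C^p)]
        refine ENNReal.ofReal_le_ofReal ?_
        gcongr
        rw [ht0, div_le_iff₀ (by positivity)] at ht'
        set y : ℝ := √(t*(2*a) - (a^2-1)) with hy
        have hy2 : y^2 = t*(2*a) - (a^2-1) := Real.sq_sqrt (by linarith)
        have hHy : H (t * I) = F (y * I) := by
          rcases (Real.sqrt_nonneg (t*(2*a) - (a^2-1))).eq_or_lt with h0 | h0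
          · rw [← hy] at h0
            have hw0 : W (t*I) = 0 := by
              rw [← h0] at hy2
              have h4 : (a:ℂ)^2 - 1 = 2*a*t := by
                have : a^2-1 = 2*a*t := by nlinarith
                exact_mod_cast this
              simp only [hW]; rw [h4]; ring_nf; simp
            simp only [hH]; rw [hw0, ← h0]; simp
          · simp only [hH]; rw [root_aux (z := y * I)]
            · rw [← hy] at h0; simpa only [mul_re, mul_im, ofReal_re, ofReal_im, I_re, I_im, mul_zero, mul_one, sub_zero, add_zero, zero_add] using h0
            · simp only [hW]
              have h4 : (a:ℂ)^2 - 1 = 2*a*t - y^2 := by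
                have : a^2-1 = 2*a*t - y^2 := by nlinarith
                exact_mod_cast this
              rw [h4]; ring_nf; simp
        rw [hHy, hFn]
        have := hfC (y * I)
        have hyn : ‖(y:ℂ) * I‖ = y := by
          rw [norm_mul, norm_real, Complex.norm_I, mul_one, Real.norm_eq_abs, abs_of_nonneg (Real.sqrt_nonneg _)]
        rw [hyn] at this
        calc _ ≤ C * Real.exp ((π+1)*y) * Real.exp (-((π+1) * y)) := by
              simp only [mul_im, ofReal_re, I_im, mul_one, ofReal_im, I_re, mul_zero, add_zero]
              gcongr
          _ = C := by rw [mul_assoc, ← Real.exp_add]; simp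
      refine (setLIntegral_mono' measurableSet_Iio.compl hle).trans ?_
      refine (setLIntegral_le_lintegral _ _).trans ?_
      rw [lintegral_const_mul' _ _ ENNReal.ofReal_ne_top]
      refine mul_le_of_le_one_right' ?_
      rw [← ofReal_integral_eq_lintegral_ofReal]
      · have : ∫ t : ℝ, 1 / (π * (1 + t^2)) = 1 := by
          have e : (fun t : ℝ => 1/(π*(1+t^2))) = fun t : ℝ => (1/π) * (1+t^2)⁻¹ := by
            ext t; rw [one_div_mul_eq_div, ← one_div, div_div, mul_comm]
          rw [e, integral_const_mul, integral_univ_inv_one_add_sq]; field_simp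
        rw [this]; simp
      · have e : (fun t : ℝ => 1/(π*(1+t^2))) = fun t : ℝ => (1/π) * (1+t^2)⁻¹ := by
            ext t; rw [one_div_mul_eq_div, ← one_div, div_div, mul_comm]
        rw [e]; exact integrable_inv_one_add_sq.const_mul _
      · filter_upwards with t; positivity
  · intro ζ hζ
    refine DifferentiableAt.differentiableWithinAt ?_
    refine (hFd _).comp ζ ?_
    refine DifferentiableAt.const_mul ?_ _
    refine DifferentiableAt.cpow_const ?_ ?_
    · simp only [hW]; fun_prop
    · left; rw [hWre]; exact mul_pos (by positivity) hζ
  · intro ζ hζ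
    refine ContinuousAt.continuousWithinAt ?_
    refine hFd.continuous.continuousAt.comp ?_
    refine ContinuousAt.mul continuousAt_const ?_
    have h1 : ContinuousAt (fun w : ℂ => w ^ (2⁻¹:ℂ)) (W ζ) :=
      continuousAt_cpow_const_of_re_pos (Or.inl (by rw [hWre]; exact mul_nonneg (by positivity) hζ)) (by simp)
    exact ContinuousAt.comp (g := fun w : ℂ => w ^ (2⁻¹:ℂ)) h1 (by simp only [hW]; fun_prop)
  · intro ζ hζ
    have hz : ∀ z, ‖F z‖ ≤ C * Real.exp (2*(π+1)*‖z‖) := by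
      intro z
      rw [hFn]
      calc _ ≤ C * Real.exp ((π+1)*‖z‖) * Real.exp ((π+1)*‖z‖) := by
            gcongr
            · exact hfC z
            · rw [← mul_neg]
              gcongr
              exact (neg_le_abs _).trans (abs_im_le_norm z)
        _ = _ := by rw [mul_assoc, ← Real.exp_add]; ring_nf
    refine (hz _).trans ?_
    rw [mul_assoc C, ← Real.exp_add]
    gcongr
    rw [mul_assoc (2*(π+1)), ← mul_add]
    gcongr
    rw [norm_mul]
    have h1 : ‖(1 + I)/2‖ ≤ 1 := by
      rw [norm_div]; 
      have := norm_add_le (1:ℂ) I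
      simp at this ⊢
      linarith
    have h2 : ‖W ζ ^ (2⁻¹:ℂ)‖ = ‖W ζ‖ ^ (1/2:ℝ) := by
      have : (2⁻¹:ℂ) = (((1/2:ℝ)):ℂ) := by push_cast; norm_num
      rw [this, norm_cpow_real]
    rw [h2]
    calc _ ≤ 1 * (4 * a * ‖ζ‖ + 2 * |a^2-1|) ^ (1/2:ℝ) := by
          gcongr
          exact hWn ζ
      _ ≤ (4*a*‖ζ‖)^(1/2:ℝ) + (2 * |a^2-1|)^(1/2:ℝ) := by
          rw [one_mul]
          exact Real.rpow_add_le_add_rpow (by positivity) (by positivity) (by norm_num) (by norm_num)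
      _ = _ := by rw [Real.mul_rpow (by positivity) (by positivity)]; ring


lemma bdd_line_pos {f : ℂ → ℂ} (hf : ExpTypePi f) {p : ℝ} (hp : 0 < p)
    (hI : (∫⁻ x : ℝ, (‖f x‖₊ : ℝ≥0∞) ^ p) < ⊤) :
    ∃ K : ℝ, 0 ≤ K ∧ ∀ a : ℝ, 0 < a → ‖f (a + I)‖ ≤ K := by
  obtain ⟨C, hC, h⟩ := quarter_aux hf hp
  set M := (∫⁻ x : ℝ, (‖f x‖₊ : ℝ≥0∞) ^ p) + ENNReal.ofReal (C ^ p) with hM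
  have hMt : M ≠ ⊤ := by simp [hM, hI.ne]
  refine ⟨M.toReal ^ (1/p) * Real.exp (π+1), by positivity, fun a ha => ?_⟩
  have h1 := h a ha
  rw [ENNReal.ofReal_le_iff_le_toReal hMt] at h1
  have h2 : ‖f (a + I)‖ * Real.exp (-(π+1)) ≤ M.toReal ^ (1/p) := by
    have := Real.rpow_le_rpow (by positivity) h1 (by positivity : 0 ≤ 1/p)
    rwa [← Real.rpow_mul (by positivity), mul_one_div_cancel hp.ne', Real.rpow_one] at this
  calc _ = ‖f (a + I)‖ * Real.exp (-(π+1)) * Real.exp (π+1) := by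
        rw [mul_assoc, ← Real.exp_add]; simp
    _ ≤ _ := by gcongr

lemma lintegral_neg_comp {f : ℂ → ℂ} {p : ℝ} :
    (∫⁻ x : ℝ, (‖f (-(x:ℂ))‖₊ : ℝ≥0∞) ^ p) = ∫⁻ x : ℝ, (‖f x‖₊ : ℝ≥0∞) ^ p := by
  have := lintegral_neg_eq_self (μ := (volume : Measure ℝ)) (fun x : ℝ => (‖f x‖₊ : ℝ≥0∞) ^ p)
  simpa using this

lemma bdd_line {f : ℂ → ℂ} (hf : ExpTypePi f) {p : ℝ} (hp : 0 < p)
    (hI : (∫⁻ x : ℝ, (‖f x‖₊ : ℝ≥0∞) ^ p) < ⊤) :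
    ∃ K : ℝ, 0 ≤ K ∧ ∀ a : ℝ, ‖f (a + I)‖ ≤ K := by
  obtain ⟨K1, h1, hK1⟩ := bdd_line_pos hf hp hI
  obtain ⟨K2, h2, hK2⟩ := bdd_line_pos hf.neg.conj hp (by
    have := lintegral_neg_comp (f := f) (p := p)
    refine lt_of_eq_of_lt ?_ hI
    rw [← this]
    simp)
  refine ⟨K1 + K2 + ‖f I‖, by positivity, fun a => ?_⟩
  rcases lt_trichotomy a 0 with h | h | h
  · have := hK2 (-a) (by linarith)
    simp at this
    rw [add_comm] at this
    linarith [norm_nonneg (f I)]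
  · subst h; simp; linarith
  · have := hK1 a h
    linarith [norm_nonneg (f I)]

lemma bdd_real {f : ℂ → ℂ} (hf : ExpTypePi f) {p : ℝ} (hp : 0 < p)
    (hI : (∫⁻ x : ℝ, (‖f x‖₊ : ℝ≥0∞) ^ p) < ⊤) :
    ∃ K : ℝ, 0 ≤ K ∧ ∀ x : ℝ, ‖f x‖ ≤ K := by
  obtain ⟨K1, h1, hK1⟩ := bdd_line hf hp hI
  obtain ⟨K2, h2, hK2⟩ := bdd_line hf.neg hp (by rw [lintegral_neg_comp]; exact hI)
  obtain ⟨C, hC, hfC⟩ := hf.2 1 one_pos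
  refine ⟨K1 + K2, by positivity, fun x => ?_⟩
  refine PhragmenLindelof.horizontal_strip (a := -1) (b := 1) (z := x) hf.1.diffContOnCl ?_ ?_ ?_
    (by simp) (by simp)
  · refine ⟨1, ?_, π+1, ?_⟩
    · have := pi_gt_three
      linarith
    · refine Asymptotics.IsBigO.of_bound C ?_
      refine Filter.Eventually.filter_mono inf_le_right ?_
      rw [Filter.eventually_principal]
      intro z hz
      refine (hfC z).trans ?_
      rw [Real.norm_eq_abs, Real.abs_exp]
      gcongr
      have h3 : |z.im| ≤ 1 := abs_le.2 ⟨le_of_lt hz.1, le_of_lt hz.2⟩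
      calc ‖z‖ ≤ |z.re| + |z.im| := norm_le_abs_re_add_abs_im z
        _ ≤ 1 * |z.re| + 1 := by linarith
        _ ≤ _ := Real.add_one_le_exp _
  · intro z hz
    have := hK2 (-z.re)
    have e : -(((-z.re : ℝ):ℂ) + I) = z := by
      apply Complex.ext <;> simp [hz]
    simp only [e] at this
    linarith
  · intro z hz
    have := hK1 (z.re)
    have e : (((z.re : ℝ):ℂ) + I) = z := by
      apply Complex.ext <;> simp [hz]
    simp only [e] at this
    linarith

lemma PL_upper {f : ℂ → ℂ} (hf : ExpTypePi f) {M : ℝ} (hM : ∀ x : ℝ, ‖f x‖ ≤ M)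
    (z : ℂ) (hz : 0 ≤ z.im) : ‖f z‖ ≤ M * Real.exp (π * z.im) := by
  have hM0 : 0 ≤ M := (norm_nonneg _).trans (hM 0)
  have key : ∀ ε : ℝ, 0 < ε → ‖f z‖ ≤ M * Real.exp ((π + ε) * z.im) := by
    intro ε hε
    obtain ⟨C, hC, hfC⟩ := hf.2 ε hε
    set g : ℂ → ℂ := fun w => f (I * w) * Complex.exp (-(π + ε) * w) with hg
    have hgn : ∀ w, ‖g w‖ = ‖f (I * w)‖ * Real.exp (-((π+ε) * w.re)) := by
      intro w
      simp only [hg, norm_mul, Complex.norm_exp]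
      congr 2
      simp [Complex.mul_re]; ring
    have := PhragmenLindelof.right_half_plane_of_bounded_on_real (f := g) (C := M) (z := -I * z) ?_ ?_ ?_ ?_ ?_
    · rw [hgn] at this
      have e : I * (-I * z) = z := by ring_nf; simp
      rw [e] at this
      have e2 : (-I * z).re = z.im := by simp
      rw [e2] at this
      calc ‖f z‖ = ‖f z‖ * Real.exp (-((π+ε)*z.im)) * Real.exp ((π+ε)*z.im) := by
            rw [mul_assoc, ← Real.exp_add]; simp
        _ ≤ _ := by gcongr
    · refine Differentiable.diffContOnCl ?_
      refine Differentiable.mul (hf.1.comp (by fun_prop)) (by fun_prop)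
    · refine ⟨1, by norm_num, 2*(π+ε), ?_⟩
      refine Asymptotics.IsBigO.of_bound C ?_
      filter_upwards with w
      rw [hgn, Real.norm_eq_abs, Real.abs_exp, Real.rpow_one]
      calc _ ≤ C * Real.exp ((π+ε)*‖w‖) * Real.exp ((π+ε)*‖w‖) := by
            gcongr
            · have := hfC (I * w)
              simpa using this
            · rw [← mul_neg]
              gcongr
              exact (neg_le_abs _).trans (abs_re_le_norm w)
        _ = _ := by rw [mul_assoc, ← Real.exp_add]; ring_nf
    · refine ⟨C, ?_⟩
      rw [Filter.eventually_map]
      filter_upwards [Filter.eventually_ge_atTop 0] with x hx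
      rw [hgn]
      calc _ ≤ C * Real.exp ((π+ε)*x) * Real.exp (-((π+ε)*x)) := by
            rw [ofReal_re]
            gcongr
            have := hfC (I * x)
            simpa [abs_of_nonneg hx] using this
        _ = C := by rw [mul_assoc, ← Real.exp_add]; simp
    · intro x
      rw [hgn]
      have e : I * (x * I) = ((-x : ℝ) : ℂ) := by push_cast; ring_nf; simp
      rw [e]
      simpa using hM (-x)
    · simpa using hz
  have hlim : Filter.Tendsto (fun ε : ℝ => M * Real.exp ((π + ε) * z.im))
      (nhdsWithin 0 (Set.Ioi 0)) (nhds (M * Real.exp ((π + 0) * z.im))) := by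
    refine Filter.Tendsto.mono_left ?_ nhdsWithin_le_nhds
    exact Continuous.tendsto (f := fun ε : ℝ => M * Real.exp ((π + ε) * z.im)) (by fun_prop) 0
  rw [add_zero] at hlim
  refine ge_of_tendsto hlim ?_
  filter_upwards [self_mem_nhdsWithin] with ε hε using key ε hε

lemma PL_full {f : ℂ → ℂ} (hf : ExpTypePi f) {M : ℝ} (hM : ∀ x : ℝ, ‖f x‖ ≤ M)
    (z : ℂ) : ‖f z‖ ≤ M * Real.exp (π * |z.im|) := by
  rcases le_total 0 z.im with h | h
  · rw [abs_of_nonneg h]; exact PL_upper hf hM z h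
  · rw [abs_of_nonpos h]
    have := PL_upper hf.neg (M := M) (fun x => by simpa using hM (-x)) (-z) (by simpa using h)
    simpa using this

lemma KL {f : ℂ → ℂ} (hf : ExpTypePi f) {M : ℝ} (hM : ∀ x : ℝ, ‖f x‖ ≤ M)
    {s : ℝ} (hs : 0 < s) (x y : ℝ) (hy : 0 < y) :
    ENNReal.ofReal ((‖f (x + y * I)‖ * Real.exp (-(π * y))) ^ s) ≤
      ∫⁻ t : ℝ, ENNReal.ofReal (1 / (π * (1 + t^2)) * ‖f ((x - y * t : ℝ))‖ ^ s) := by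
  have hM0 : 0 ≤ M := (norm_nonneg _).trans (hM 0)
  set H : ℂ → ℂ := fun ζ => f (x + y * I * ζ) * Complex.exp (-(π * y * ζ)) with hH
  have hHn : ∀ ζ, ‖H ζ‖ = ‖f (x + y * I * ζ)‖ * Real.exp (-(π * y * ζ.re)) := by
    intro ζ
    simp only [hH, norm_mul, Complex.norm_exp]
    congr 2
    simp [Complex.mul_re]
  have hHd : Differentiable ℂ H := Differentiable.mul (hf.1.comp (by fun_prop)) (by fun_prop)
  have main := half_plane_bounded (H := H) (K := M) hs hHd.differentiableOn hHd.continuous.continuousOn ?_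
  · rw [hHn] at main
    simp only [mul_one, one_re] at main
    refine main.trans (le_of_eq ?_)
    congr 1; ext t
    rw [hHn]
    have e : (x:ℂ) + y * I * (t * I) = ((x - y*t : ℝ) : ℂ) := by
      push_cast; ring_nf; simp; ring
    rw [e]
    simp
  · intro ζ hζ
    rw [hHn]
    have := PL_upper hf hM (x + y * I * ζ) (by simp; positivity)
    have e : ((x:ℂ) + y * I * ζ).im = y * ζ.re := by simp
    rw [e] at this
    calc _ ≤ M * Real.exp (π * (y * ζ.re)) * Real.exp (-(π * y * ζ.re)) := by gcongr
      _ = M := by rw [mul_assoc, ← Real.exp_add]; ring_nf; simp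


/-- Upper half plane part of the weighted norm. -/
noncomputable def Nplus (α : ℝ) (f : ℂ → ℂ) : ℝ≥0∞ :=
  ∫⁻ y in Set.Ioi (0:ℝ), ∫⁻ x : ℝ, ENNReal.ofReal (Real.exp (-(π * y)) * y ^ α) * (‖f (x + y * I)‖₊ : ℝ≥0∞)

lemma N_split (α : ℝ) {f : ℂ → ℂ} (hf : Continuous f) :
    (∫⁻ z : ℂ, ENNReal.ofReal
            (Real.exp (-Real.pi * |z.im|) * |z.im| ^ α) * (‖f z‖₊ : ℝ≥0∞)) =
      Nplus α f + Nplus α (fun z => f (-z)) := by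
  have hmeas : Measurable (fun z : ℂ => ENNReal.ofReal
            (Real.exp (-Real.pi * |z.im|) * |z.im| ^ α) * (‖f z‖₊ : ℝ≥0∞)) := by
    refine Measurable.mul ?_ hf.nnnorm.measurable.coe_nnreal_ennreal
    refine Measurable.ennreal_ofReal ?_
    have h1 : Measurable fun z : ℂ => |z.im| := (continuous_abs.comp Complex.continuous_im).measurable
    exact (h1.const_mul _).exp.mul (h1.pow_const _)
  rw [← (Complex.volume_preserving_equiv_real_prod.symm).lintegral_comp_emb
    (Complex.measurableEquivRealProd.symm.measurableEmbedding)]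
  rw [Measure.volume_eq_prod, lintegral_prod_symm']
  swap
  · exact hmeas.comp (Complex.measurableEquivRealProd.symm.measurable)
  have e : ∀ (x y : ℝ), Complex.measurableEquivRealProd.symm (x, y) = x + y * I := by
    intro x y
    apply Complex.ext <;> simp [Complex.measurableEquivRealProd]
  simp only [e]
  rw [← lintegral_add_compl _ (measurableSet_Ioi (a := (0:ℝ)))]
  congr 1
  · refine setLIntegral_congr_fun measurableSet_Ioi fun y hy => ?_
    refine lintegral_congr fun x => ?_
    have : (0:ℝ) < y := hy
    simp [abs_of_pos this]
  · rw [Set.compl_Ioi, setLIntegral_congr Iio_ae_eq_Iic.symm]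
    have := (Measure.measurePreserving_neg (volume : Measure ℝ)).setLIntegral_comp_emb
      (MeasurableEquiv.neg ℝ).measurableEmbedding
      (fun y : ℝ => ∫⁻ x : ℝ, ENNReal.ofReal (Real.exp (-π * |(x + y * I : ℂ).im|) * |(x + y * I : ℂ).im| ^ α) * (‖f (x + y * I)‖₊ : ℝ≥0∞))
      (Set.Ioi 0)
    simp only [Set.image_neg_Ioi, neg_zero] at this
    rw [← this]
    refine setLIntegral_congr_fun measurableSet_Ioi fun y hy => ?_
    have hy0 : (0:ℝ) < y := hy
    rw [← lintegral_neg_eq_self (μ := (volume : Measure ℝ))]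
    refine lintegral_congr fun x => ?_
    simp [abs_of_pos hy0]
    rw [add_comm]

lemma split_lemma {μ : Measure ℝ} [IsProbabilityMeasure μ] {G : ℝ → ℝ≥0∞} (hG : Measurable G)
    {θ V : ℝ≥0∞} {r : ℝ} (hr : 1 < r) (h1 : V ≤ θ) (h2 : V ≤ ∫⁻ t, G t ∂μ) :
    V ^ r ≤ ∫⁻ t, (if θ < G t then 2 * θ ^ (r-1) * G t else 2 ^ r * (G t) ^ r) ∂μ := by
  set S : Set ℝ := {t | θ < G t} with hS
  have hSm : MeasurableSet S := measurableSet_lt measurable_const hG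
  set A := ∫⁻ t in S, G t ∂μ with hA
  set B := ∫⁻ t in Sᶜ, G t ∂μ with hB
  have hAB : V ≤ A + B := by rwa [hA, hB, lintegral_add_compl _ hSm]
  have e : (∫⁻ t, (if θ < G t then 2 * θ ^ (r-1) * G t else 2 ^ r * (G t) ^ r) ∂μ)
      = 2 * θ^(r-1) * A + 2^r * ∫⁻ t in Sᶜ, (G t)^r ∂μ := by
    rw [← lintegral_add_compl _ hSm]
    congr 1
    · rw [hA, ← lintegral_const_mul _ hG]
      exact setLIntegral_congr_fun hSm fun t ht => if_pos ht
    · rw [← lintegral_const_mul _ (hG.pow_const r)]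
      exact setLIntegral_congr_fun hSm.compl fun t ht => if_neg ht
  rw [e]
  rcases le_total B A with h | h
  · refine le_add_right ?_
    have : V ^ r = V ^ (r-1) * V := by
      by_cases hV0 : V = 0
      · rw [hV0, ENNReal.zero_rpow_of_pos (by linarith)]; simp
      by_cases hVt : V = ⊤
      · rw [hVt, ENNReal.top_rpow_of_pos (by linarith), ENNReal.top_rpow_of_pos (by linarith)]; simp
      conv_rhs => rw [← ENNReal.rpow_one V, ← ENNReal.rpow_mul, ← ENNReal.rpow_add _ _ hV0 hVt]
      congr 1; ring
    rw [this]
    calc V^(r-1) * V ≤ θ^(r-1) * (A + A) := by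
          gcongr
          exact hAB.trans (by gcongr)
      _ = _ := by ring
  · refine le_add_left ?_
    have hBr : B ^ r ≤ ∫⁻ t in Sᶜ, (G t)^r ∂μ := by
      have := eLpNorm'_le_eLpNorm'_of_exponent_le (μ := μ) (f := Sᶜ.indicator G) one_pos hr.le
        (hG.indicator hSm.compl).aestronglyMeasurable
      simp only [eLpNorm', enorm_eq_self, ENNReal.rpow_one, ne_eq, one_ne_zero, not_false_eq_true, div_self] at this
      rw [lintegral_indicator hSm.compl] at this
      have h3 : ∫⁻ a, (Sᶜ.indicator G a)^r ∂μ = ∫⁻ a in Sᶜ, (G a)^r ∂μ := by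
        rw [← lintegral_indicator hSm.compl]
        refine lintegral_congr fun a => ?_
        by_cases ha : a ∈ Sᶜ
        · simp [ha]
        · simp [ha, (by linarith : 0 < r)]
      rw [h3] at this
      have h4 := ENNReal.rpow_le_rpow this (by linarith : 0 ≤ r)
      rwa [← ENNReal.rpow_mul, one_div_mul_cancel (by linarith), ENNReal.rpow_one] at h4
    calc V^r ≤ (B + B)^r := by
          gcongr
          exact hAB.trans (by gcongr)
      _ = 2^r * B^r := by rw [← two_mul, ENNReal.mul_rpow_of_nonneg _ _ (by linarith)]
      _ ≤ _ := by gcongr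

lemma y_integral {r : ℝ} (hr : 2 < r) (w : ℝ) (hw : 0 ≤ w) :
    ∫⁻ y in Set.Ioi (0:ℝ), ENNReal.ofReal (y ^ (r/2 - 2)) *
      (if ENNReal.ofReal (y ^ (-(1/2):ℝ)) < ENNReal.ofReal w then
        2 * ENNReal.ofReal (y ^ (-(1/2):ℝ)) ^ (r-1) * ENNReal.ofReal w
        else 2 ^ r * (ENNReal.ofReal w) ^ r) ≤
    ENNReal.ofReal (4 + 2^r / (r/2 - 1)) * ENNReal.ofReal (w^2) := by
  rcases hw.eq_or_lt with h0 | h0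
  · rw [← h0]; simp [(by linarith : 0 < r)]
  set b : ℝ := w ^ (-2:ℝ) with hb
  have hb0 : 0 < b := by positivity
  have hbw : b ^ (-(1/2):ℝ) = w := by
    rw [hb, ← Real.rpow_mul hw]; norm_num
  have hiff : ∀ y : ℝ, 0 < y → (ENNReal.ofReal (y ^ (-(1/2):ℝ)) < ENNReal.ofReal w ↔ b < y) := by
    intro y hy
    rw [ENNReal.ofReal_lt_ofReal_iff h0]
    nth_rewrite 1 [← hbw]
    exact Real.rpow_lt_rpow_iff_of_neg hy hb0 (by norm_num)
  rw [← Set.Ioc_union_Ioi_eq_Ioi hb0.le, lintegral_union measurableSet_Ioi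
    (Set.Ioc_disjoint_Ioi le_rfl)]
  have hA : ∫⁻ y in Set.Ioc (0:ℝ) b, ENNReal.ofReal (y ^ (r/2 - 2)) *
      (if ENNReal.ofReal (y ^ (-(1/2):ℝ)) < ENNReal.ofReal w then
        2 * ENNReal.ofReal (y ^ (-(1/2):ℝ)) ^ (r-1) * ENNReal.ofReal w
        else 2 ^ r * (ENNReal.ofReal w) ^ r) = ENNReal.ofReal (2^r / (r/2-1) * w^2) := by
    have : ∀ y ∈ Set.Ioc (0:ℝ) b, ENNReal.ofReal (y ^ (r/2 - 2)) *
      (if ENNReal.ofReal (y ^ (-(1/2):ℝ)) < ENNReal.ofReal w then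
        2 * ENNReal.ofReal (y ^ (-(1/2):ℝ)) ^ (r-1) * ENNReal.ofReal w
        else 2 ^ r * (ENNReal.ofReal w) ^ r) = ENNReal.ofReal (y ^ (r/2-2) * (2^r * w^r)) := by
      intro y hy
      have hy0 : 0 < y := hy.1
      rw [if_neg (by rw [hiff y hy0]; exact not_lt.2 hy.2), ENNReal.ofReal_mul (by positivity),
        ENNReal.ofReal_mul (by positivity), ← ENNReal.ofReal_rpow_of_pos (by norm_num : (0:ℝ) < 2),
        ← ENNReal.ofReal_rpow_of_pos h0]
      simp
    rw [setLIntegral_congr_fun measurableSet_Ioc this]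
    rw [← ofReal_integral_eq_lintegral_ofReal]
    · congr 1
      rw [← intervalIntegral.integral_of_le hb0.le, intervalIntegral.integral_mul_const,
        integral_rpow (Or.inl (by linarith))]
      rw [Real.zero_rpow (by linarith), sub_zero, hb, ← Real.rpow_mul hw]
      have e : w^2 = w ^ (-2 * (r/2 - 2 + 1)) * w^r := by
        rw [← Real.rpow_add h0, ← Real.rpow_natCast]; congr 1; push_cast; ring
      rw [e]
      have : r/2 - 1 ≠ 0 := by linarith
      have : r/2 - 2 + 1 = r/2 - 1 := by ring
      rw [this]
      field_simp
    · have := (intervalIntegral.intervalIntegrable_rpow' (a := 0) (b := b) (r := r/2-2) (by linarith))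
      rw [intervalIntegrable_iff_integrableOn_Ioc_of_le hb0.le] at this
      exact this.mul_const _
    · filter_upwards [ae_restrict_mem measurableSet_Ioc] with y hy
      have hy0 : 0 < y := hy.1
      positivity
  have hB : ∫⁻ y in Set.Ioi b, ENNReal.ofReal (y ^ (r/2 - 2)) *
      (if ENNReal.ofReal (y ^ (-(1/2):ℝ)) < ENNReal.ofReal w then
        2 * ENNReal.ofReal (y ^ (-(1/2):ℝ)) ^ (r-1) * ENNReal.ofReal w
        else 2 ^ r * (ENNReal.ofReal w) ^ r) = ENNReal.ofReal (4 * w^2) := by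
    have : ∀ y ∈ Set.Ioi b, ENNReal.ofReal (y ^ (r/2 - 2)) *
      (if ENNReal.ofReal (y ^ (-(1/2):ℝ)) < ENNReal.ofReal w then
        2 * ENNReal.ofReal (y ^ (-(1/2):ℝ)) ^ (r-1) * ENNReal.ofReal w
        else 2 ^ r * (ENNReal.ofReal w) ^ r) = ENNReal.ofReal (y ^ (-(3/2):ℝ) * (2 * w)) := by
      intro y hy
      have hy0 : 0 < y := hb0.trans hy
      rw [if_pos (by rw [hiff y hy0]; exact hy), ENNReal.ofReal_rpow_of_pos (by positivity),
        ← Real.rpow_mul hy0.le]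
      have e2 : (2:ℝ≥0∞) = ENNReal.ofReal 2 := by simp
      rw [e2, ← ENNReal.ofReal_mul (by positivity), ← ENNReal.ofReal_mul (by positivity),
        ← ENNReal.ofReal_mul (by positivity)]
      congr 1
      have e : y ^ (-(3/2):ℝ) = y ^ (r/2-2) * y ^ (-(1/2) * (r-1)) := by
        rw [← Real.rpow_add hy0]; congr 1; ring
      rw [e]; ring
    rw [setLIntegral_congr_fun measurableSet_Ioi this]
    rw [← ofReal_integral_eq_lintegral_ofReal]
    · congr 1
      rw [integral_mul_const, integral_Ioi_rpow_of_lt (by norm_num) hb0]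
      have : (-(3/2):ℝ) + 1 = -(1/2) := by norm_num
      rw [this, hbw]; ring
    · exact (integrableOn_Ioi_rpow_of_lt (by norm_num) hb0).mul_const _
    · filter_upwards [ae_restrict_mem measurableSet_Ioi] with y hy
      have hy0 : 0 < y := hb0.trans hy
      positivity
  rw [hA, hB, ← ENNReal.ofReal_mul, ← ENNReal.ofReal_add]
  · refine ENNReal.ofReal_le_ofReal (le_of_eq ?_); ring
  · have : 0 < r/2 - 1 := by linarith
    positivity
  · positivity
  · have : 0 < r/2 - 1 := by linarith
    positivity


noncomputable def cauchyMu : Measure ℝ :=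
  (volume : Measure ℝ).withDensity (fun t => ENNReal.ofReal (1 / (π * (1 + t^2))))

lemma cauchy_dens_meas : Measurable (fun t : ℝ => ENNReal.ofReal (1 / (π * (1 + t^2)))) := by
  refine Measurable.ennreal_ofReal ?_
  fun_prop

instance cauchyMu_prob : IsProbabilityMeasure cauchyMu := by
  constructor
  rw [cauchyMu, withDensity_apply _ MeasurableSet.univ, setLIntegral_univ]
  have e : (fun t : ℝ => 1/(π*(1+t^2))) = fun t : ℝ => (1/π) * (1+t^2)⁻¹ := by
    ext t; rw [one_div_mul_eq_div, ← one_div, div_div, mul_comm]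
  rw [← ofReal_integral_eq_lintegral_ofReal]
  · rw [e, integral_const_mul, integral_univ_inv_one_add_sq]; field_simp; simp
  · rw [e]; exact integrable_inv_one_add_sq.const_mul _
  · filter_upwards with t; positivity

lemma enorm_rpow_ofReal (z : ℂ) {s : ℝ} (hs : 0 ≤ s) :
    (‖z‖₊ : ℝ≥0∞) ^ s = ENNReal.ofReal (‖z‖ ^ s) := by
  rw [← ENNReal.ofReal_rpow_of_nonneg (norm_nonneg _) hs, ofReal_norm]; rfl

lemma KL_mu {f : ℂ → ℂ} (hf : ExpTypePi f) {M : ℝ} (hM : ∀ x : ℝ, ‖f x‖ ≤ M)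
    {s : ℝ} (hs : 0 < s) (x y : ℝ) (hy : 0 < y) :
    ENNReal.ofReal ((‖f (x + y * I)‖ * Real.exp (-(π * y))) ^ s) ≤
      ∫⁻ t : ℝ, (‖f ((x - y * t : ℝ))‖₊ : ℝ≥0∞) ^ s ∂cauchyMu := by
  refine (KL hf hM hs x y hy).trans (le_of_eq ?_)
  rw [cauchyMu, lintegral_withDensity_eq_lintegral_mul _ cauchy_dens_meas]
  · refine lintegral_congr fun t => ?_
    rw [Pi.mul_apply, enorm_rpow_ofReal _ hs.le, ENNReal.ofReal_mul (by positivity)]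
  · refine Measurable.pow_const ?_ _
    refine (Continuous.measurable ?_).coe_nnreal_ennreal
    refine Continuous.nnnorm (hf.1.continuous.comp ?_)
    fun_prop

lemma lintegral_scale (g : ℝ → ℝ≥0∞) {y : ℝ} (hy : 0 < y) :
    ∫⁻ t : ℝ, g (y * t) = ENNReal.ofReal (y⁻¹) * ∫⁻ t : ℝ, g t := by
  have h := Real.map_volume_mul_left hy.ne'
  have h2 := (Homeomorph.mulLeft₀ y hy.ne').measurableEmbedding.lintegral_map (μ := volume) g
  have h3 : (⇑(Homeomorph.mulLeft₀ y hy.ne')) = fun t => y * t := rfl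
  rw [h3, h, lintegral_smul_measure, abs_of_pos (by positivity)] at h2
  exact h2.symm

lemma u_bound {f : ℂ → ℂ} (hf : ExpTypePi f) {p : ℝ} (hp : 0 < p)
    (hI : (∫⁻ x : ℝ, (‖f x‖₊ : ℝ≥0∞) ^ p) ≤ 1) (x y : ℝ) (hy : 0 < y) :
    ENNReal.ofReal ((‖f (x + y * I)‖ * Real.exp (-(π * y))) ^ p) ≤ ENNReal.ofReal (y⁻¹) := by
  obtain ⟨M, hM0, hM⟩ := bdd_real hf hp (hI.trans_lt ENNReal.one_lt_top)
  refine (KL hf hM hp x y hy).trans ?_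
  calc _ ≤ ∫⁻ t : ℝ, (‖f ((x - y * t : ℝ))‖₊ : ℝ≥0∞) ^ p := by
        refine lintegral_mono fun t => ?_
        rw [enorm_rpow_ofReal _ hp.le]
        refine ENNReal.ofReal_le_ofReal ?_
        refine mul_le_of_le_one_left (by positivity) ?_
        rw [div_le_one (by positivity)]
        nlinarith [pi_gt_three, sq_nonneg t]
    _ = ENNReal.ofReal (y⁻¹) * ∫⁻ t : ℝ, (‖f t‖₊ : ℝ≥0∞) ^ p := by
        have h1 := lintegral_scale (fun t : ℝ => (‖f ((x - t : ℝ))‖₊ : ℝ≥0∞) ^ p) hy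
        rw [h1]
        congr 1
        exact lintegral_sub_left_eq_self (fun t : ℝ => (‖f t‖₊ : ℝ≥0∞) ^ p) x
    _ ≤ _ := mul_le_of_le_one_right' hI

lemma upper_half {f : ℂ → ℂ} (hf : ExpTypePi f) {p : ℝ} (hp : 0 < p) (hp1 : p < 1)
    (hI : (∫⁻ x : ℝ, (‖f x‖₊ : ℝ≥0∞) ^ p) ≤ 1) :
    Nplus (1/p - 2) f ≤ ENNReal.ofReal (4 + 2^(2/p) / (2/p/2 - 1)) := by
  obtain ⟨M, hM0, hM⟩ := bdd_real hf hp (hI.trans_lt ENNReal.one_lt_top)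
  set r : ℝ := 2/p with hr
  have hr2 : 2 < r := by rw [hr, lt_div_iff₀ hp]; linarith
  have hα : 1/p - 2 = r/2 - 2 := by rw [hr]; ring
  rw [hα]
  set Ψ : ℝ → ℝ≥0∞ → ℝ≥0∞ := fun y w => if ENNReal.ofReal (y ^ (-(1/2):ℝ)) < w then
        2 * ENNReal.ofReal (y ^ (-(1/2):ℝ)) ^ (r-1) * w
        else 2 ^ r * w ^ r with hΨ
  have hΨm : Measurable (Function.uncurry Ψ) := by
    refine Measurable.ite ?_ ?_ ?_
    · refine measurableSet_lt ?_ measurable_snd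
      exact (measurable_fst.pow_const _).ennreal_ofReal
    · exact (((measurable_fst.pow_const _).ennreal_ofReal.pow_const _).const_mul _).mul measurable_snd
    · exact (measurable_snd.pow_const _).const_mul _
  set g : ℝ → ℝ≥0∞ := fun x => (‖f x‖₊ : ℝ≥0∞) ^ (p/2) with hg
  have hgm : Measurable g := by
    refine Measurable.pow_const ?_ _
    exact (hf.1.continuous.comp continuous_ofReal).nnnorm.measurable.coe_nnreal_ennreal
  have hpt : ∀ y : ℝ, 0 < y → ∀ x : ℝ, ENNReal.ofReal (Real.exp (-(π * y)) * y ^ (r/2-2)) * (‖f (x + y * I)‖₊ : ℝ≥0∞)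
      ≤ ENNReal.ofReal (y ^ (r/2-2)) * ∫⁻ t, Ψ y (g (x - y * t)) ∂cauchyMu := by
    intro y hy x
    set u := ‖f (x + y * I)‖ * Real.exp (-(π * y)) with hu
    have hu0 : 0 ≤ u := by positivity
    have h1 : ENNReal.ofReal (Real.exp (-(π * y)) * y ^ (r/2-2)) * (‖f (x + y * I)‖₊ : ℝ≥0∞)
        = ENNReal.ofReal (y ^ (r/2-2)) * (ENNReal.ofReal (u ^ (p/2))) ^ r := by
      have e1 : (‖f (x + y * I)‖₊ : ℝ≥0∞) = ENNReal.ofReal ‖f (x + y * I)‖ := by rw [ofReal_norm]; rfl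
      rw [e1, ENNReal.ofReal_rpow_of_nonneg (by positivity) (by linarith), ← Real.rpow_mul hu0,
        ← ENNReal.ofReal_mul (by positivity), ← ENNReal.ofReal_mul (by positivity)]
      have : p/2 * r = 1 := by rw [hr]; field_simp
      rw [this, Real.rpow_one, hu]; congr 1; ring
    rw [h1]
    gcongr
    refine split_lemma (hgm.comp (by fun_prop)) (by linarith) ?_ ?_
    · have h2 := u_bound hf hp hI x y hy
      rw [ENNReal.ofReal_le_ofReal_iff (by positivity)] at h2
      refine ENNReal.ofReal_le_ofReal ?_
      have h3 := Real.rpow_le_rpow (by positivity) h2 (by norm_num : (0:ℝ) ≤ 1/2)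
      rw [← Real.rpow_mul hu0] at h3
      have : p * (1/2) = p/2 := by ring
      rw [this] at h3
      rwa [Real.rpow_neg hy.le, ← Real.inv_rpow hy.le]
    · exact KL_mu hf hM (by positivity) x y hy
  calc Nplus (r/2-2) f ≤ ∫⁻ y in Set.Ioi (0:ℝ), ∫⁻ x : ℝ, ENNReal.ofReal (y ^ (r/2-2)) * ∫⁻ t, Ψ y (g (x - y * t)) ∂cauchyMu := by
        refine setLIntegral_mono' measurableSet_Ioi fun y hy => ?_
        exact lintegral_mono fun x => hpt y hy x
    _ = ∫⁻ y in Set.Ioi (0:ℝ), ∫⁻ x : ℝ, ENNReal.ofReal (y ^ (r/2-2)) * Ψ y (g x) := by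
        refine lintegral_congr fun y => ?_
        have hΨy : Measurable (Ψ y) := hΨm.comp measurable_prodMk_left
        rw [lintegral_const_mul' _ _ ENNReal.ofReal_ne_top, lintegral_const_mul' _ _ ENNReal.ofReal_ne_top]
        congr 1
        rw [lintegral_lintegral_swap]
        · have : ∀ t : ℝ, ∫⁻ x : ℝ, Ψ y (g (x - y * t)) = ∫⁻ x : ℝ, Ψ y (g x) := fun t =>
            lintegral_sub_right_eq_self (fun x => Ψ y (g x)) (y * t)
          simp [this]
        · refine Measurable.aemeasurable ?_
          exact hΨy.comp (hgm.comp (by fun_prop))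
    _ = ∫⁻ x : ℝ, ∫⁻ y in Set.Ioi (0:ℝ), ENNReal.ofReal (y ^ (r/2-2)) * Ψ y (g x) := by
        rw [lintegral_lintegral_swap]
        refine Measurable.aemeasurable ?_
        refine Measurable.mul ?_ ?_
        · exact (measurable_fst.pow_const _).ennreal_ofReal
        · exact hΨm.comp (measurable_fst.prodMk (hgm.comp measurable_snd))
    _ ≤ ∫⁻ x : ℝ, ENNReal.ofReal (4 + 2^r / (r/2 - 1)) * (‖f x‖₊ : ℝ≥0∞) ^ p := by
        refine lintegral_mono fun x => ?_
        have h := y_integral hr2 (‖f x‖ ^ (p/2)) (by positivity)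
        rw [← enorm_rpow_ofReal _ (by positivity)] at h
        refine h.trans (le_of_eq ?_)
        rw [enorm_rpow_ofReal _ hp.le, ← Real.rpow_natCast, ← Real.rpow_mul (norm_nonneg _)]
        congr 3; push_cast; ring
    _ ≤ _ := by
        rw [lintegral_const_mul' _ _ ENNReal.ofReal_ne_top]
        exact mul_le_of_le_one_right' hI

lemma upper_full {p : ℝ} (hp : 0 < p) (hp1 : p < 1) : ∃ C : ℝ, 0 < C ∧ ∀ f : ℂ → ℂ, ExpTypePi f →
    (∫⁻ x : ℝ, (‖f x‖₊ : ℝ≥0∞) ^ p) ≤ 1 →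
    (∫⁻ z : ℂ, ENNReal.ofReal
            (Real.exp (-Real.pi * |z.im|) * |z.im| ^ (1/p-2)) * (‖f z‖₊ : ℝ≥0∞)) ≤ ENNReal.ofReal C := by
  have : 0 < 2/p/2 - 1 := by
    have : 1 < 1/p := by rw [lt_div_iff₀ hp]; linarith
    have e : 2/p/2 = 1/p := by ring
    linarith
  refine ⟨(4 + 2^(2/p) / (2/p/2 - 1)) + (4 + 2^(2/p) / (2/p/2 - 1)), by positivity, fun f hf hI => ?_⟩
  rw [N_split _ hf.1.continuous, ENNReal.ofReal_add (by positivity) (by positivity)]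
  exact add_le_add (upper_half hf hp hp1 hI)
    (upper_half hf.neg hp hp1 (by rw [lintegral_neg_comp]; exact hI))

open scoped Pointwise

/-- Unit ball of `Eᵖ`. -/
def Bp (p : ℝ) : Set (ℂ → ℂ) :=
  {f : ℂ → ℂ | ExpTypePi f ∧ (∫⁻ x : ℝ, (‖f x‖₊ : ℝ≥0∞) ^ p) ≤ 1}

/-- The weighted norm. -/
noncomputable def NW (α : ℝ) (f : ℂ → ℂ) : ℝ≥0∞ :=
  ∫⁻ z : ℂ, ENNReal.ofReal (Real.exp (-Real.pi * |z.im|) * |z.im| ^ α) * (‖f z‖₊ : ℝ≥0∞)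

lemma ExpTypePi.const_mul {f : ℂ → ℂ} (hf : ExpTypePi f) (c : ℂ) : ExpTypePi (fun z => c * f z) := by
  refine ⟨hf.1.const_mul c, fun ε hε => ?_⟩
  obtain ⟨C, hC, h⟩ := hf.2 ε hε
  refine ⟨(‖c‖+1) * C, by positivity, fun z => ?_⟩
  rw [norm_mul, mul_assoc]
  gcongr
  · linarith
  · exact h z

lemma ExpTypePi.add {f g : ℂ → ℂ} (hf : ExpTypePi f) (hg : ExpTypePi g) : ExpTypePi (f + g) := by
  refine ⟨hf.1.add hg.1, fun ε hε => ?_⟩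
  obtain ⟨C, hC, h⟩ := hf.2 ε hε
  obtain ⟨C', hC', h'⟩ := hg.2 ε hε
  refine ⟨C + C', by positivity, fun z => ?_⟩
  rw [add_mul]
  exact (norm_add_le _ _).trans (add_le_add (h z) (h' z))

lemma ExpTypePi.zero : ExpTypePi (0 : ℂ → ℂ) :=
  ⟨differentiable_const 0, fun ε hε => ⟨1, one_pos, fun z => by simp; positivity⟩⟩

lemma ExpTypePi.sub {f g : ℂ → ℂ} (hf : ExpTypePi f) (hg : ExpTypePi g) : ExpTypePi (f - g) := by
  have := hf.add (hg.const_mul (-1))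
  convert this using 1
  ext z; simp [sub_eq_add_neg]

lemma mem_smul_Bp {p r : ℝ} (hp : 0 < p) (hr : 0 < r) {h : ℂ → ℂ} (hh : ExpTypePi h)
    (hI : (∫⁻ x : ℝ, (‖h x‖₊ : ℝ≥0∞) ^ p) ≤ ENNReal.ofReal (r ^ p)) : h ∈ r • Bp p := by
  rw [Set.mem_smul_set]
  refine ⟨fun z => (r⁻¹ : ℝ) * h z, ⟨hh.const_mul _, ?_⟩, ?_⟩
  · have : ∀ x : ℝ, (‖((r⁻¹ : ℝ) : ℂ) * h x‖₊ : ℝ≥0∞) ^ p = ENNReal.ofReal ((r ^ p)⁻¹) * (‖h x‖₊ : ℝ≥0∞) ^ p := by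
      intro x
      rw [enorm_rpow_ofReal _ hp.le, enorm_rpow_ofReal _ hp.le, ← ENNReal.ofReal_mul (by positivity),
        norm_mul, Real.mul_rpow (by positivity) (by positivity), norm_real, Real.norm_eq_abs,
        abs_of_pos (by positivity), Real.inv_rpow hr.le]
    simp only [this]
    rw [lintegral_const_mul' _ _ ENNReal.ofReal_ne_top]
    calc _ ≤ ENNReal.ofReal ((r ^ p)⁻¹) * ENNReal.ofReal (r ^ p) := by gcongr
      _ = 1 := by rw [← ENNReal.ofReal_mul (by positivity), inv_mul_cancel₀ (by positivity)]; simp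
  · ext z
    simp only [Pi.smul_apply, real_smul]
    rw [← mul_assoc]
    have : (r:ℂ) ≠ 0 := by exact_mod_cast hr.ne'
    push_cast
    rw [mul_inv_cancel₀ this, one_mul]

lemma NW_smul {α : ℝ} (r : ℝ) (hr : 0 ≤ r) (f : ℂ → ℂ) :
    NW α (r • f) = ENNReal.ofReal r * NW α f := by
  unfold NW
  rw [← lintegral_const_mul' _ _ ENNReal.ofReal_ne_top]
  refine lintegral_congr fun z => ?_
  have : (‖(r • f) z‖₊ : ℝ≥0∞) = ENNReal.ofReal r * (‖f z‖₊ : ℝ≥0∞) := by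
    rw [Pi.smul_apply, nnnorm_smul, ENNReal.coe_mul]
    congr 1
    rw [Real.nnnorm_of_nonneg hr, ENNReal.ofReal, Real.toNNReal_of_nonneg hr]
  rw [this]; ring

lemma NW_meas {α : ℝ} {f : ℂ → ℂ} (hf : Continuous f) : Measurable (fun z : ℂ => ENNReal.ofReal
            (Real.exp (-Real.pi * |z.im|) * |z.im| ^ α) * (‖f z‖₊ : ℝ≥0∞)) := by
  refine Measurable.mul ?_ hf.nnnorm.measurable.coe_nnreal_ennreal
  refine Measurable.ennreal_ofReal ?_
  have h1 : Measurable fun z : ℂ => |z.im| := (continuous_abs.comp Complex.continuous_im).measurable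
  exact (h1.const_mul _).exp.mul (h1.pow_const _)

lemma NW_add {α : ℝ} {f g : ℂ → ℂ} (hf : Continuous f) :
    NW α (f + g) ≤ NW α f + NW α g := by
  unfold NW
  rw [← lintegral_add_left (NW_meas hf)]
  refine lintegral_mono fun z => ?_
  rw [← mul_add]
  gcongr
  rw [Pi.add_apply, ← ENNReal.coe_add]
  exact ENNReal.coe_le_coe.2 (nnnorm_add_le (f z) (g z))

lemma upper_gauge {p : ℝ} (hp : 0 < p) (hp1 : p < 1) : ∃ C : ℝ, 0 < C ∧ ∀ f : ℂ → ℂ, ExpTypePi f →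
    (∫⁻ x : ℝ, (‖f x‖₊ : ℝ≥0∞) ^ p) < ⊤ →
    NW (1/p-2) f ≤ ENNReal.ofReal (C * gauge (convexHull ℝ (Bp p)) f) := by
  obtain ⟨C, hC, h⟩ := upper_full hp hp1
  refine ⟨C, hC, fun f hf hI => ?_⟩
  set D : Set (ℂ → ℂ) := {f | Continuous f ∧ NW (1/p-2) f ≤ ENNReal.ofReal C} with hD
  have hconv : Convex ℝ D := by
    intro f hf g hg a b ha hb hab
    refine ⟨(hf.1.const_smul a).add (hg.1.const_smul b), ?_⟩
    refine (NW_add (hf.1.const_smul a)).trans ?_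
    rw [NW_smul _ ha, NW_smul _ hb]
    calc _ ≤ ENNReal.ofReal a * ENNReal.ofReal C + ENNReal.ofReal b * ENNReal.ofReal C := by
          gcongr
          · exact hf.2
          · exact hg.2
      _ = ENNReal.ofReal C := by
          rw [← add_mul, ← ENNReal.ofReal_add ha hb, hab]; simp
  have hsub : convexHull ℝ (Bp p) ⊆ D :=
    convexHull_min (fun g hg => ⟨hg.1.1.continuous, h g hg.1 hg.2⟩) hconv
  have hr : ∀ r : ℝ, 0 < r → f ∈ r • convexHull ℝ (Bp p) → NW (1/p-2) f ≤ ENNReal.ofReal (C * r) := by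
    intro r hr hfr
    rw [Set.mem_smul_set] at hfr
    obtain ⟨g, hg, rfl⟩ := hfr
    rw [NW_smul _ hr.le, mul_comm C, ENNReal.ofReal_mul hr.le]
    gcongr
    exact (hsub hg).2
  set J := (∫⁻ x : ℝ, (‖f x‖₊ : ℝ≥0∞) ^ p).toReal with hJ
  have hr0 : f ∈ (J ^ (1/p) + 1) • convexHull ℝ (Bp p) := by
    refine Set.smul_set_mono (subset_convexHull ℝ _) (mem_smul_Bp hp (by positivity) hf ?_)
    rw [ENNReal.le_ofReal_iff_toReal_le hI.ne (by positivity)]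
    have : J = (J ^ (1/p)) ^ p := by
      rw [← Real.rpow_mul (by positivity), one_div_mul_cancel hp.ne', Real.rpow_one]
    rw [← hJ]
    nth_rewrite 1 [this]
    gcongr
    linarith
  have hfin := (hr _ (by positivity) hr0).trans_lt ENNReal.ofReal_lt_top
  rw [ENNReal.le_ofReal_iff_toReal_le hfin.ne (mul_nonneg hC.le (gauge_nonneg _)), ← div_le_iff₀' hC]
  unfold gauge
  refine le_csInf ⟨J ^ (1/p) + 1, by positivity, hr0⟩ ?_
  rintro r ⟨hr1, hr2⟩
  rw [div_le_iff₀' hC]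
  have := hr r hr1 hr2
  rwa [ENNReal.le_ofReal_iff_toReal_le hfin.ne (by positivity)] at this


lemma integrable_dec2 : Integrable (fun x : ℝ => 1 / (1 + |x|)^2) := by
  refine Integrable.mono' (integrable_inv_one_add_sq) ?_ ?_
  · refine Measurable.aestronglyMeasurable ?_
    fun_prop
  · filter_upwards with x
    rw [Real.norm_eq_abs, abs_of_nonneg (by positivity), one_div]
    gcongr
    nlinarith [abs_nonneg x, sq_abs x]

lemma contour_shift {G : ℂ → ℂ} (hG : Differentiable ℂ G) {v D : ℝ}
    (hD : ∀ z : ℂ, |z.im| ≤ |v| → ‖G z‖ ≤ D / (1 + |z.re|)^2) :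
    ∫ x : ℝ, G x = ∫ x : ℝ, G (x + v * I) := by
  have hD0 : 0 ≤ D := by
    have := (norm_nonneg _).trans (hD 0 (by simp))
    simpa using this
  have hIntg : ∀ y : ℝ, |y| ≤ |v| → Integrable (fun x : ℝ => G (x + y * I)) := by
    intro y hy
    refine Integrable.mono' (integrable_dec2.const_mul D) ?_ ?_
    · exact (hG.continuous.comp (by fun_prop)).aestronglyMeasurable
    · filter_upwards with x
      have := hD (x + y * I) (by simpa using hy)
      simpa [mul_one_div, div_eq_mul_inv] using this
  have hi0 : Integrable (fun x : ℝ => G x) := by simpa using hIntg 0 (by simp)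
  have hiv := hIntg v le_rfl
  have t1 : Filter.Tendsto (fun T : ℝ => ∫ x in (-T)..T, G x) Filter.atTop (nhds (∫ x : ℝ, G x)) :=
    intervalIntegral_tendsto_integral hi0 Filter.tendsto_neg_atTop_atBot Filter.tendsto_id
  have t2 : Filter.Tendsto (fun T : ℝ => ∫ x in (-T)..T, G (x + v * I)) Filter.atTop (nhds (∫ x : ℝ, G (x + v * I))) :=
    intervalIntegral_tendsto_integral hiv Filter.tendsto_neg_atTop_atBot Filter.tendsto_id
  have hside : ∀ T : ℝ, 0 ≤ T → ∀ T' : ℝ, |T'| = T → ‖∫ y in (0:ℝ)..v, G (T' + y * I)‖ ≤ D / (1 + T)^2 * |v| := by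
    intro T hT T' hT'
    have := intervalIntegral.norm_integral_le_of_norm_le_const (a := 0) (b := v) (f := fun y : ℝ => G (T' + y * I))
      (C := D / (1 + T)^2) ?_
    · simpa using this
    · intro y hy
      have hy' : |y| ≤ |v| := by
        rcases Set.mem_uIoc.1 hy with h | h
        · rw [abs_of_pos h.1]; exact h.2.trans (le_abs_self _)
        · rw [abs_of_nonpos h.2, abs_of_neg (h.1.trans_le h.2)]; linarith [h.1]
      have := hD (T' + y * I) (by simpa using hy')
      simpa [hT'] using this
  have t3 : Filter.Tendsto (fun T : ℝ => D / (1 + T)^2 * |v|) Filter.atTop (nhds 0) := by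
    have : Filter.Tendsto (fun T : ℝ => (1 + T)^2) Filter.atTop Filter.atTop :=
      (Filter.tendsto_pow_atTop two_ne_zero).comp (Filter.tendsto_atTop_add_const_left _ _ Filter.tendsto_id)
    have h2 := (this.const_div_atTop D).mul_const |v|
    simpa using h2
  have t4 : Filter.Tendsto (fun T : ℝ => ∫ y in (0:ℝ)..v, G (T + y * I)) Filter.atTop (nhds 0) := by
    refine squeeze_zero_norm' ?_ t3
    filter_upwards [Filter.eventually_ge_atTop 0] with T hT
    exact hside T hT T (abs_of_nonneg hT)
  have t5 : Filter.Tendsto (fun T : ℝ => ∫ y in (0:ℝ)..v, G ((-T : ℝ) + y * I)) Filter.atTop (nhds 0) := by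
    refine squeeze_zero_norm' ?_ t3
    filter_upwards [Filter.eventually_ge_atTop 0] with T hT
    exact hside T hT (-T) (by rw [abs_neg, abs_of_nonneg hT])
  have hrect : ∀ T : ℝ, (∫ x in (-T)..T, G x) - (∫ x in (-T)..T, G (x + v * I)) +
      I * (∫ y in (0:ℝ)..v, G (T + y * I)) - I * (∫ y in (0:ℝ)..v, G ((-T : ℝ) + y * I)) = 0 := by
    intro T
    have := Complex.integral_boundary_rect_eq_zero_of_differentiableOn G ((-T : ℝ) : ℂ) (T + v * I) hG.differentiableOn
    simpa using this
  have t6 := ((t1.sub t2).add (t4.const_mul I)).sub (t5.const_mul I)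
  simp only [hrect] at t6
  have := tendsto_nhds_unique t6 tendsto_const_nhds
  simp at this
  exact sub_eq_zero.1 this

/-- Decay predicate. -/
def Dec (F : ℂ → ℂ) (σ C : ℝ) (n : ℕ) : Prop :=
  Differentiable ℂ F ∧ ∀ z : ℂ, ‖F z‖ ≤ C * Real.exp (σ * |z.im|) / (1 + |z.re|)^n

lemma Dec.C_nonneg {F : ℂ → ℂ} {σ C : ℝ} {n : ℕ} (hF : Dec F σ C n) : 0 ≤ C := by
  have := (norm_nonneg _).trans (hF.2 0)
  simpa using this

lemma Dec.mono {F : ℂ → ℂ} {σ C : ℝ} {n m : ℕ} (hF : Dec F σ C n) (h : m ≤ n) : Dec F σ C m := by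
  refine ⟨hF.1, fun z => (hF.2 z).trans ?_⟩
  have := hF.C_nonneg
  gcongr
  linarith [abs_nonneg z.re]

lemma Dec.neg {F : ℂ → ℂ} {σ C : ℝ} {n : ℕ} (hF : Dec F σ C n) : Dec (fun z => F (-z)) σ C n :=
  ⟨hF.1.comp differentiable_neg, fun z => by simpa using hF.2 (-z)⟩

lemma Dec.integrable {F : ℂ → ℂ} {σ C : ℝ} (hF : Dec F σ C 2) (y : ℝ) :
    Integrable (fun x : ℝ => F (x + y * I)) := by
  refine Integrable.mono' (integrable_dec2.const_mul (C * Real.exp (σ * |y|))) ?_ ?_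
  · exact (hF.1.continuous.comp (by fun_prop)).aestronglyMeasurable
  · filter_upwards with x
    have := hF.2 (x + y * I)
    simpa [mul_one_div, div_eq_mul_inv] using this

/-- Fourier transform with angular frequency. -/
noncomputable def FT (F : ℂ → ℂ) (ξ : ℝ) : ℂ := ∫ x : ℝ, F x * Complex.exp (-(I * ξ * x))

lemma FT_shift {F : ℂ → ℂ} {σ C : ℝ} (hσ : 0 ≤ σ) (hF : Dec F σ C 2) (ξ v : ℝ) :
    FT F ξ = ∫ x : ℝ, F (x + v * I) * Complex.exp (-(I * ξ * (x + v * I))) := by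
  have hC := hF.C_nonneg
  refine contour_shift (G := fun z => F z * Complex.exp (-(I * ξ * z)))
    (D := C * Real.exp (σ * |v|) * Real.exp (|ξ| * |v|)) ?_ ?_
  · exact hF.1.mul (by fun_prop)
  · intro z hz
    rw [norm_mul, Complex.norm_exp]
    have e : (-(I * ξ * z)).re = ξ * z.im := by simp
    rw [e]
    have hxi : ξ * z.im ≤ |ξ| * |v| := by
      refine (le_abs_self _).trans ?_
      rw [abs_mul]; gcongr
    calc _ ≤ (C * Real.exp (σ * |v|) / (1 + |z.re|)^2) * Real.exp (|ξ| * |v|) := by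
          refine mul_le_mul ?_ (Real.exp_le_exp.2 hxi) (by positivity) (by positivity)
          refine (hF.2 z).trans ?_
          gcongr
      _ = _ := by ring

lemma FT_shift' {F : ℂ → ℂ} {σ C : ℝ} (hσ : 0 ≤ σ) (hF : Dec F σ C 2) (ξ v : ℝ) :
    ∫ x : ℝ, F (x + v * I) * Complex.exp (-(I * ξ * x)) = Real.exp (-(ξ * v)) * FT F ξ := by
  rw [FT_shift hσ hF ξ v, ← integral_const_mul]
  congr 1; ext x
  have : -(I * ξ * (x + v * I)) = -(I * ξ * x) + ξ * v := by ring_nf; simp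
  rw [this, Complex.exp_add]
  push_cast
  rw [Complex.exp_neg (ξ * v)]
  field_simp

lemma FT_zero {F : ℂ → ℂ} {σ C : ℝ} (hσ : 0 ≤ σ) (hF : Dec F σ C 2) (ξ : ℝ) (hξ : σ < |ξ|) :
    FT F ξ = 0 := by
  have hC := hF.C_nonneg
  set K := ∫ x : ℝ, 1 / (1 + |x|)^2 with hK
  have key : ∀ v : ℝ, ‖FT F ξ‖ ≤ C * Real.exp (σ * |v| + ξ * v) * K := by
    intro v
    rw [FT_shift hσ hF ξ v, hK, ← integral_const_mul]
    refine norm_integral_le_of_norm_le (integrable_dec2.const_mul _) ?_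
    filter_upwards with x
    rw [norm_mul, Complex.norm_exp]
    have e : (-(I * ξ * (x + v * I))).re = ξ * v := by simp
    rw [e, Real.exp_add]
    have := hF.2 (x + v * I)
    simp only [add_im, ofReal_im, mul_im, ofReal_re, I_im, mul_one, I_re, mul_zero, add_zero, zero_add, add_re, mul_re, sub_self] at this
    calc _ ≤ (C * Real.exp (σ * |v|) / (1 + |x|)^2) * Real.exp (ξ * v) := by gcongr
      _ = _ := by ring
  have lim : Filter.Tendsto (fun t : ℝ => C * Real.exp (-((|ξ| - σ) * t)) * K) Filter.atTop (nhds 0) := by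
    have h1 : Filter.Tendsto (fun t : ℝ => (|ξ| - σ) * t) Filter.atTop Filter.atTop :=
      Filter.tendsto_id.const_mul_atTop (by linarith)
    have h2 := ((Real.tendsto_exp_neg_atTop_nhds_zero.comp h1).const_mul C).mul_const K
    simpa using h2
  have : ‖FT F ξ‖ ≤ 0 := by
    refine ge_of_tendsto lim ?_
    filter_upwards [Filter.eventually_ge_atTop 0] with t ht
    rcases le_total 0 ξ with h | h
    · refine (key (-t)).trans (le_of_eq ?_)
      rw [abs_neg, abs_of_nonneg ht, abs_of_nonneg h]; ring_nf
    · refine (key t).trans (le_of_eq ?_)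
      rw [abs_of_nonneg ht, abs_of_nonpos h]; ring_nf
  exact norm_le_zero_iff.1 this

open FourierTransform in
lemma FT_eq (F : ℂ → ℂ) (ξ : ℝ) : FT F ξ = 𝓕 (fun x : ℝ => F x) (ξ / (2*π)) := by
  rw [Real.fourier_eq', FT]
  congr 1; ext x
  simp only [smul_eq_mul]
  rw [mul_comm]
  congr 2
  simp
  field_simp

lemma FT_cont {F : ℂ → ℂ} {σ C : ℝ} (hF : Dec F σ C 2) : Continuous (FT F) := by
  have hi : Integrable (fun x : ℝ => F x) := by simpa using hF.integrable 0
  have : FT F = fun ξ => FourierTransform.fourier (fun x : ℝ => F x) (ξ / (2*π)) := by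
    ext ξ; exact FT_eq F ξ
  rw [this]
  have h1 : Continuous (FourierTransform.fourier (fun x : ℝ => F x)) := by
    exact VectorFourier.fourierIntegral_continuous Real.continuous_fourierChar (by fun_prop) hi
  exact h1.comp (by fun_prop)

lemma FT_compact {F : ℂ → ℂ} {σ C : ℝ} (hσ : 0 ≤ σ) (hF : Dec F σ C 2) :
    HasCompactSupport (FT F) := by
  refine HasCompactSupport.of_support_subset_isCompact (isCompact_Icc (a := -σ) (b := σ)) ?_
  intro ξ hξ
  by_contra h
  refine hξ (FT_zero hσ hF ξ ?_)
  by_contra h'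
  exact h (abs_le.1 (not_lt.1 h'))

lemma FT_inv {F : ℂ → ℂ} {σ C : ℝ} (hσ : 0 ≤ σ) (hF : Dec F σ C 2) (x : ℝ) :
    ∫ ξ : ℝ, FT F ξ * Complex.exp (I * ξ * x) = 2 * π * F x := by
  have hi : Integrable (fun x : ℝ => F x) := by simpa using hF.integrable 0
  have hFT : Integrable (FT F) := (FT_cont hF).integrable_of_hasCompactSupport (FT_compact hσ hF)
  have hFi : Integrable (FourierTransform.fourier (fun x : ℝ => F x)) := by
    have := hFT.comp_mul_left' (R := 2*π) (by positivity)
    refine this.congr ?_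
    filter_upwards with w
    rw [FT_eq]; congr 1; field_simp
  have hinv := congrFun (Continuous.fourierInv_fourier_eq (f := fun x : ℝ => F x)
    (hF.1.continuous.comp continuous_ofReal) hi hFi) x
  rw [Real.fourierInv_eq'] at hinv
  rw [← hinv]
  have := Measure.integral_comp_mul_left (fun ξ : ℝ => FT F ξ * Complex.exp (I * ξ * x)) (2*π)
  rw [abs_of_pos (by positivity)] at this
  have h2 : ∀ w : ℝ, FT F (2*π*w) * Complex.exp (I * ((2*π*w : ℝ):ℂ) * x) =
    Complex.exp (((2 * π * inner ℝ w x : ℝ) : ℂ) * I) • FourierTransform.fourier (fun x : ℝ => F x) w := by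
    intro w
    rw [FT_eq, smul_eq_mul, mul_comm]
    congr 2
    · simp; ring
    · field_simp
  simp only [h2] at this
  push_cast at this ⊢
  rw [this, real_smul]
  push_cast
  rw [← mul_assoc, mul_inv_cancel₀ (by norm_num [pi_ne_zero]), one_mul]


noncomputable def tau (s : ℝ) : ℝ := Real.smoothTransition ((s - 1) / (2*π - 2))

lemma den_pos : 0 < 2*π - 2 := by linarith [pi_gt_three]

lemma tau_contDiff : ContDiff ℝ ((⊤ : ℕ∞) : WithTop ℕ∞) tau :=
  Real.smoothTransition.contDiff.comp (by fun_prop)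

lemma tau_zero {s : ℝ} (h : s ≤ 1) : tau s = 0 :=
  Real.smoothTransition.zero_of_nonpos (div_nonpos_of_nonpos_of_nonneg (by linarith) den_pos.le)

lemma tau_one {s : ℝ} (h : 2*π - 1 ≤ s) : tau s = 1 :=
  Real.smoothTransition.one_of_one_le (by rw [le_div_iff₀ den_pos]; linarith)

lemma smoothTransition_symm (x : ℝ) : Real.smoothTransition x + Real.smoothTransition (1 - x) = 1 := by
  unfold Real.smoothTransition
  have := Real.smoothTransition.pos_denom x
  have e : 1 - (1 - x) = x := by ring
  rw [e, add_comm (expNegInvGlue (1 - x)), ← add_div, div_self this.ne']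

lemma tau_symm (η : ℝ) : tau η + tau (2*π - η) = 1 := by
  unfold tau
  have : (2*π - η - 1) / (2*π - 2) = 1 - (η - 1) / (2*π - 2) := by
    rw [eq_sub_iff_add_eq, ← add_div, div_eq_one_iff_eq den_pos.ne']; ring
  rw [this, smoothTransition_symm]

lemma dtau_contDiff : ContDiff ℝ ((⊤ : ℕ∞) : WithTop ℕ∞) (deriv tau) := by
  have h := tau_contDiff
  have e : (((⊤ : ℕ∞) : WithTop ℕ∞)) = ((⊤ : ℕ∞) : WithTop ℕ∞) + 1 := rfl
  rw [e, contDiff_succ_iff_deriv] at h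
  exact h.2.2

lemma tau_hasDerivAt (s : ℝ) : HasDerivAt tau (deriv tau s) s :=
  ((tau_contDiff.differentiable (by simp)) s).hasDerivAt

lemma dtau_low {s : ℝ} (h : s < 1) : deriv tau s = 0 := by
  have : tau =ᶠ[nhds s] fun _ => 0 := by
    filter_upwards [Iio_mem_nhds h] with t ht using tau_zero (le_of_lt ht)
  rw [this.deriv_eq]; simp

lemma dtau_high {s : ℝ} (h : 2*π - 1 < s) : deriv tau s = 0 := by
  have : tau =ᶠ[nhds s] fun _ => 1 := by
    filter_upwards [Ioi_mem_nhds h] with t ht using tau_one (le_of_lt ht)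
  rw [this.deriv_eq]; simp

lemma A_pos {η : ℝ} (hη : 0 < η) : ∫ v in Set.Ioi (1:ℝ), η * deriv tau (v * η) = 1 - tau η := by
  have h := integral_Ioi_of_hasDerivAt_of_tendsto (a := 1) (f := fun v : ℝ => tau (v * η))
    (f' := fun v => η * deriv tau (v * η)) (m := 1) ?_ ?_ ?_ ?_
  · simpa using h
  · exact (tau_contDiff.continuous.comp (by fun_prop)).continuousWithinAt
  · intro v _
    have h1 := (tau_hasDerivAt (v * η)).comp v ((hasDerivAt_id v).mul_const η)
    simpa [Function.comp_def, mul_comm] using h1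
  · refine Integrable.integrableOn ?_
    refine Continuous.integrable_of_hasCompactSupport ?_ ?_
    · exact continuous_const.mul (dtau_contDiff.continuous.comp (by fun_prop))
    · refine HasCompactSupport.of_support_subset_isCompact (isCompact_Icc (a := 1/η) (b := (2*π-1)/η)) ?_
      intro v hv
      rw [Function.mem_support] at hv
      constructor
      · by_contra hc
        rw [not_le, lt_div_iff₀ hη] at hc
        exact hv (by rw [dtau_low hc, mul_zero])
      · by_contra hc
        rw [not_le, div_lt_iff₀ hη] at hc
        exact hv (by rw [dtau_high hc, mul_zero])
  · refine tendsto_const_nhds.congr' ?_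
    filter_upwards [Filter.eventually_ge_atTop ((2*π-1)/η)] with v hv
    rw [div_le_iff₀ hη] at hv
    exact (tau_one hv).symm

/-- The profile. -/
noncomputable def mfun (s : ℝ) : ℝ := s * Real.exp s * deriv tau s

lemma mfun_contDiff : ContDiff ℝ ((⊤ : ℕ∞) : WithTop ℕ∞) mfun :=
  (contDiff_id.mul Real.contDiff_exp).mul dtau_contDiff

lemma mfun_zero {s : ℝ} (h : s ∉ Set.Icc (1:ℝ) (2*π-1)) : mfun s = 0 := by
  rw [Set.mem_Icc, not_and_or, not_le, not_le] at h
  unfold mfun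
  rcases h with h | h
  · rw [dtau_low h, mul_zero]
  · rw [dtau_high h, mul_zero]

lemma mfun_compact : HasCompactSupport mfun :=
  HasCompactSupport.of_support_subset_isCompact (isCompact_Icc (a := 1) (b := 2*π-1))
    fun s hs => by by_contra h; exact hs (mfun_zero h)

noncomputable def psi (z : ℂ) : ℂ := ∫ s : ℝ, (mfun s : ℂ) * Complex.exp (I * s * z)

lemma mfun_integrable_mul {g : ℝ → ℂ} (hg : Continuous g) : Integrable (fun s : ℝ => (mfun s : ℂ) * g s) := by
  refine Continuous.integrable_of_hasCompactSupport ?_ ?_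
  · exact (continuous_ofReal.comp mfun_contDiff.continuous).mul hg
  · refine HasCompactSupport.mul_right ?_
    exact mfun_compact.comp_left (g := fun x : ℝ => (x:ℂ)) (by simp)

lemma psi_diff : Differentiable ℂ psi := by
  intro z0
  have h := hasDerivAt_integral_of_dominated_loc_of_deriv_le (μ := (volume : Measure ℝ)) (𝕜 := ℂ)
    (F := fun z (s:ℝ) => (mfun s : ℂ) * Complex.exp (I * s * z)) (x₀ := z0)
    (F' := fun z (s:ℝ) => (mfun s : ℂ) * (Complex.exp (I * s * z) * (I * s)))
    (bound := fun s : ℝ => ‖(mfun s : ℂ) * ((|s| * Real.exp (|s| * (‖z0‖+1)) : ℝ) : ℂ)‖)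
    (Metric.ball_mem_nhds z0 one_pos) ?_ ?_ ?_ ?_ ?_ ?_
  · exact h.2.differentiableAt
  · filter_upwards with z
    exact (mfun_integrable_mul (by fun_prop)).aestronglyMeasurable
  · exact mfun_integrable_mul (by fun_prop)
  · exact (mfun_integrable_mul (by fun_prop)).aestronglyMeasurable
  · filter_upwards with s z hz
    rw [norm_mul, norm_mul (mfun s : ℂ)]
    gcongr
    rw [norm_mul, Complex.norm_exp, norm_real, Real.norm_eq_abs, abs_of_nonneg (by positivity), mul_comm]
    have hz1 : ‖z‖ ≤ ‖z0‖ + 1 := by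
      have h1 : ‖z - z0‖ < 1 := by simpa [dist_eq_norm] using hz
      have h2 := norm_sub_norm_le z z0
      linarith
    have e1 : ‖I * (s:ℂ)‖ = |s| := by simp
    rw [e1]
    gcongr
    calc (I * s * z).re ≤ ‖I * s * z‖ := re_le_norm _
      _ = |s| * ‖z‖ := by simp
      _ ≤ _ := by gcongr
  · exact (mfun_integrable_mul (by fun_prop)).norm
  · filter_upwards with s z _
    have h1 : HasDerivAt (fun z : ℂ => I * s * z) (I * s) z := by
      simpa using (hasDerivAt_id z).const_mul (I * (s:ℂ))
    exact (h1.cexp).const_mul _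

lemma psi_bound : ∃ L : ℝ, 0 < L ∧ ∀ z : ℂ, ‖psi z‖ ≤ L * Real.exp (π * (|z.im| - z.im)) := by
  have hi : Integrable (fun s : ℝ => ‖(mfun s : ℂ)‖) := by
    simpa using (mfun_integrable_mul (g := fun _ => 1) continuous_const).norm
  refine ⟨(∫ s : ℝ, ‖(mfun s : ℂ)‖) + 1, by positivity, fun z => ?_⟩
  calc ‖psi z‖ ≤ (∫ s : ℝ, ‖(mfun s : ℂ)‖) * Real.exp (π * (|z.im| - z.im)) := by
        rw [← integral_mul_const]
        refine norm_integral_le_of_norm_le (hi.mul_const _) ?_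
        filter_upwards with s
        rw [norm_mul]
        by_cases hs : s ∈ Set.Icc (1:ℝ) (2*π-1)
        · gcongr
          rw [Complex.norm_exp]
          gcongr
          have : (I * s * z).re = -(s * z.im) := by simp
          rw [this]
          rcases le_total 0 z.im with h | h
          · rw [abs_of_nonneg h]
            have := mul_nonneg (zero_le_one.trans hs.1) h
            linarith
          · rw [abs_of_nonpos h]
            nlinarith [hs.2]
        · rw [mfun_zero hs]; simp
    _ ≤ _ := by gcongr; linarith

lemma psi_decay (M : ℕ) : ∃ C : ℝ, 0 < C ∧ ∀ x : ℝ, ‖psi x‖ ≤ C / (1 + |x|)^M := by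
  set g : ℝ → ℂ := fun s => (mfun s : ℂ) with hg
  have hgc : HasCompactSupport g := mfun_compact.comp_left (g := fun x : ℝ => (x:ℂ)) (by simp)
  have hgd : ContDiff ℝ ((⊤ : ℕ∞) : WithTop ℕ∞) g := ofRealCLM.contDiff.comp mfun_contDiff
  set G : SchwartzMap ℝ ℂ := hgc.toSchwartzMap hgd with hG
  set H : SchwartzMap ℝ ℂ := FourierTransform.fourier G with hH
  have hps : ∀ x : ℝ, psi x = H (-(x / (2*π))) := by
    intro x
    rw [hH, SchwartzMap.fourier_coe, Real.fourier_eq']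
    unfold psi
    congr 1; ext s
    have : G s = (mfun s : ℂ) := rfl
    rw [this, smul_eq_mul, mul_comm]
    congr 2
    simp
    field_simp
  have hb := SchwartzMap.one_add_le_sup_seminorm_apply (𝕜 := ℝ) (m := (M, 0)) (k := M) (n := 0) le_rfl le_rfl H
  set S := 2 ^ M * (Finset.Iic (M, 0)).sup (fun m => SchwartzMap.seminorm ℝ m.1 m.2) H with hS
  have hS0 : 0 ≤ S := by
    refine le_trans ?_ (hb 0)
    positivity
  refine ⟨(2*π)^M * (S + 1), by positivity, fun x => ?_⟩
  have h1 := hb (-(x / (2*π)))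
  rw [norm_iteratedFDeriv_zero, ← hps] at h1
  rw [le_div_iff₀ (by positivity)]
  have h2 : 1 + |x| ≤ (2*π) * (1 + ‖-(x / (2*π))‖) := by
    rw [norm_neg, Real.norm_eq_abs, abs_div, abs_of_pos (by positivity : 0 < 2*π), mul_add,
      mul_div_cancel₀ _ (by positivity)]
    linarith [pi_gt_three]
  calc ‖psi x‖ * (1 + |x|)^M ≤ ‖psi x‖ * ((2*π) * (1 + ‖-(x / (2*π))‖))^M := by gcongr
    _ = (2*π)^M * ((1 + ‖-(x / (2*π))‖)^M * ‖psi x‖) := by rw [mul_pow]; ring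
    _ ≤ (2*π)^M * S := by gcongr
    _ ≤ _ := by gcongr; linarith


/-- The atoms. The index is `ω = (v, u)`. -/
noncomputable def atom (p : ℝ) (ω : ℝ × ℝ) (z : ℂ) : ℂ :=
  ((ω.1 ^ (-(1/p)) : ℝ) : ℂ) * (Complex.exp (-(I * π * (z - ω.2))) * psi ((z - ω.2) / ω.1))

/-- The coefficients. -/
noncomputable def coef (α : ℝ) (F : ℂ → ℂ) (ω : ℝ × ℝ) : ℂ :=
  ((Real.exp (-(π * ω.1)) * ω.1 ^ α : ℝ) : ℂ) * F (ω.2 + ω.1 * I)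

lemma repro_fubini {F : ℂ → ℂ} {σ C : ℝ} (hσ : 0 ≤ σ) (hF : Dec F σ C 2)
    {v : ℝ} (hv : 0 < v) (x : ℝ) :
    ∫ u : ℝ, F (u + v * I) * Complex.exp (I * π * u) * psi (((x:ℂ) - u) / v)
      = ∫ s : ℝ, (mfun s : ℂ) * Complex.exp (I * s * (x / v)) *
          (Real.exp (-((s/v - π) * v)) * FT F (s / v - π)) := by
  have hFi := hF.integrable v
  have hmi : Integrable (fun s : ℝ => (mfun s : ℂ)) := by
    simpa using (mfun_integrable_mul (g := fun _ => 1) continuous_const)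
  have h2 : Integrable (fun q : ℝ × ℝ => F (q.1 + v * I) * Complex.exp (I * π * q.1) *
      ((mfun q.2 : ℂ) * Complex.exp (I * q.2 * (((x:ℂ) - q.1) / v)))) (volume.prod volume) := by
    refine Integrable.mono' (hFi.norm.mul_prod hmi.norm) ?_ ?_
    · refine Continuous.aestronglyMeasurable ?_
      have := hF.1.continuous
      have := mfun_contDiff.continuous
      fun_prop
    · filter_upwards with q
      simp only [norm_mul]
      have e1 : ‖Complex.exp (I * π * q.1)‖ = 1 := by
        rw [show I * (π:ℂ) * q.1 = ((π * q.1 : ℝ) : ℂ) * I by push_cast; ring, norm_exp_ofReal_mul_I]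
      have e2 : ‖Complex.exp (I * q.2 * (((x:ℂ) - q.1) / v))‖ = 1 := by
        rw [show I * q.2 * (((x:ℂ) - q.1) / v) = ((q.2 * ((x - q.1)/v) : ℝ) : ℂ) * I by
          push_cast; ring, norm_exp_ofReal_mul_I]
      rw [e1, e2]; simp
  have e1 : ∀ u : ℝ, F (u + v * I) * Complex.exp (I * π * u) * psi (((x:ℂ) - u) / v)
      = ∫ s : ℝ, F (u + v * I) * Complex.exp (I * π * u) *
      ((mfun s : ℂ) * Complex.exp (I * s * (((x:ℂ) - u) / v))) := by
    intro u
    rw [integral_const_mul]; rfl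
  simp only [e1]
  rw [integral_integral_swap h2]
  congr 1; ext s
  rw [← FT_shift' hσ hF, ← integral_const_mul]
  congr 1; ext u
  have hv' : (v:ℂ) ≠ 0 := by exact_mod_cast hv.ne'
  have : Complex.exp (I * π * u) * Complex.exp (I * s * (((x:ℂ) - u) / v)) =
      Complex.exp (I * s * (x / v)) * Complex.exp (-(I * ((s / v - π : ℝ):ℂ) * u)) := by
    rw [← Complex.exp_add, ← Complex.exp_add]
    congr 1
    push_cast
    ring
  linear_combination (F (u + v * I) * (mfun s : ℂ)) * this

lemma repro_inner {p : ℝ} {F : ℂ → ℂ} {σ C : ℝ} (hσ : 0 ≤ σ) (hF : Dec F σ C 2)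
    {v : ℝ} (hv : 0 < v) (x : ℝ) :
    ∫ u : ℝ, coef (1/p-2) F (v, u) * atom p (v, u) x
      = Complex.exp (-(I * π * x)) *
        ∫ η : ℝ, ((η * deriv tau (v * η) : ℝ) : ℂ) * (Complex.exp (I * η * x) * FT F (η - π)) := by
  have hvC : (v:ℂ) ≠ 0 := by exact_mod_cast hv.ne'
  have hvv : v ^ (1/p-2) * v ^ (-(1/p)) = (v⁻¹)^2 := by
    rw [← Real.rpow_add hv, show 1/p-2 + -(1/p) = -2 by ring, Real.rpow_neg hv.le, inv_pow]
    norm_num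
  have hvvC : ((v ^ (1/p-2) : ℝ) : ℂ) * ((v ^ (-(1/p)) : ℝ) : ℂ) = ((v:ℂ)⁻¹)^2 := by
    exact_mod_cast hvv
  have e1 : ∀ u : ℝ, coef (1/p-2) F (v, u) * atom p (v, u) x =
      (Complex.exp (-(I * π * x)) * (Real.exp (-(π * v)) * ((v:ℂ)⁻¹)^2)) *
       (F (u + v * I) * Complex.exp (I * π * u) * psi (((x:ℂ) - u) / v)) := by
    intro u
    unfold coef atom
    have : Complex.exp (-(I * π * ((x:ℂ) - u))) = Complex.exp (-(I * π * x)) * Complex.exp (I * π * u) := by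
      rw [← Complex.exp_add]; congr 1; ring
    simp only
    rw [this, ← hvvC]
    push_cast
    ring
  simp only [e1]
  rw [integral_const_mul, repro_fubini hσ hF hv x]
  set G : ℝ → ℂ := fun s => (mfun s : ℂ) * Complex.exp (I * s * (x / v)) *
          (Real.exp (-((s/v - π) * v)) * FT F (s / v - π)) with hG
  have hsub := Measure.integral_comp_mul_left G v
  rw [abs_of_pos (inv_pos.mpr hv)] at hsub
  have hsub' : ∫ s, G s = v * ∫ η, G (v * η) := by
    rw [hsub, real_smul]; push_cast; rw [← mul_assoc, mul_inv_cancel₀ hvC, one_mul]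
  rw [hsub', mul_assoc]
  congr 1
  rw [← mul_assoc, ← integral_const_mul]
  congr 1; ext η
  rw [hG]
  simp only
  have a1 : v * η / v = η := by field_simp
  have a2 : I * ((v * η : ℝ):ℂ) * (x / v) = I * η * x := by push_cast; field_simp
  rw [a1, a2]
  have a3 : Real.exp (-(π*v)) * (v⁻¹)^2 * v * (mfun (v*η) * Real.exp (-((η - π) * v))) = η * deriv tau (v * η) := by
    unfold mfun
    have : Real.exp (-(π*v)) * Real.exp (v*η) * Real.exp (-((η - π) * v)) = 1 := by
      rw [← Real.exp_add, ← Real.exp_add, ← Real.exp_zero]; congr 1; ring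
    have hv1 : v⁻¹ * v = 1 := inv_mul_cancel₀ hv.ne'
    linear_combination (η * deriv tau (v*η)) * (v⁻¹ * v)^2 * this +
      (η * deriv tau (v*η)) * (v⁻¹ * v + 1) * hv1
  rw [← a3]
  push_cast
  ring

lemma repro_half {p : ℝ} {F : ℂ → ℂ} {σ C : ℝ} (hσ : 0 ≤ σ) (hσ' : σ < π) (hF : Dec F σ C 2) (x : ℝ) :
    ∫ v in Set.Ioi (1:ℝ), ∫ u : ℝ, coef (1/p-2) F (v, u) * atom p (v, u) x
      = ∫ ξ : ℝ, ((1 - tau (ξ + π) : ℝ) : ℂ) * (Complex.exp (I * ξ * x) * FT F ξ) := by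
  rw [setIntegral_congr_fun measurableSet_Ioi (g := fun v => Complex.exp (-(I * π * x)) *
        ∫ η : ℝ, ((η * deriv tau (v * η) : ℝ) : ℂ) * (Complex.exp (I * η * x) * FT F (η - π)))
        (fun v hv => repro_inner hσ hF (lt_trans one_pos hv) x)]
  rw [integral_const_mul]
  have hz : ∀ η : ℝ, η ∉ Set.Icc (π - σ) (π + σ) → FT F (η - π) = 0 := by
    intro η h
    refine FT_zero hσ hF _ ?_
    by_contra h'
    rw [not_lt, abs_le] at h'
    exact h ⟨by linarith, by linarith⟩
  have hIntg : Integrable (fun q : ℝ × ℝ => ((q.2 * deriv tau (q.1 * q.2) : ℝ) : ℂ) *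
      (Complex.exp (I * q.2 * x) * FT F (q.2 - π))) ((volume.restrict (Set.Ioi (1:ℝ))).prod volume) := by
    have : ((volume.restrict (Set.Ioi (1:ℝ))).prod volume) =
      ((volume : Measure ℝ).prod (volume : Measure ℝ)).restrict (Set.Ioi (1:ℝ) ×ˢ Set.univ) := by
      rw [← Measure.prod_restrict, Measure.restrict_univ]
    rw [this]
    change IntegrableOn _ _ _
    have hc : Continuous (fun q : ℝ × ℝ => ((q.2 * deriv tau (q.1 * q.2) : ℝ) : ℂ) *
      (Complex.exp (I * q.2 * x) * FT F (q.2 - π))) := by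
      have := dtau_contDiff.continuous
      have := FT_cont hF
      fun_prop
    have hK : IsCompact (Set.Icc (1:ℝ) ((2*π-1)/(π-σ)) ×ˢ Set.Icc (π - σ) (π + σ)) :=
      isCompact_Icc.prod isCompact_Icc
    refine IntegrableOn.of_forall_sdiff_eq_zero (hc.continuousOn.integrableOn_compact hK)
      (measurableSet_Ioi.prod MeasurableSet.univ) ?_
    rintro ⟨v, η⟩ ⟨⟨hv, -⟩, h⟩
    simp only [Set.mem_Ioi] at hv
    by_cases hη : η ∈ Set.Icc (π - σ) (π + σ)
    · have : (2*π-1)/(π-σ) < v := by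
        by_contra h'
        exact h ⟨⟨hv.le, not_lt.mp h'⟩, hη⟩
      rw [div_lt_iff₀ (by linarith)] at this
      have h3 : v * (π - σ) ≤ v * η := by gcongr; exact hη.1
      simp [dtau_high (show 2*π-1 < v * η by linarith)]
    · simp [hz η hη]
  rw [integral_integral_swap hIntg, ← integral_const_mul]
  rw [← integral_sub_right_eq_self (fun ξ : ℝ => ((1 - tau (ξ + π) : ℝ) : ℂ) * (Complex.exp (I * ξ * x) * FT F ξ)) π]
  congr 1; ext η
  rw [integral_mul_const]
  by_cases hη : η ∈ Set.Icc (π - σ) (π + σ)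
  · have h0 : 0 < η := by linarith [hη.1]
    have := A_pos h0
    rw [integral_complex_ofReal, this, sub_add_cancel]
    have e : Complex.exp (I * ((η - π : ℝ):ℂ) * x) = Complex.exp (-(I * π * x)) * Complex.exp (I * η * x) := by
      rw [← Complex.exp_add]; congr 1; push_cast; ring
    rw [e]; ring
  · rw [hz η hη]; simp

lemma FT_neg (F : ℂ → ℂ) (ξ : ℝ) : FT (fun z => F (-z)) ξ = FT F (-ξ) := by
  unfold FT
  rw [← integral_neg_eq_self]
  congr 1; ext x; simp

lemma repro {p : ℝ} {F : ℂ → ℂ} {σ C : ℝ} (hσ : 0 ≤ σ) (hσ' : σ < π) (hF : Dec F σ C 2) (x : ℝ) :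
    (∫ v in Set.Ioi (1:ℝ), ∫ u : ℝ, coef (1/p-2) F (v, u) * atom p (v, u) x) +
    (∫ v in Set.Ioi (1:ℝ), ∫ u : ℝ, coef (1/p-2) (fun z => F (-z)) (v, u) * atom p (v, u) (-x))
      = 2 * π * F x := by
  have h2 := repro_half (p := p) hσ hσ' hF.neg (-x)
  rw [ofReal_neg] at h2
  rw [repro_half hσ hσ' hF x, h2]
  rw [← integral_neg_eq_self (fun ξ : ℝ => ((1 - tau (ξ + π) : ℝ) : ℂ) * (Complex.exp (I * ξ * -x) * FT (fun z => F (-z)) ξ)),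
    ← FT_inv hσ hF x]
  have hcF := FT_cont hF
  have hct := tau_contDiff.continuous
  have hFc : HasCompactSupport (FT F) := FT_compact hσ hF
  rw [← integral_add]
  · congr 1; ext ξ
    rw [FT_neg, neg_neg]
    have := tau_symm (ξ + π)
    rw [show 2*π - (ξ + π) = -ξ + π by ring] at this
    have t : ((tau (-ξ+π) : ℝ) : ℂ) = 1 - (tau (ξ+π) : ℝ) := by
      have h3 : tau (-ξ+π) = 1 - tau (ξ+π) := by linarith
      rw [h3]; push_cast; ring
    have e : I * ((-ξ : ℝ):ℂ) * -x = I * ξ * x := by push_cast; ring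
    rw [e]
    push_cast
    rw [t]; ring
  · exact Continuous.integrable_of_hasCompactSupport (by fun_prop) (hFc.mul_left.mul_left)
  · simp only [FT_neg, neg_neg]
    exact Continuous.integrable_of_hasCompactSupport (by fun_prop) (hFc.mul_left.mul_left)


lemma atom_expType {p : ℝ} (hp : 0 < p) {ω : ℝ × ℝ} (hv : 1 ≤ ω.1) : ExpTypePi (atom p ω) := by
  obtain ⟨L, hL, hb⟩ := psi_bound
  have hv0 : 0 < ω.1 := by linarith
  refine ⟨?_, fun ε hε => ⟨L, hL, fun z => ?_⟩⟩
  · unfold atom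
    have h1 : Differentiable ℂ (fun z : ℂ => psi ((z - ω.2) / ω.1)) := psi_diff.comp (by fun_prop)
    fun_prop
  · unfold atom
    rw [norm_mul, norm_mul, norm_real, Real.norm_eq_abs, abs_of_pos (by positivity), Complex.norm_exp]
    have e1 : (-(I * π * (z - ω.2))).re = π * z.im := by simp
    have e2 : ((z - ω.2) / (ω.1:ℂ)).im = z.im / ω.1 := by rw [Complex.div_ofReal_im]; simp
    have h1 := hb ((z - ω.2) / ω.1)
    rw [e2, abs_div, abs_of_pos hv0] at h1
    rw [e1]
    have h2 : ω.1 ^ (-(1/p)) ≤ 1 := Real.rpow_le_one_of_one_le_of_nonpos hv (by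
      have : 0 < 1/p := by positivity
      linarith)
    calc ω.1 ^ (-(1/p)) * (Real.exp (π * z.im) * ‖psi ((z - ω.2) / ω.1)‖)
        ≤ 1 * (Real.exp (π * z.im) * (L * Real.exp (π * (|z.im| / ω.1 - z.im / ω.1)))) := by gcongr
      _ = L * Real.exp (π * z.im + π * (|z.im| / ω.1 - z.im / ω.1)) := by rw [Real.exp_add]; ring
      _ ≤ _ := by
        gcongr
        have h3 : (|z.im| - z.im) / ω.1 ≤ |z.im| - z.im :=
          div_le_self (by linarith [le_abs_self z.im]) hv
        have h4 := Complex.abs_im_le_norm z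
        have h5 : z.im + (|z.im| / ω.1 - z.im / ω.1) ≤ ‖z‖ := by
          rw [← sub_div]; linarith
        have h6 : 0 ≤ ε * ‖z‖ := by positivity
        nlinarith [pi_pos]

lemma psi_Lp {p : ℝ} (hp : 0 < p) : (∫⁻ x : ℝ, (‖psi x‖₊ : ℝ≥0∞) ^ p) < ⊤ := by
  obtain ⟨M, hM⟩ := exists_nat_gt (2 / p)
  obtain ⟨C, hC, h⟩ := psi_decay M
  have hi := (integrable_dec2.const_mul (C^p)).lintegral_lt_top
  refine lt_of_le_of_lt (lintegral_mono fun x => ?_) hi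
  rw [enorm_rpow_ofReal _ hp.le]
  refine ENNReal.ofReal_le_ofReal ?_
  have h1 : (1:ℝ) ≤ 1 + |x| := by linarith [abs_nonneg x]
  calc ‖psi x‖ ^ p ≤ (C / (1 + |x|)^M) ^ p := Real.rpow_le_rpow (norm_nonneg _) (h x) hp.le
    _ = C^p * (1 / (1+|x|)^((M:ℝ)*p)) := by
      rw [Real.div_rpow hC.le (by positivity), ← Real.rpow_natCast, ← Real.rpow_mul (by positivity)]
      ring
    _ ≤ C^p * (1 / (1+|x|)^2) := by
      gcongr
      rw [← Real.rpow_natCast]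
      refine Real.rpow_le_rpow_of_exponent_le h1 ?_
      rw [div_lt_iff₀ hp] at hM
      exact_mod_cast hM.le

lemma atom_norm {p : ℝ} {ω : ℝ × ℝ} (hv : 0 < ω.1) (x : ℝ) :
    ‖atom p ω x‖ = ω.1 ^ (-(1/p)) * ‖psi (((x - ω.2) / ω.1 : ℝ) : ℂ)‖ := by
  unfold atom
  rw [norm_mul, norm_mul, norm_real, Real.norm_eq_abs, abs_of_pos (by positivity),
    show -(I * (π:ℂ) * (x - ω.2)) = ((-(π * (x - ω.2)) : ℝ) : ℂ) * I by push_cast; ring,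
    norm_exp_ofReal_mul_I, one_mul]
  push_cast; rfl

lemma atom_Lp {p : ℝ} (hp : 0 < p) {ω : ℝ × ℝ} (hv : 0 < ω.1) :
    (∫⁻ x : ℝ, (‖atom p ω x‖₊ : ℝ≥0∞) ^ p) = ∫⁻ x : ℝ, (‖psi x‖₊ : ℝ≥0∞) ^ p := by
  have e : ∀ x : ℝ, (‖atom p ω x‖₊ : ℝ≥0∞) ^ p =
      ENNReal.ofReal ω.1⁻¹ * (fun t : ℝ => (fun s : ℝ => (‖psi s‖₊ : ℝ≥0∞) ^ p) (ω.1⁻¹ * t)) (x - ω.2) := by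
    intro x
    simp only
    rw [enorm_rpow_ofReal _ hp.le, enorm_rpow_ofReal _ hp.le, ← ENNReal.ofReal_mul (by positivity),
      atom_norm hv, Real.mul_rpow (by positivity) (by positivity), ← Real.rpow_mul hv.le]
    congr 2
    · rw [show -(1/p) * p = -1 by field_simp, Real.rpow_neg_one]
    · rw [div_eq_inv_mul]
  simp only [e]
  rw [lintegral_const_mul' _ _ ENNReal.ofReal_ne_top,
    lintegral_sub_right_eq_self (fun t : ℝ => (‖psi ((ω.1⁻¹ * t : ℝ) : ℂ)‖₊ : ℝ≥0∞) ^ p),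
    lintegral_scale (fun s : ℝ => (‖psi s‖₊ : ℝ≥0∞) ^ p) (inv_pos.mpr hv), ← mul_assoc,
    ← ENNReal.ofReal_mul (by positivity), mul_inv_cancel₀ (inv_pos.mpr hv).ne']
  simp

lemma atom_ball {p : ℝ} (hp : 0 < p) : ∃ c : ℝ, 0 < c ∧ ∀ ω : ℝ × ℝ, 1 ≤ ω.1 →
    atom p ω ∈ c • Bp p ∧ (fun z => atom p ω (-z)) ∈ c • Bp p := by
  have hI := psi_Lp hp
  set A := (∫⁻ x : ℝ, (‖psi x‖₊ : ℝ≥0∞) ^ p)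
  refine ⟨(A.toReal + 1) ^ (1/p), by positivity, fun ω hv => ?_⟩
  have hv0 : 0 < ω.1 := by linarith
  have hA : A ≤ ENNReal.ofReal (((A.toReal + 1) ^ (1/p)) ^ p) := by
    rw [← Real.rpow_mul (by positivity), one_div_mul_cancel hp.ne', Real.rpow_one,
      ← ENNReal.ofReal_toReal hI.ne]
    gcongr
    simp
  refine ⟨mem_smul_Bp hp (by positivity) (atom_expType hp hv) ?_,
    mem_smul_Bp hp (by positivity) (atom_expType hp hv).neg ?_⟩
  · rw [atom_Lp hp hv0]; exact hA
  · rw [lintegral_neg_comp, atom_Lp hp hv0]; exact hA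

lemma atom_decay {p : ℝ} (hp : 0 < p) (M : ℕ) : ∃ C : ℝ, 0 < C ∧ ∀ ω : ℝ × ℝ, 1 ≤ ω.1 → ∀ x : ℝ,
    ‖atom p ω x‖ ≤ C * (1 + ‖ω‖) ^ (2*M) / (1 + |x|)^M := by
  obtain ⟨C, hC, h⟩ := psi_decay M
  refine ⟨C, hC, fun ω hv x => ?_⟩
  have hv0 : 0 < ω.1 := by linarith
  rw [atom_norm hv0]
  have h2 : ω.1 ^ (-(1/p)) ≤ 1 := Real.rpow_le_one_of_one_le_of_nonpos hv (by
      have : 0 < 1/p := by positivity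
      linarith)
  have n1 : ω.1 ≤ ‖ω‖ := (le_abs_self _).trans (by simpa using norm_fst_le ω)
  have n2 : |ω.2| ≤ ‖ω‖ := by simpa using norm_snd_le ω
  calc _ ≤ 1 * (C / (1 + |(x - ω.2)/ω.1|)^M) := by gcongr; exact h _
    _ ≤ _ := by
      rw [one_mul, div_le_div_iff₀ (by positivity) (by positivity), mul_assoc, pow_mul, ← mul_pow]
      gcongr
      have h3 : |x - ω.2| = ω.1 * |(x - ω.2)/ω.1| := by
        rw [abs_div, abs_of_pos hv0]; field_simp
      have h4 : |x| ≤ |x - ω.2| + |ω.2| := by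
        have := abs_add_le (x - ω.2) ω.2
        simpa using this
      set t := |(x - ω.2)/ω.1|
      have ht : 0 ≤ t := abs_nonneg _
      have hn : 1 ≤ ‖ω‖ := by linarith
      have h5 : ω.1 * t ≤ ‖ω‖ * t := by gcongr
      nlinarith [mul_nonneg ht (sq_nonneg ‖ω‖), mul_nonneg ht (norm_nonneg ω)]

lemma atom_contOn (p : ℝ) (z : ℂ) : ContinuousOn (fun ω => atom p ω z) (Set.Ioi 0 ×ˢ Set.univ) := by
  rintro ω ⟨hω, -⟩
  have hω : 0 < ω.1 := hω
  refine ContinuousAt.continuousWithinAt ?_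
  unfold atom
  have h1 : ContinuousAt (fun ω : ℝ × ℝ => ω.1 ^ (-(1/p))) ω :=
    continuousAt_fst.rpow_const (Or.inl hω.ne')
  have h2 : ContinuousAt (fun ω : ℝ × ℝ => psi ((z - ω.2) / ω.1)) ω := by
    refine psi_diff.continuous.continuousAt.comp ?_
    refine ContinuousAt.div (by fun_prop) (by fun_prop) ?_
    exact_mod_cast hω.ne'
  have h3 : ContinuousAt (fun ω : ℝ × ℝ => Complex.exp (-(I * π * (z - ω.2)))) ω := by fun_prop
  exact (continuous_ofReal.continuousAt.comp h1).mul (h3.mul h2)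

lemma coef_contOn (α : ℝ) {F : ℂ → ℂ} (hF : Continuous F) :
    ContinuousOn (coef α F) (Set.Ioi 0 ×ˢ Set.univ) := by
  rintro ω ⟨hω, -⟩
  have hω : 0 < ω.1 := hω
  refine ContinuousAt.continuousWithinAt ?_
  unfold coef
  have h1 : ContinuousAt (fun ω : ℝ × ℝ => Real.exp (-(π * ω.1)) * ω.1 ^ α) ω :=
    ContinuousAt.mul (by fun_prop) (continuousAt_fst.rpow_const (Or.inl hω.ne'))
  refine (continuous_ofReal.continuousAt.comp h1).mul ?_
  fun_prop

lemma sum_cone {K : Set (ℂ → ℂ)} (hK : Convex ℝ K) (h0 : (0 : ℂ → ℂ) ∈ K) {ι : Type*} (s : Finset ι)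
    (t : ι → ℝ) (g : ι → ℂ → ℂ) (ht : ∀ i ∈ s, 0 ≤ t i) (hg : ∀ i ∈ s, g i ∈ t i • K) :
    (∑ i ∈ s, g i) ∈ (∑ i ∈ s, t i) • K := by
  classical
  induction s using Finset.induction_on with
  | empty => simp only [Finset.sum_empty]; rw [Set.mem_smul_set]; exact ⟨0, h0, by simp⟩
  | insert a s ha ih =>
    rw [Finset.sum_insert ha, Finset.sum_insert ha, hK.add_smul (ht a (Finset.mem_insert_self _ _))
      (Finset.sum_nonneg fun i hi => ht i (Finset.mem_insert_of_mem hi))]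
    exact Set.add_mem_add (hg a (Finset.mem_insert_self _ _))
      (ih (fun i hi => ht i (Finset.mem_insert_of_mem hi)) (fun i hi => hg i (Finset.mem_insert_of_mem hi)))

lemma smul_cone_mono {K : Set (ℂ → ℂ)} (hK : Convex ℝ K) (h0 : (0 : ℂ → ℂ) ∈ K) {s t : ℝ}
    (hs : 0 ≤ s) (hst : s ≤ t) : s • K ⊆ t • K := by
  have e : t = s + (t - s) := by ring
  rw [e, hK.add_smul hs (by linarith)]
  intro x hx
  have : (0 : ℂ → ℂ) ∈ (t - s) • K := ⟨0, h0, by simp⟩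
  have := Set.add_mem_add hx this
  simpa using this

lemma Bp_zero {p : ℝ} (hp : 0 < p) : (0 : ℂ → ℂ) ∈ Bp p := by
  refine ⟨ExpTypePi.zero, ?_⟩
  simp [ENNReal.zero_rpow_of_pos hp]

lemma cmul_mem {p r : ℝ} (hr : 0 < r) {φ : ℂ → ℂ} (hφ : φ ∈ r • Bp p) (l : ℂ) (hp : 0 < p) :
    (fun z => l * φ z) ∈ (r * ‖l‖) • convexHull ℝ (Bp p) := by
  obtain ⟨b, hb, rfl⟩ := hφ
  rcases eq_or_ne l 0 with rfl | hl
  · exact ⟨0, subset_convexHull ℝ _ (Bp_zero hp), by ext; simp⟩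
  · have hl' : ‖l‖ ≠ 0 := by simpa using hl
    refine ⟨fun z => (l / ‖l‖) * b z, subset_convexHull ℝ _ ⟨hb.1.const_mul _, ?_⟩, ?_⟩
    · refine le_trans (le_of_eq ?_) hb.2
      refine lintegral_congr fun x => ?_
      rw [nnnorm_mul]
      have : ‖l / (‖l‖:ℂ)‖₊ = 1 := by
        ext; simp [hl']
      rw [this, one_mul]
    · ext z
      have : (‖l‖ : ℂ) ≠ 0 := by exact_mod_cast hl'
      simp only [Pi.smul_apply, real_smul]
      push_cast
      field_simp

lemma cone_integral {p r : ℝ} (hp : 0 < p) (hr : 0 < r) {Ω : Type*} [MeasurableSpace Ω] {ν : Measure Ω}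
    {a : Ω → ℂ} (ha : Integrable a ν) {X : Type*} (c : SimpleFunc Ω X) (Φ : X → ℂ → ℂ)
    (hΦ : ∀ ω, Φ (c ω) ∈ r • Bp p) :
    (fun z => ∫ ω, a ω * Φ (c ω) z ∂ν) ∈ (r * ∫ ω, ‖a ω‖ ∂ν) • convexHull ℝ (Bp p) := by
  have hU : (⋃ y ∈ c.range, c ⁻¹' {y}) = Set.univ := by
    ext ω; simp
  have hdis : (c.range : Set X).PairwiseDisjoint (fun y => c ⁻¹' {y}) := by
    intro y _ y' _ hyy
    refine Set.disjoint_left.mpr fun ω h1 h2 => hyy ?_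
    simp only [Set.mem_preimage, Set.mem_singleton_iff] at h1 h2
    rw [← h1, h2]
  have e1 : (fun z => ∫ ω, a ω * Φ (c ω) z ∂ν) =
      ∑ y ∈ c.range, (fun z => (∫ ω in c ⁻¹' {y}, a ω ∂ν) * Φ y z) := by
    ext z
    rw [Finset.sum_apply, ← setIntegral_univ, ← hU, integral_biUnion_finset _ (fun y _ => c.measurableSet_fiber y) hdis]
    · refine Finset.sum_congr rfl fun y _ => ?_
      rw [← integral_mul_const]
      refine setIntegral_congr_fun (c.measurableSet_fiber y) fun ω hω => ?_
      simp only [Set.mem_preimage, Set.mem_singleton_iff] at hω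
      simp only [hω]
    · intro y _
      refine IntegrableOn.congr_fun (f := fun ω => a ω * Φ y z) (ha.integrableOn.mul_const _) ?_ (c.measurableSet_fiber y)
      intro ω hω
      simp only [Set.mem_preimage, Set.mem_singleton_iff] at hω
      simp only [hω]
  have e2 : (∫ ω, ‖a ω‖ ∂ν) = ∑ y ∈ c.range, ∫ ω in c ⁻¹' {y}, ‖a ω‖ ∂ν := by
    rw [← setIntegral_univ, ← hU, integral_biUnion_finset _ (fun y _ => c.measurableSet_fiber y) hdis]
    exact fun y _ => ha.norm.integrableOn
  rw [e1, e2, Finset.mul_sum]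
  refine sum_cone (convex_convexHull ℝ _) (subset_convexHull ℝ _ (Bp_zero hp)) _ _ _ ?_ ?_
  · intro y _; exact mul_nonneg hr.le (integral_nonneg fun _ => norm_nonneg _)
  · intro y hy
    rw [SimpleFunc.mem_range] at hy
    obtain ⟨ω, rfl⟩ := hy
    refine smul_cone_mono (convex_convexHull ℝ _) (subset_convexHull ℝ _ (Bp_zero hp)) (by positivity) ?_
      (cmul_mem hr (hΦ ω) _ hp)
    gcongr
    exact norm_integral_le_integral_norm _


/-- The parameter measure on `(v,u)`, `v > 1`. -/
noncomputable def nuM : Measure (ℝ × ℝ) := ((volume : Measure ℝ).restrict (Set.Ioi (1:ℝ))).prod volume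

lemma nuM_eq : nuM = (volume : Measure (ℝ × ℝ)).restrict (Set.Ioi (1:ℝ) ×ˢ Set.univ) := by
  unfold nuM
  rw [Measure.volume_eq_prod, ← Measure.prod_restrict, Measure.restrict_univ]

lemma nuM_ae : ∀ᵐ ω ∂nuM, 1 < ω.1 := by
  rw [nuM_eq, ae_restrict_iff' (measurableSet_Ioi.prod MeasurableSet.univ)]
  filter_upwards with ω hω using hω.1

lemma nuM_meas {g : ℝ × ℝ → ℂ} (hg : ContinuousOn g (Set.Ioi 0 ×ˢ Set.univ)) :
    AEStronglyMeasurable g nuM := by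
  rw [nuM_eq]
  refine (hg.mono ?_).aestronglyMeasurable (measurableSet_Ioi.prod MeasurableSet.univ)
  rintro ω ⟨h, -⟩
  exact ⟨Set.mem_Ioi.mpr (lt_trans one_pos (Set.mem_Ioi.mp h)), trivial⟩

lemma coef_integrable {α : ℝ} (hα : -1 < α) {F : ℂ → ℂ} {σ C : ℝ} (hσ' : σ < π) {M : ℕ}
    (hF : Dec F σ C (2*M+2)) : Integrable (fun ω => ‖coef α F ω‖ * (1 + ‖ω‖)^(2*M)) nuM := by
  have hC := hF.C_nonneg
  have h1 : IntegrableOn (fun v : ℝ => (2:ℝ)^(2*M) * C * (v ^ (α + 2*M) * Real.exp (-(π-σ) * v ^ (1:ℝ)))) (Set.Ioi 1) :=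
    ((integrableOn_rpow_mul_exp_neg_mul_rpow (by
      have : (0:ℝ) ≤ M := by positivity
      linarith) one_pos (by linarith)).mono_set
      (Set.Ioi_subset_Ioi zero_le_one)).const_mul _
  have h2 := Integrable.mul_prod h1 integrable_dec2
  refine Integrable.mono' h2 ?_ ?_
  · refine AEStronglyMeasurable.mul (nuM_meas (coef_contOn α hF.1.continuous)).norm ?_
    exact Continuous.aestronglyMeasurable (by fun_prop)
  · filter_upwards [nuM_ae] with ω hω
    have hω0 : 0 < ω.1 := by linarith
    rw [Real.norm_eq_abs, abs_of_nonneg (by positivity)]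
    have hb := hF.2 (ω.2 + ω.1 * I)
    simp only [add_im, ofReal_im, mul_im, ofReal_re, I_im, mul_one, I_re, mul_zero, add_zero, zero_add,
      add_re, mul_re, sub_zero, abs_of_pos hω0, sub_self] at hb
    have hc : ‖coef α F ω‖ = Real.exp (-(π * ω.1)) * ω.1 ^ α * ‖F (ω.2 + ω.1 * I)‖ := by
      unfold coef
      rw [norm_mul, norm_real, Real.norm_eq_abs, abs_of_pos (by positivity)]
    have hn : 1 + ‖ω‖ ≤ (2 * ω.1) * (1 + |ω.2|) := by
      have : ‖ω‖ ≤ ω.1 + |ω.2| := by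
        rw [Prod.norm_def]
        refine max_le ?_ ?_
        · rw [Real.norm_eq_abs, abs_of_pos hω0]; linarith [abs_nonneg ω.2]
        · rw [Real.norm_eq_abs]; linarith
      nlinarith [abs_nonneg ω.2]
    rw [hc]
    calc _ ≤ Real.exp (-(π * ω.1)) * ω.1 ^ α * (C * Real.exp (σ * ω.1) / (1 + |ω.2|)^(2*M+2)) *
          ((2 * ω.1) * (1 + |ω.2|))^(2*M) := by gcongr
      _ = _ := by
        have e1 : ω.1 ^ (α + 2*M) = ω.1 ^ α * ω.1^(2*M) := by
          rw [Real.rpow_add hω0, ← Real.rpow_natCast]; push_cast; rfl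
        have e2 : Real.exp (-(π-σ) * ω.1 ^ (1:ℝ)) = Real.exp (-(π * ω.1)) * Real.exp (σ * ω.1) := by
          rw [← Real.exp_add, Real.rpow_one]; congr 1; ring
        rw [e1, e2, mul_pow, mul_pow, pow_add]
        have : (1 + |ω.2|) ≠ 0 := by positivity
        field_simp

lemma coef_integrable' {α : ℝ} (hα : -1 < α) {F : ℂ → ℂ} {σ C : ℝ} (hσ' : σ < π) {M : ℕ}
    (hF : Dec F σ C (2*M+2)) : Integrable (coef α F) nuM := by
  refine Integrable.mono (coef_integrable hα hσ' hF) (nuM_meas (coef_contOn α hF.1.continuous)) ?_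
  filter_upwards with ω
  rw [Real.norm_eq_abs, abs_of_nonneg (by positivity)]
  refine le_mul_of_one_le_right (norm_nonneg _) (one_le_pow₀ ?_)
  linarith [norm_nonneg ω]

lemma coef_Nplus {α : ℝ} {F : ℂ → ℂ} (hF : Continuous F) (hi : Integrable (coef α F) nuM) :
    ENNReal.ofReal (∫ ω, ‖coef α F ω‖ ∂nuM) ≤ Nplus α F := by
  rw [ofReal_integral_eq_lintegral_ofReal hi.norm (by filter_upwards with ω using norm_nonneg _)]
  have hm : AEMeasurable (fun ω => ENNReal.ofReal ‖coef α F ω‖) nuM :=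
    hi.norm.aestronglyMeasurable.aemeasurable.ennreal_ofReal
  unfold nuM at hm ⊢
  rw [lintegral_prod _ hm]
  unfold Nplus
  refine le_trans ?_ (lintegral_mono_set (Set.Ioi_subset_Ioi zero_le_one))
  refine setLIntegral_mono' measurableSet_Ioi fun v hv => lintegral_mono fun u => le_of_eq ?_
  have hv0 : 0 < v := lt_trans one_pos hv
  unfold coef
  rw [norm_mul, norm_real, Real.norm_eq_abs, abs_of_pos (by positivity), ENNReal.ofReal_mul (by positivity)]
  congr 1
  exact ofReal_norm _

lemma half_seq {p c : ℝ} (hp : 0 < p) (hp1 : p < 1) (hc : 0 < c)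
    (hb : ∀ ω : ℝ × ℝ, 1 ≤ ω.1 → atom p ω ∈ c • Bp p ∧ (fun z => atom p ω (-z)) ∈ c • Bp p)
    {F : ℂ → ℂ} {σ C : ℝ} (hσ' : σ < π) {M : ℕ} (hF : Dec F σ C (2*M+2)) :
    ∃ g : ℕ → ℂ → ℂ, ∃ D : ℝ, 0 ≤ D ∧
      (∀ n, g n ∈ (c * ∫ ω, ‖coef (1/p-2) F ω‖ ∂nuM) • convexHull ℝ (Bp p)) ∧
      (∀ n, (fun z => g n (-z)) ∈ (c * ∫ ω, ‖coef (1/p-2) F ω‖ ∂nuM) • convexHull ℝ (Bp p)) ∧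
      (∀ n, ∀ x : ℝ, ‖g n x‖ ≤ D / (1 + |x|)^M) ∧
      (∀ x : ℝ, Filter.Tendsto (fun n => g n x) Filter.atTop
        (nhds (∫ v in Set.Ioi (1:ℝ), ∫ u : ℝ, coef (1/p-2) F (v, u) * atom p (v, u) x))) := by
  have hα : -1 < 1/p - 2 := by
    have : 1 < 1/p := by rw [lt_div_iff₀ hp]; linarith
    linarith
  set α := 1/p - 2 with hαdef
  have hi := coef_integrable hα hσ' hF
  have hi' := coef_integrable' hα hσ' hF
  obtain ⟨L, hL, hdec⟩ := atom_decay hp M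
  set s : Set (ℝ × ℝ) := Set.Ici (1:ℝ) ×ˢ Set.univ with hs
  have h0 : ((1:ℝ), (0:ℝ)) ∈ s := ⟨le_refl (1:ℝ), trivial⟩
  set cn : ℕ → SimpleFunc (ℝ × ℝ) (ℝ × ℝ) := fun n => SimpleFunc.approxOn id measurable_id s _ h0 n with hcn
  have hcs : ∀ n ω, 1 ≤ (cn n ω).1 := fun n ω => (SimpleFunc.approxOn_mem measurable_id h0 n ω).1
  have hnorm : ∀ n ω, 1 + ‖cn n ω‖ ≤ 2 * (1 + ‖ω‖) := by
    intro n ω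
    have h1 := SimpleFunc.edist_approxOn_le measurable_id h0 ω n
    rw [edist_dist, edist_dist, ENNReal.ofReal_le_ofReal_iff dist_nonneg, dist_eq_norm, dist_eq_norm] at h1
    have h2 : ‖((1:ℝ),(0:ℝ)) - id ω‖ ≤ 1 + ‖ω‖ := (norm_sub_le _ _).trans (by simp [Prod.norm_def])
    have h3 : ‖cn n ω‖ ≤ ‖cn n ω - id ω‖ + ‖ω‖ := by
      have := norm_add_le (cn n ω - id ω) (id ω)
      simpa using this
    linarith
  have hbd : ∀ n ω, ∀ x : ℝ, ‖coef α F ω * atom p (cn n ω) x‖ ≤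
      (L * 2^(2*M) / (1 + |x|)^M) * (‖coef α F ω‖ * (1 + ‖ω‖)^(2*M)) := by
    intro n ω x
    rw [norm_mul]
    calc _ ≤ ‖coef α F ω‖ * (L * (2 * (1 + ‖ω‖)) ^ (2*M) / (1 + |x|)^M) := by
          gcongr
          refine (hdec _ (hcs n ω) x).trans ?_
          gcongr
          exact hnorm n ω
      _ = _ := by rw [mul_pow]; ring
  refine ⟨fun n z => ∫ ω, coef α F ω * atom p (cn n ω) z ∂nuM,
    L * 2^(2*M) * ∫ ω, ‖coef α F ω‖ * (1 + ‖ω‖)^(2*M) ∂nuM, by positivity, ?_, ?_, ?_, ?_⟩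
  · intro n
    exact cone_integral hp hc hi' (cn n) (atom p) fun ω => (hb _ (hcs n ω)).1
  · intro n
    exact cone_integral hp hc hi' (cn n) (fun ω z => atom p ω (-z)) fun ω => (hb _ (hcs n ω)).2
  · intro n x
    refine (norm_integral_le_of_norm_le (hi.const_mul (L * 2^(2*M) / (1 + |x|)^M))
      (by filter_upwards with ω using hbd n ω x)).trans (le_of_eq ?_)
    rw [integral_const_mul]; ring
  · intro x
    have hae : ∀ᵐ ω ∂nuM, Filter.Tendsto (fun n => coef α F ω * atom p (cn n ω) x) Filter.atTop
        (nhds (coef α F ω * atom p ω x)) := by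
      filter_upwards [nuM_ae] with ω hω
      refine Filter.Tendsto.const_mul _ ?_
      have h1 : Filter.Tendsto (fun n => cn n ω) Filter.atTop (nhds ω) := by
        have := SimpleFunc.tendsto_approxOn measurable_id h0 (x := ω) (subset_closure ⟨hω.le, trivial⟩)
        simpa using this
      have h2 : ContinuousAt (fun ω => atom p ω x) ω :=
        (atom_contOn p x).continuousAt ((isOpen_Ioi.prod isOpen_univ).mem_nhds
          ⟨show (0:ℝ) < ω.1 by linarith, trivial⟩)
      exact h2.tendsto.comp h1
    have hmeas : ∀ n, AEStronglyMeasurable (fun ω => coef α F ω * atom p (cn n ω) x) nuM := by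
      intro n
      refine hi'.aestronglyMeasurable.mul ?_
      exact ((cn n).map (fun c => atom p c x)).aestronglyMeasurable
    have key := tendsto_integral_of_dominated_convergence _ hmeas
      (hi.const_mul (L * 2^(2*M) / (1 + |x|)^M)) (fun n => by filter_upwards with ω using hbd n ω x) hae
    have hIntg : Integrable (fun ω => coef α F ω * atom p ω x) nuM := by
      refine Integrable.mono' (hi.const_mul (L * 2^(2*M) / (1 + |x|)^M))
        (hi'.aestronglyMeasurable.mul (nuM_meas (atom_contOn p x))) ?_
      filter_upwards [hae] with ω hω
      exact le_of_tendsto hω.norm (by filter_upwards with n using hbd n ω x)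
    have e : ∫ ω, coef α F ω * atom p ω x ∂nuM =
        ∫ v in Set.Ioi (1:ℝ), ∫ u : ℝ, coef α F (v, u) * atom p (v, u) x := by
      unfold nuM at hIntg ⊢
      exact integral_prod _ hIntg
    rwa [e] at key

lemma hull_expType {p : ℝ} {g : ℂ → ℂ} (hg : g ∈ convexHull ℝ (Bp p)) : ExpTypePi g := by
  have hc : Convex ℝ {f : ℂ → ℂ | ExpTypePi f} := by
    intro f hf g hg a b _ _ _
    exact (hf.const_mul a).add (hg.const_mul b)
  exact convexHull_min (fun f hf => hf.1) hc hg

lemma smul_hull_expType {p r : ℝ} {g : ℂ → ℂ} (hg : g ∈ r • convexHull ℝ (Bp p)) : ExpTypePi g := by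
  obtain ⟨b, hb, rfl⟩ := hg
  exact (hull_expType hb).const_mul r

lemma approx_Dec {p c : ℝ} (hp : 0 < p) (hp1 : p < 1) (hc : 0 < c)
    (hb : ∀ ω : ℝ × ℝ, 1 ≤ ω.1 → atom p ω ∈ c • Bp p ∧ (fun z => atom p ω (-z)) ∈ c • Bp p)
    {F : ℂ → ℂ} {σ C : ℝ} (hσ : 0 ≤ σ) (hσ' : σ < π) {M : ℕ} (hM : 2 / p < M) (hF : Dec F σ C (2*M+2))
    (hN : NW (1/p-2) F < ⊤)
    {ε : ℝ} (hε : 0 < ε) :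
    ∃ g ∈ (c * (NW (1/p-2) F).toReal) • convexHull ℝ (Bp p),
      (∫⁻ x : ℝ, (‖F x - g x‖₊ : ℝ≥0∞)^p) ≤ ENNReal.ofReal ε := by
  have hα : -1 < 1/p - 2 := by
    have : 1 < 1/p := by rw [lt_div_iff₀ hp]; linarith
    linarith
  obtain ⟨g, D, hD, hg1, hg2, hg3, hg4⟩ := half_seq hp hp1 hc hb hσ' hF
  obtain ⟨h, D', hD', hh1, hh2, hh3, hh4⟩ := half_seq hp hp1 hc hb hσ' hF.neg
  have hK := convex_convexHull ℝ (Bp p)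
  have h0 := subset_convexHull ℝ _ (Bp_zero hp)
  set A := ∫ ω, ‖coef (1/p-2) F ω‖ ∂nuM with hA
  set A' := ∫ ω, ‖coef (1/p-2) (fun z => F (-z)) ω‖ ∂nuM with hA'
  have hA0 : 0 ≤ A := integral_nonneg fun _ => norm_nonneg _
  have hA0' : 0 ≤ A' := integral_nonneg fun _ => norm_nonneg _
  have hAA : A + A' ≤ (NW (1/p-2) F).toReal := by
    rw [← ENNReal.ofReal_le_iff_le_toReal hN.ne, ENNReal.ofReal_add hA0 hA0']
    have := N_split (1/p-2) hF.1.continuous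
    unfold NW
    rw [this]
    exact add_le_add (coef_Nplus hF.1.continuous (coef_integrable' hα hσ' hF))
      (coef_Nplus hF.neg.1.continuous (coef_integrable' hα hσ' hF.neg))
  set S : ℕ → ℂ → ℂ := fun n => (2*π)⁻¹ • (g n + fun z => h n (-z)) with hS
  have hSmem : ∀ n, S n ∈ (c * (NW (1/p-2) F).toReal) • convexHull ℝ (Bp p) := by
    intro n
    have h1 : g n + (fun z => h n (-z)) ∈ (c * A + c * A') • convexHull ℝ (Bp p) := by
      rw [hK.add_smul (by positivity) (by positivity)]
      exact Set.add_mem_add (hg1 n) (hh2 n)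
    have h2 : S n ∈ ((2*π)⁻¹ * (c * A + c * A')) • convexHull ℝ (Bp p) := by
      rw [← smul_smul]
      exact Set.smul_mem_smul_set h1
    refine smul_cone_mono hK h0 (by positivity) ?_ h2
    have h3 : (2*π)⁻¹ ≤ 1 := inv_le_one_of_one_le₀ (by linarith [pi_gt_three])
    calc (2*π)⁻¹ * (c * A + c * A') ≤ 1 * (c * A + c * A') := by gcongr
      _ = c * (A + A') := by ring
      _ ≤ _ := by gcongr
  have hpt : ∀ x : ℝ, Filter.Tendsto (fun n => S n x) Filter.atTop (nhds (F x)) := by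
    intro x
    have h2 := hh4 (-x)
    rw [ofReal_neg] at h2
    have h3 := ((hg4 x).add h2).const_smul ((2*π)⁻¹ : ℝ)
    rw [repro hσ hσ' (hF.mono (by omega)) x] at h3
    have e : (2*π)⁻¹ • (2 * π * F x) = F x := by
      have : (π:ℂ) ≠ 0 := by exact_mod_cast pi_ne_zero
      rw [real_smul]; push_cast; field_simp
    rw [e] at h3
    exact h3
  have hSb : ∀ n, ∀ x : ℝ, ‖S n x‖ ≤ (D + D') / (1 + |x|)^M := by
    intro n x
    have h3 : (2*π)⁻¹ ≤ 1 := inv_le_one_of_one_le₀ (by linarith [pi_gt_three])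
    have h4 := hh3 n (-x)
    rw [ofReal_neg, abs_neg] at h4
    rw [hS]
    simp only [Pi.smul_apply, Pi.add_apply]
    rw [norm_smul, Real.norm_eq_abs, abs_of_pos (by positivity)]
    calc _ ≤ 1 * (‖g n x‖ + ‖h n (-x)‖) := by
          gcongr; exact norm_add_le _ _
      _ ≤ 1 * (D / (1 + |x|)^M + D' / (1 + |x|)^M) := by gcongr; exact hg3 n x
      _ = _ := by ring
  have hFb : ∀ x : ℝ, ‖F x‖ ≤ (D + D') / (1 + |x|)^M := fun x =>
    le_of_tendsto (hpt x).norm (by filter_upwards with n using hSb n x)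
  set E := (2 * (D + D')) with hE
  have hE0 : 0 ≤ E := by positivity
  have hmaj : ∀ n, ∀ x : ℝ, (‖F x - S n x‖₊ : ℝ≥0∞)^p ≤ ENNReal.ofReal (E^p * (1 / (1+|x|)^2)) := by
    intro n x
    rw [enorm_rpow_ofReal _ hp.le]
    refine ENNReal.ofReal_le_ofReal ?_
    have h1 : (1:ℝ) ≤ 1 + |x| := by linarith [abs_nonneg x]
    have h2 : ‖F x - S n x‖ ≤ E / (1 + |x|)^M := by
      refine (norm_sub_le _ _).trans ((add_le_add (hFb x) (hSb n x)).trans (le_of_eq ?_))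
      rw [hE]; ring
    calc ‖F x - S n x‖ ^ p ≤ (E / (1 + |x|)^M) ^ p := Real.rpow_le_rpow (norm_nonneg _) h2 hp.le
      _ = E^p * (1 / (1+|x|)^((M:ℝ)*p)) := by
        rw [Real.div_rpow hE0 (by positivity), ← Real.rpow_natCast, ← Real.rpow_mul (by positivity)]
        ring
      _ ≤ E^p * (1 / (1+|x|)^2) := by
        gcongr
        rw [← Real.rpow_natCast]
        refine Real.rpow_le_rpow_of_exponent_le h1 ?_
        rw [div_lt_iff₀ hp] at hM
        exact_mod_cast hM.le
  have hlim : Filter.Tendsto (fun n => ∫⁻ x : ℝ, (‖F x - S n x‖₊ : ℝ≥0∞)^p) Filter.atTop (nhds (∫⁻ _ : ℝ, 0)) := by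
    refine tendsto_lintegral_of_dominated_convergence _ ?_ (fun n => by filter_upwards with x using hmaj n x)
      ((integrable_dec2.const_mul (E^p)).lintegral_lt_top.ne) ?_
    · intro n
      have hc1 := (smul_hull_expType (hSmem n)).1.continuous
      have hc2 := hF.1.continuous
      have : Continuous fun x : ℝ => ‖F x - S n x‖₊ := by fun_prop
      exact this.measurable.coe_nnreal_ennreal.pow_const p
    · filter_upwards with x
      have h1 : Filter.Tendsto (fun n => ‖F x - S n x‖^p) Filter.atTop (nhds (‖F x - F x‖^p)) := by
        refine Filter.Tendsto.rpow_const (((tendsto_const_nhds).sub (hpt x)).norm) (Or.inr hp.le)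
      simp only [sub_self, norm_zero, Real.zero_rpow hp.ne'] at h1
      simp only [enorm_rpow_ofReal _ hp.le]
      have := ENNReal.tendsto_ofReal h1
      simpa using this
  rw [lintegral_zero] at hlim
  have hev := hlim.eventually (Iic_mem_nhds (show (0:ℝ≥0∞) < ENNReal.ofReal ε by simpa using hε))
  obtain ⟨n, hn⟩ := hev.exists
  exact ⟨S n, hSmem n, hn⟩


/-- The entire function `sin z / z`. -/
noncomputable def sincC (z : ℂ) : ℂ := dslope Complex.sin 0 z

lemma sincC_diff : Differentiable ℂ sincC := by
  have h := (Complex.differentiableOn_dslope (f := Complex.sin) (c := 0) (s := Set.univ) Filter.univ_mem).mpr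
    Complex.differentiable_sin.differentiableOn
  exact differentiableOn_univ.mp h

lemma sincC_zero : sincC 0 = 1 := by
  unfold sincC
  rw [dslope_same, Complex.deriv_sin]; simp

lemma norm_csin_le (z : ℂ) : ‖Complex.sin z‖ ≤ Real.exp |z.im| := by
  unfold Complex.sin
  have h1 : ‖Complex.exp (-z * I)‖ ≤ Real.exp |z.im| := by
    rw [Complex.norm_exp]; gcongr; simp [le_abs_self]
  have h2 : ‖Complex.exp (z * I)‖ ≤ Real.exp |z.im| := by
    rw [Complex.norm_exp]; gcongr; simp [neg_le_abs]
  rw [norm_div, norm_mul, norm_I, mul_one]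
  have := norm_sub_le (Complex.exp (-z * I)) (Complex.exp (z * I))
  simp only [Complex.norm_ofNat]
  linarith

lemma sincC_bound : ∃ C : ℝ, 1 ≤ C ∧ ∀ z : ℂ, ‖sincC z‖ ≤ C * Real.exp |z.im| / (1 + |z.re|) := by
  obtain ⟨K, hK⟩ := (isCompact_closedBall (0:ℂ) 1).exists_bound_of_continuousOn sincC_diff.continuous.continuousOn
  refine ⟨2 * max 1 K, by linarith [le_max_left 1 K], fun z => ?_⟩
  have hre := Complex.abs_re_le_norm z
  have he : 1 ≤ Real.exp |z.im| := Real.one_le_exp (abs_nonneg _)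
  have hm := le_max_left 1 K
  rw [le_div_iff₀ (by positivity)]
  rcases le_total ‖z‖ 1 with h | h
  · have h1 : ‖sincC z‖ ≤ max 1 K := (hK z (by simpa using h)).trans (le_max_right _ _)
    calc _ ≤ max 1 K * 2 := by gcongr; linarith
      _ ≤ (2 * max 1 K) * Real.exp |z.im| := by nlinarith
  · have hz : z ≠ 0 := by rintro rfl; simp at h; linarith
    have h1 : ‖sincC z‖ ≤ Real.exp |z.im| / ‖z‖ := by
      unfold sincC
      rw [dslope_of_ne _ hz, slope_def_field, norm_div]
      simp only [Complex.sin_zero, sub_zero]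
      gcongr
      exact norm_csin_le z
    calc _ ≤ Real.exp |z.im| / ‖z‖ * (2 * ‖z‖) := by gcongr; linarith
      _ = 2 * 1 * Real.exp |z.im| := by field_simp
      _ ≤ _ := by gcongr

/-- Regularisation of `f`. -/
noncomputable def regF (f : ℂ → ℂ) (n : ℕ) (r : ℝ) (z : ℂ) : ℂ :=
  f (r * z) * sincC (((1 - r) * π / (2 * n) : ℝ) * z) ^ n

lemma sincC_pow {S : ℝ} (hS1 : 1 ≤ S) (hS : ∀ z : ℂ, ‖sincC z‖ ≤ S * Real.exp |z.im| / (1 + |z.re|))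
    {n : ℕ} (hn : 0 < n) {r : ℝ} (hr1 : r < 1) (z : ℂ) :
    ‖sincC (((1 - r) * π / (2 * n) : ℝ) * z) ^ n‖ ≤ S^n * Real.exp ((1-r)*π/2 * |z.im|) /
      (1 + (1 - r) * π / (2 * n) * |z.re|)^n := by
  have hn' : (0:ℝ) < n := by exact_mod_cast hn
  set δ : ℝ := (1 - r) * π / (2 * n) with hδ
  have hδ0 : 0 < δ := by
    have : 0 < 1 - r := by linarith
    positivity
  have h := hS (δ * z)
  have e1 : ((δ:ℂ) * z).im = δ * z.im := by simp
  have e2 : ((δ:ℂ) * z).re = δ * z.re := by simp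
  rw [e1, e2, abs_mul, abs_mul, abs_of_pos hδ0] at h
  rw [norm_pow]
  calc _ ≤ (S * Real.exp (δ * |z.im|) / (1 + δ * |z.re|))^n := by gcongr
    _ = _ := by
      rw [div_pow, mul_pow, ← Real.exp_nat_mul]
      have e3 : (n:ℝ) * (δ * |z.im|) = (1-r)*π/2 * |z.im| := by rw [hδ]; field_simp
      rw [e3]

lemma regF_Dec {f : ℂ → ℂ} (hf : ExpTypePi f) {K : ℝ} (hK : ∀ x : ℝ, ‖f x‖ ≤ K)
    {n : ℕ} (hn : 0 < n) {r : ℝ} (hr0 : 0 < r) (hr1 : r < 1) :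
    ∃ C, Dec (regF f n r) (π * (1 + r) / 2) C n := by
  obtain ⟨S, hS1, hS⟩ := sincC_bound
  have hn' : (1:ℝ) ≤ n := by exact_mod_cast hn
  have hK0 : 0 ≤ K := (norm_nonneg _).trans (hK 0)
  set δ : ℝ := (1 - r) * π / (2 * n) with hδ
  have hδ0 : 0 < δ := by
    have : 0 < 1 - r := by linarith
    positivity
  refine ⟨K * S^n * (max 1 δ⁻¹)^n, ?_, fun z => ?_⟩
  · unfold regF
    have h1 := hf.1
    have h2 := sincC_diff
    fun_prop
  · have h1 := sincC_pow hS1 hS hn hr1 z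
    rw [← hδ] at h1
    have h2 := PL_full hf hK (r * z)
    have e1 : ((r:ℂ) * z).im = r * z.im := by simp
    rw [e1, abs_mul, abs_of_pos hr0] at h2
    unfold regF
    rw [norm_mul, ← hδ]
    have h3 : 1 + |z.re| ≤ max 1 δ⁻¹ * (1 + δ * |z.re|) := by
      have a1 := le_max_left 1 δ⁻¹
      have a2 := le_max_right 1 δ⁻¹
      have a3 : 1 ≤ max 1 δ⁻¹ * δ := by
        calc 1 = δ⁻¹ * δ := by field_simp
          _ ≤ _ := by gcongr
      nlinarith [abs_nonneg z.re]
    calc _ ≤ (K * Real.exp (π * (r * |z.im|))) * (S^n * Real.exp ((1-r)*π/2 * |z.im|) /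
      (1 + δ * |z.re|)^n) := by gcongr
      _ = K * S^n * Real.exp (π * (1 + r) / 2 * |z.im|) / (1 + δ * |z.re|)^n := by
        rw [show π * (1 + r) / 2 * |z.im| = π * (r * |z.im|) + (1-r)*π/2 * |z.im| by ring, Real.exp_add]
        ring
      _ ≤ _ := by
        rw [div_le_div_iff₀ (by positivity) (by positivity)]
        calc _ ≤ K * S^n * Real.exp (π * (1 + r) / 2 * |z.im|) * (max 1 δ⁻¹ * (1 + δ * |z.re|))^n := by gcongr
          _ = _ := by rw [mul_pow]; ring

lemma lintegral_scaleC (g : ℂ → ℝ≥0∞) {r : ℝ} (hr : 0 < r) :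
    ∫⁻ z : ℂ, g (r * z) = ENNReal.ofReal ((r^2)⁻¹) * ∫⁻ z : ℂ, g z := by
  have h := Measure.map_addHaar_smul (volume : Measure ℂ) hr.ne'
  have hE : MeasurableEmbedding (fun z : ℂ => r • z) :=
    (Homeomorph.smulOfNeZero r hr.ne').isClosedEmbedding.measurableEmbedding
  have h2 := hE.lintegral_map g (μ := volume)
  rw [h] at h2
  simp only [real_smul] at h2
  rw [← h2, lintegral_smul_measure, Complex.finrank_real_complex, abs_of_pos (by positivity)]
  rfl

lemma regF_NW {S : ℝ} (hS1 : 1 ≤ S) (hS : ∀ z : ℂ, ‖sincC z‖ ≤ S * Real.exp |z.im| / (1 + |z.re|))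
    {f : ℂ → ℂ} {n : ℕ} (hn : 0 < n) {r : ℝ} (hr0 : 1/2 ≤ r) (hr1 : r < 1) {α : ℝ} (hα : -1 < α) :
    NW α (regF f n r) ≤ ENNReal.ofReal (S^n * 2^(α+2)) * NW α f := by
  have hr : 0 < r := by linarith
  set g : ℂ → ℝ≥0∞ := fun z => ENNReal.ofReal
            (Real.exp (-Real.pi * |z.im|) * |z.im| ^ α) * (‖f z‖₊ : ℝ≥0∞) with hg
  have hpt : ∀ z : ℂ, ENNReal.ofReal (Real.exp (-Real.pi * |z.im|) * |z.im| ^ α) * (‖regF f n r z‖₊ : ℝ≥0∞)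
      ≤ ENNReal.ofReal (S^n * r^(-α)) * g (r * z) := by
    intro z
    have e1 : ((r:ℂ) * z).im = r * z.im := by simp
    have h1 := sincC_pow hS1 hS hn hr1 z
    have h2 : ‖sincC (((1 - r) * π / (2 * n) : ℝ) * z) ^ n‖ ≤ S^n * Real.exp ((1-r)*π/2 * |z.im|) := by
      refine h1.trans (div_le_self (by positivity) (one_le_pow₀ ?_))
      have : 0 ≤ (1 - r) * π / (2 * n) * |z.re| := by
        have : 0 < 1 - r := by linarith
        positivity
      linarith
    rw [hg]
    simp only [e1, abs_mul, abs_of_pos hr]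
    rw [← mul_assoc, ← ENNReal.ofReal_mul (by positivity)]
    have n1 : (‖regF f n r z‖₊ : ℝ≥0∞) = ENNReal.ofReal ‖sincC (((1 - r) * π / (2 * n) : ℝ) * z) ^ n‖ * (‖f (r*z)‖₊ : ℝ≥0∞) := by
      unfold regF
      rw [nnnorm_mul, ENNReal.coe_mul, mul_comm]
      congr 1
      exact (ofReal_norm _).symm
    rw [n1, ← mul_assoc, ← ENNReal.ofReal_mul (by positivity)]
    refine mul_le_mul' (ENNReal.ofReal_le_ofReal ?_) le_rfl
    rw [Real.mul_rpow hr.le (abs_nonneg _)]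
    have e3 : r^(-α) * r^α = 1 := by rw [← Real.rpow_add hr]; simp
    calc _ ≤ Real.exp (-π * |z.im|) * |z.im|^α * (S^n * Real.exp ((1-r)*π/2 * |z.im|)) := by gcongr
      _ = S^n * |z.im|^α * Real.exp (-π * |z.im| + (1-r)*π/2 * |z.im|) := by rw [Real.exp_add]; ring
      _ ≤ S^n * |z.im|^α * Real.exp (-π * (r * |z.im|)) := by
        gcongr
        have : 0 ≤ (1-r) * π * |z.im| := by
          have : 0 < 1 - r := by linarith
          positivity
        nlinarith
      _ = S^n * (r^(-α) * r^α) * |z.im|^α * Real.exp (-π * (r * |z.im|)) := by rw [e3, mul_one]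
      _ = _ := by ring
  unfold NW
  refine (lintegral_mono hpt).trans ?_
  rw [lintegral_const_mul' _ _ ENNReal.ofReal_ne_top, lintegral_scaleC g hr, ← mul_assoc,
    ← ENNReal.ofReal_mul (by positivity)]
  refine mul_le_mul' (ENNReal.ofReal_le_ofReal ?_) le_rfl
  have e4 : r^(-α) * (r^2)⁻¹ = (r⁻¹)^(α+2) := by
    rw [Real.inv_rpow hr.le, ← Real.rpow_neg hr.le, show -(α+2) = -α + (-(2:ℕ):ℝ) by push_cast; ring,
      Real.rpow_add hr, Real.rpow_neg hr.le ((2:ℕ):ℝ), Real.rpow_natCast]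
  rw [mul_assoc, e4]
  gcongr
  · linarith
  · rw [inv_le_comm₀ hr (by norm_num)]; linarith

lemma fatou_dct {D G : ℕ → ℝ → ℝ≥0∞} {G' : ℝ → ℝ≥0∞} (hD : ∀ k, Measurable (D k)) (hG : ∀ k, Measurable (G k))
    (hDG : ∀ k x, D k x ≤ G k x) (hGt : ∀ x, Filter.Tendsto (fun k => G k x) Filter.atTop (nhds (G' x)))
    (hDt : ∀ x, Filter.Tendsto (fun k => D k x) Filter.atTop (nhds 0))
    (hGf : ∀ k, ∫⁻ x, G k x ≠ ⊤) (hGf' : ∫⁻ x, G' x ≠ ⊤)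
    (hlim : Filter.Tendsto (fun k => ∫⁻ x, G k x) Filter.atTop (nhds (∫⁻ x, G' x)))
    {ε : ℝ≥0∞} (hε : 0 < ε) : ∃ k, ∫⁻ x, D k x ≤ ε := by
  by_contra hcon
  push Not at hcon
  have h1 : ∫⁻ x, G' x ≤ Filter.liminf (fun k => ∫⁻ x, (G k x - D k x)) Filter.atTop := by
    refine le_trans (le_of_eq ?_) (lintegral_liminf_le fun k => (hG k).sub (hD k))
    refine lintegral_congr fun x => ?_
    have : Filter.Tendsto (fun k => G k x - D k x) Filter.atTop (nhds (G' x - 0)) :=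
      ENNReal.Tendsto.sub (hGt x) (hDt x) (Or.inr ENNReal.zero_ne_top)
    rw [this.liminf_eq, tsub_zero]
  have h2 : ∀ k, ∫⁻ x, (G k x - D k x) ≤ (∫⁻ x, G k x) - ε := by
    intro k
    rw [lintegral_sub (hD k) (((lintegral_mono (hDG k)).trans_lt (hGf k).lt_top).ne)
      (by filter_upwards with x using hDG k x)]
    exact tsub_le_tsub_left (hcon k).le _
  have h3 : Filter.Tendsto (fun k => (∫⁻ x, G k x) - ε) Filter.atTop (nhds ((∫⁻ x, G' x) - ε)) :=
    ENNReal.Tendsto.sub hlim tendsto_const_nhds (Or.inl hGf')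
  have h4 : ∫⁻ x, G' x ≤ (∫⁻ x, G' x) - ε := by
    refine h1.trans ?_
    rw [← h3.liminf_eq]
    exact Filter.liminf_le_liminf (by filter_upwards with k using h2 k)
  have h5 : ε ≤ ∫⁻ x, G' x := by
    refine ge_of_tendsto hlim ?_
    filter_upwards with k using (hcon k).le.trans (lintegral_mono (hDG k))
  have h6 : (∫⁻ x, G' x) - ε < ∫⁻ x, G' x :=
    ENNReal.sub_lt_self hGf' (lt_of_lt_of_le hε h5).ne' hε.ne'
  exact absurd h4 (not_le.mpr h6)

lemma regF_approx {p : ℝ} (hp : 0 < p) (hp1 : p < 1) {f : ℂ → ℂ} (hf : ExpTypePi f)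
    (hI : (∫⁻ x : ℝ, (‖f x‖₊ : ℝ≥0∞) ^ p) < ⊤) {n : ℕ} (hn : 0 < n) {ε : ℝ} (hε : 0 < ε) :
    ∃ r : ℝ, 1/2 ≤ r ∧ r < 1 ∧ (∫⁻ x : ℝ, (‖f x - regF f n r x‖₊ : ℝ≥0∞) ^ p) ≤ ENNReal.ofReal ε := by
  obtain ⟨S, hS1, hS⟩ := sincC_bound
  have hfc := hf.1.continuous
  have hsc := sincC_diff.continuous
  set rk : ℕ → ℝ := fun k => 1 - 1 / ((k:ℝ) + 2) with hrk
  have hk1 : ∀ k, rk k < 1 := fun k => by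
    have : 0 < 1 / ((k:ℝ) + 2) := by positivity
    simp only [hrk]; linarith
  have hk0 : ∀ k, 1/2 ≤ rk k := fun k => by
    have : 1 / ((k:ℝ) + 2) ≤ 1 / 2 := by gcongr; linarith [(Nat.cast_nonneg k : (0:ℝ) ≤ k)]
    simp only [hrk]; linarith
  have hlim : Filter.Tendsto rk Filter.atTop (nhds 1) := by
    have h1 : Filter.Tendsto (fun k : ℕ => 1 / ((k:ℝ) + 2)) Filter.atTop (nhds 0) := by
      refine Filter.Tendsto.div_atTop tendsto_const_nhds ?_
      exact Filter.tendsto_atTop_add_const_right _ _ tendsto_natCast_atTop_atTop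
    have h2 := h1.const_sub 1
    rwa [sub_zero] at h2
  have hSp : 0 ≤ (S^n)^p := by positivity
  set I0 := ∫⁻ x : ℝ, (‖f x‖₊ : ℝ≥0∞) ^ p with hI0
  have hm1 : ∀ r : ℝ, Measurable fun x : ℝ => (‖f (r * x)‖₊ : ℝ≥0∞) ^ p := fun r =>
    (show Continuous fun x : ℝ => ‖f (r * x)‖₊ by fun_prop).measurable.coe_nnreal_ennreal.pow_const p
  have hm0 : Measurable fun x : ℝ => (‖f x‖₊ : ℝ≥0∞) ^ p := by simpa using hm1 1
  have hscale : ∀ r : ℝ, 0 < r → ∫⁻ x : ℝ, (‖f (r * x)‖₊ : ℝ≥0∞) ^ p = ENNReal.ofReal r⁻¹ * I0 := by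
    intro r hr
    have := lintegral_scale (fun x : ℝ => (‖f x‖₊ : ℝ≥0∞) ^ p) hr
    simpa using this
  have hGint : ∀ r : ℝ, 0 < r → ∫⁻ x : ℝ, ((‖f x‖₊ : ℝ≥0∞) ^ p + ENNReal.ofReal ((S^n)^p) * (‖f (r * x)‖₊ : ℝ≥0∞) ^ p)
      = I0 + ENNReal.ofReal ((S^n)^p) * (ENNReal.ofReal r⁻¹ * I0) := by
    intro r hr
    rw [lintegral_add_left hm0, lintegral_const_mul _ (hm1 r), hscale r hr]
  have hfin : ∀ r : ℝ, I0 + ENNReal.ofReal ((S^n)^p) * (ENNReal.ofReal r⁻¹ * I0) ≠ ⊤ := fun r =>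
    ENNReal.add_ne_top.mpr ⟨hI.ne, ENNReal.mul_ne_top ENNReal.ofReal_ne_top (ENNReal.mul_ne_top ENNReal.ofReal_ne_top hI.ne)⟩
  have hpos : ∀ k, 0 < rk k := fun k => by linarith [hk0 k]
  suffices hsuf : ∃ k, ∫⁻ x : ℝ, (‖f x - regF f n (rk k) x‖₊ : ℝ≥0∞) ^ p ≤ ENNReal.ofReal ε by
    obtain ⟨k, hk⟩ := hsuf
    exact ⟨rk k, hk0 k, hk1 k, hk⟩
  refine fatou_dct (D := fun k x => (‖f x - regF f n (rk k) x‖₊ : ℝ≥0∞) ^ p)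
    (G := fun k x => (‖f x‖₊ : ℝ≥0∞) ^ p + ENNReal.ofReal ((S^n)^p) * (‖f (rk k * x)‖₊ : ℝ≥0∞) ^ p)
    (G' := fun x => (‖f x‖₊ : ℝ≥0∞) ^ p + ENNReal.ofReal ((S^n)^p) * (‖f ((1:ℝ) * x)‖₊ : ℝ≥0∞) ^ p)
    ?_ ?_ ?_ ?_ ?_ ?_ ?_ ?_ (show 0 < ENNReal.ofReal ε by simpa using hε)
  · intro k
    have : Continuous fun x : ℝ => ‖f x - regF f n (rk k) x‖₊ := by unfold regF; fun_prop
    exact this.measurable.coe_nnreal_ennreal.pow_const p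
  · intro k
    exact hm0.add ((hm1 _).const_mul _)
  · intro k x
    have h1 := sincC_pow hS1 hS hn (hk1 k) x
    have h2 : ‖sincC (((1 - rk k) * π / (2 * n) : ℝ) * x) ^ n‖ ≤ S^n := by
      refine h1.trans ?_
      simp only [ofReal_im, abs_zero, mul_zero, Real.exp_zero, mul_one]
      refine div_le_self (by positivity) (one_le_pow₀ ?_)
      have : 0 ≤ (1 - rk k) * π / (2 * n) * |(x:ℂ).re| := by
        have : 0 < 1 - rk k := by linarith [hk1 k]
        positivity
      linarith
    have h3 : (‖regF f n (rk k) x‖₊ : ℝ≥0∞) ^ p ≤ ENNReal.ofReal ((S^n)^p) * (‖f (rk k * x)‖₊ : ℝ≥0∞) ^ p := by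
      rw [enorm_rpow_ofReal _ hp.le, enorm_rpow_ofReal _ hp.le, ← ENNReal.ofReal_mul hSp]
      refine ENNReal.ofReal_le_ofReal ?_
      rw [← Real.mul_rpow (by positivity) (norm_nonneg _)]
      refine Real.rpow_le_rpow (norm_nonneg _) ?_ hp.le
      unfold regF
      rw [norm_mul, mul_comm]
      gcongr
    calc (‖f x - regF f n (rk k) x‖₊ : ℝ≥0∞) ^ p ≤ ((‖f x‖₊ : ℝ≥0∞) + ‖regF f n (rk k) x‖₊)^p := by
          gcongr
          exact_mod_cast nnnorm_sub_le _ _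
      _ ≤ (‖f x‖₊ : ℝ≥0∞)^p + (‖regF f n (rk k) x‖₊ : ℝ≥0∞)^p := ENNReal.rpow_add_le_add_rpow _ _ hp.le hp1.le
      _ ≤ _ := by gcongr
  · intro x
    refine Filter.Tendsto.add tendsto_const_nhds (ENNReal.Tendsto.const_mul ?_ (Or.inr ENNReal.ofReal_ne_top))
    simp only [enorm_rpow_ofReal _ hp.le]
    refine ENNReal.tendsto_ofReal (Filter.Tendsto.rpow_const ?_ (Or.inr hp.le))
    have : Continuous fun r : ℝ => ‖f (r * x)‖ := by fun_prop
    exact (this.tendsto 1).comp hlim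
  · intro x
    simp only [enorm_rpow_ofReal _ hp.le]
    have hc : Continuous fun r : ℝ => ‖f x - regF f n r x‖ := by unfold regF; fun_prop
    have h1 : Filter.Tendsto (fun k => ‖f x - regF f n (rk k) x‖^p) Filter.atTop (nhds (‖f x - regF f n 1 x‖^p)) :=
      Filter.Tendsto.rpow_const ((hc.tendsto 1).comp hlim) (Or.inr hp.le)
    have h2 : regF f n 1 x = f x := by unfold regF; simp [sincC_zero]
    rw [h2, sub_self, norm_zero, Real.zero_rpow hp.ne'] at h1
    have := ENNReal.tendsto_ofReal h1
    simpa using this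
  · intro k
    rw [hGint _ (hpos k)]; exact hfin _
  · rw [hGint 1 one_pos]; exact hfin _
  · rw [hGint 1 one_pos]
    simp only [hGint _ (hpos _)]
    refine Filter.Tendsto.add tendsto_const_nhds (ENNReal.Tendsto.const_mul ?_ (Or.inr ENNReal.ofReal_ne_top))
    refine ENNReal.Tendsto.mul_const ?_ (Or.inr hI.ne)
    exact ENNReal.tendsto_ofReal (hlim.inv₀ one_ne_zero)

lemma lower_gauge {p : ℝ} (hp : 0 < p) (hp1 : p < 1) : ∃ C : ℝ, 0 < C ∧ ∀ f : ℂ → ℂ, ExpTypePi f →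
    (∫⁻ x : ℝ, (‖f x‖₊ : ℝ≥0∞) ^ p) < ⊤ → NW (1/p-2) f < ⊤ →
    gauge (convexHull ℝ (Bp p)) f ≤ C * (NW (1/p-2) f).toReal := by
  obtain ⟨c, hc, hb⟩ := atom_ball hp
  obtain ⟨M, hM⟩ := exists_nat_gt (2 / p)
  obtain ⟨S, hS1, hS⟩ := sincC_bound
  have hα : -1 < 1/p - 2 := by
    have : 1 < 1/p := by rw [lt_div_iff₀ hp]; linarith
    linarith
  set α := 1/p-2 with hαd
  set Q := S^(2*M+2) * 2^(α+2) with hQ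
  have hQ0 : 0 < Q := by positivity
  refine ⟨c * Q, by positivity, fun f hf hI hN => ?_⟩
  have hK := convex_convexHull ℝ (Bp p)
  have h0 := subset_convexHull ℝ _ (Bp_zero hp)
  obtain ⟨K, hK0, hKb⟩ := bdd_real hf hp hI
  refine le_of_forall_pos_le_add fun ε hε => ?_
  have hε2 : 0 < ε/2 := by positivity
  have hn : 0 < 2*M+2 := by omega
  obtain ⟨r, hr0, hr1, hr⟩ := regF_approx hp hp1 hf hI hn (show 0 < (ε/2)^p by positivity)
  have hrp : 0 < r := by linarith
  obtain ⟨C, hDec⟩ := regF_Dec hf hKb hn hrp hr1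
  have hNF := regF_NW (f := f) hS1 hS hn hr0 hr1 hα
  have hNtop : ENNReal.ofReal Q * NW α f < ⊤ := ENNReal.mul_lt_top ENNReal.ofReal_lt_top hN
  have hNF' : NW α (regF f (2*M+2) r) < ⊤ := hNF.trans_lt hNtop
  obtain ⟨g, hg, hgF⟩ := approx_Dec hp hp1 hc hb (by positivity) (by nlinarith [pi_pos]) hM hDec hNF'
    (show 0 < (ε/2)^p by positivity)
  have hle : (NW α (regF f (2*M+2) r)).toReal ≤ Q * (NW α f).toReal := by
    have := ENNReal.toReal_mono hNtop.ne hNF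
    rwa [ENNReal.toReal_mul, ENNReal.toReal_ofReal hQ0.le] at this
  have hg' : g ∈ (c * (Q * (NW α f).toReal)) • convexHull ℝ (Bp p) :=
    smul_cone_mono hK h0 (by positivity) (by gcongr) hg
  have hge := smul_hull_expType hg
  have hFe : ExpTypePi (regF f (2*M+2) r) := by
    refine ⟨hDec.1, fun e he => ⟨C + 1, by linarith [hDec.C_nonneg], fun z => (hDec.2 z).trans ?_⟩⟩
    have hC0 := hDec.C_nonneg
    have h1 : (1:ℝ) ≤ (1 + |z.re|)^(2*M+2) := one_le_pow₀ (by linarith [abs_nonneg z.re])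
    refine (div_le_self (by positivity) h1).trans ?_
    have h2 := Complex.abs_im_le_norm z
    have h3 : π * (1 + r) / 2 ≤ π + e := by nlinarith [pi_pos]
    gcongr
    linarith
  have m1 : f - regF f (2*M+2) r ∈ (ε/2) • convexHull ℝ (Bp p) :=
    Set.smul_set_mono (subset_convexHull ℝ _) (mem_smul_Bp hp hε2 (hf.sub hFe) hr)
  have m2 : regF f (2*M+2) r - g ∈ (ε/2) • convexHull ℝ (Bp p) :=
    Set.smul_set_mono (subset_convexHull ℝ _) (mem_smul_Bp hp hε2 (hFe.sub hge) hgF)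
  have m3 : f ∈ (c * (Q * (NW α f).toReal) + (ε/2 + ε/2)) • convexHull ℝ (Bp p) := by
    rw [hK.add_smul (by positivity) (by positivity), hK.add_smul hε2.le hε2.le]
    have := Set.add_mem_add hg' (Set.add_mem_add m1 m2)
    convert this using 1
    abel
  refine (gauge_le_of_mem (by positivity) m3).trans (le_of_eq ?_)
  ring

theorem main_thm (p : ℝ) (hp0 : 0 < p) (hp1 : p < 1)
    (B : Set (ℂ → ℂ))
    (hB : B = {f : ℂ → ℂ | ExpTypePi f ∧ (∫⁻ x : ℝ, (‖f x‖₊ : ℝ≥0∞) ^ p) ≤ 1}) :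
    ∃ c C : ℝ, 0 < c ∧ 0 < C ∧ ∀ f : ℂ → ℂ,
      ExpTypePi f → (∫⁻ x : ℝ, (‖f x‖₊ : ℝ≥0∞) ^ p) < ⊤ →
      ENNReal.ofReal (c * gauge (convexHull ℝ B) f) ≤ NW (1/p-2) f ∧
      NW (1/p-2) f ≤ ENNReal.ofReal (C * gauge (convexHull ℝ B) f) := by
  obtain ⟨C, hC, h⟩ := upper_gauge hp0 hp1
  obtain ⟨c, hc, h'⟩ := lower_gauge hp0 hp1
  have hB' : B = Bp p := hB
  subst hB'
  refine ⟨c⁻¹, C, by positivity, hC, fun f hf hI => ⟨?_, h f hf hI⟩⟩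
  have hfin : NW (1/p-2) f < ⊤ := (h f hf hI).trans_lt ENNReal.ofReal_lt_top
  rw [ENNReal.ofReal_le_iff_le_toReal hfin.ne, inv_mul_le_iff₀ hc]
  exact h' f hf hI hfin

/-- **Main theorem, dense-subspace form.** For `0 < p < 1`, the Minkowski functional
of the convex hull of the unit ball of `Eᵖ` is equivalent, on `Eᵖ`, to the weighted
Bergman-type norm `∫_ℂ e^{-π|Im z|} |Im z|^{1/p-2} |f(z)| dA(z)`. -/
theorem banach_envelope_of_Ep (p : ℝ) (hp0 : 0 < p) (hp1 : p < 1)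
    (B : Set (ℂ → ℂ))
    (hB : B = {f : ℂ → ℂ | ExpTypePi f ∧ (∫⁻ x : ℝ, (‖f x‖₊ : ℝ≥0∞) ^ p) ≤ 1}) :
    ∃ c C : ℝ, 0 < c ∧ 0 < C ∧ ∀ f : ℂ → ℂ,
      ExpTypePi f → (∫⁻ x : ℝ, (‖f x‖₊ : ℝ≥0∞) ^ p) < ⊤ →
      ENNReal.ofReal (c * gauge (convexHull ℝ B) f) ≤
        (∫⁻ z : ℂ, ENNReal.ofReal
            (Real.exp (-Real.pi * |z.im|) * |z.im| ^ (1 / p - 2)) * (‖f z‖₊ : ℝ≥0∞)) ∧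
      (∫⁻ z : ℂ, ENNReal.ofReal
            (Real.exp (-Real.pi * |z.im|) * |z.im| ^ (1 / p - 2)) * (‖f z‖₊ : ℝ≥0∞)) ≤
        ENNReal.ofReal (C * gauge (convexHull ℝ B) f) := by
  exact main_thm p hp0 hp1 B hB
end

section
/- There is a constant C > 0 such that for every y_0 > 0 there exists a nonzero f ∈ E^1 with ∫_ℝ |f(x+iy)| dx ≥ C e^{πy} ∫_ℝ |f(x)| dx for all y ∈ [0, y_0]. Moreover f can be taken of the form f(z) = ∫_ℝ φ(t) e^{itz} dt for a Schwartz function φ supported in [-π, -π+ε] for suitably small ε > 0. -/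
open MeasureTheory Real Complex
open scoped ENNReal NNReal

/-- Fixed bump supported in `[0,1]`. -/
noncomputable def bumpPsi : ContDiffBump (1/2 : ℝ) := ⟨1/4, 1/2, by norm_num, by norm_num⟩

/-- The Fourier-Laplace transform of the bump. -/
noncomputable def bumpG (w : ℂ) : ℂ := ∫ s : ℝ, (bumpPsi s : ℂ) * Complex.exp (Complex.I * s * w)

lemma bumpPsi_supp {s : ℝ} (h : bumpPsi s ≠ 0) : 0 ≤ s ∧ s ≤ 1 := by
  have h1 : s ∈ Function.support bumpPsi := h
  rw [bumpPsi.support_eq, Real.ball_eq_Ioo] at h1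
  simp only [bumpPsi, Set.mem_Ioo] at h1
  constructor <;> linarith [h1.1, h1.2]

lemma bumpPsi_cont : Continuous (fun s : ℝ => bumpPsi s) := bumpPsi.continuous

lemma bumpPsi_integrable_mul {h : ℝ → ℂ} (hh : Continuous h) :
    Integrable (fun s : ℝ => (bumpPsi s : ℂ) * h s) := by
  refine Continuous.integrable_of_hasCompactSupport ?_ ?_
  · exact (Complex.continuous_ofReal.comp bumpPsi_cont).mul hh
  · refine HasCompactSupport.mul_right ?_
    exact bumpPsi.hasCompactSupport.comp_left Complex.ofReal_zero

lemma norm_exp_le {s : ℝ} (w : ℂ) (R : ℝ) (hw : ‖w‖ ≤ R) (h0 : 0 ≤ s) (h1 : s ≤ 1) :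
    ‖Complex.exp (Complex.I * s * w)‖ ≤ Real.exp R := by
  rw [Complex.norm_exp]
  apply Real.exp_le_exp.mpr
  refine (Complex.re_le_norm _).trans ?_
  rw [norm_mul, norm_mul, Complex.norm_I, Complex.norm_real, Real.norm_of_nonneg h0, one_mul]
  nlinarith [norm_nonneg w]

lemma bumpG_diff : Differentiable ℂ bumpG := by
  intro w
  have key := hasDerivAt_integral_of_dominated_loc_of_deriv_le (𝕜 := ℂ) (μ := volume)
    (F := fun w (s : ℝ) => (bumpPsi s : ℂ) * Complex.exp (Complex.I * s * w))
    (F' := fun w (s : ℝ) => (bumpPsi s : ℂ) * (Complex.exp (Complex.I * s * w) * (Complex.I * s)))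
    (x₀ := w) (s := Metric.ball w 1)
    (bound := fun s => bumpPsi s * Real.exp (‖w‖ + 1))
    (Metric.ball_mem_nhds w one_pos)
    (Filter.Eventually.of_forall fun x =>
      (bumpPsi_integrable_mul (by fun_prop)).aestronglyMeasurable)
    (bumpPsi_integrable_mul (by fun_prop))
    (bumpPsi_integrable_mul (by fun_prop)).aestronglyMeasurable
    (Filter.Eventually.of_forall fun s x hx => ?_)
    (bumpPsi.integrable.mul_const _)
    (Filter.Eventually.of_forall fun s x hx => ?_)
  · exact key.2.differentiableAt
  · by_cases h : bumpPsi s = 0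
    · simp [h]
    obtain ⟨h0, h1⟩ := bumpPsi_supp h
    rw [norm_mul, Complex.norm_real, Real.norm_of_nonneg bumpPsi.nonneg, norm_mul]
    refine mul_le_mul_of_nonneg_left ?_ bumpPsi.nonneg
    have hx' : ‖x‖ ≤ ‖w‖ + 1 := by
      have h2 := norm_add_le w (x - w)
      rw [mem_ball_iff_norm] at hx
      rw [add_sub_cancel] at h2
      linarith
    have h3 : ‖Complex.I * (s : ℂ)‖ ≤ 1 := by
      rw [norm_mul, Complex.norm_I, Complex.norm_real, Real.norm_of_nonneg h0]; linarith
    calc _ ≤ Real.exp (‖w‖ + 1) * 1 :=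
          mul_le_mul (norm_exp_le x _ hx' h0 h1) h3 (norm_nonneg _) (Real.exp_pos _).le
      _ = _ := mul_one _
  · refine HasDerivAt.const_mul _ ?_
    have h4 : HasDerivAt (fun x : ℂ => Complex.I * s * x) (Complex.I * s) x := by
      simpa using (hasDerivAt_id x).const_mul (Complex.I * (s : ℂ))
    exact h4.cexp

lemma bumpG_integrable : Integrable (fun x : ℝ => bumpG x) := by
  have hc : HasCompactSupport (fun s : ℝ => (bumpPsi s : ℂ)) :=
    bumpPsi.hasCompactSupport.comp_left Complex.ofReal_zero
  have hs : ContDiff ℝ (⊤ : ℕ∞) (fun s : ℝ => (bumpPsi s : ℂ)) :=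
    Complex.ofRealCLM.contDiff.comp bumpPsi.contDiff
  have h1 := (FourierTransform.fourier (hc.toSchwartzMap hs)).integrable (μ := volume)
  have h2 := h1.comp_mul_left' (R := -(2 * π)⁻¹) (by simp [Real.pi_ne_zero])
  refine h2.congr (Filter.Eventually.of_forall fun x => ?_)
  simp only [SchwartzMap.fourier_coe, Real.fourier_real_eq_integral_exp_smul, bumpG]
  refine integral_congr_ae (Filter.Eventually.of_forall fun s => ?_)
  change Complex.exp _ • ((bumpPsi s : ℂ)) = _
  simp only [smul_eq_mul]
  rw [mul_comm]
  congr 2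
  push_cast
  have : (π : ℂ) ≠ 0 := by exact_mod_cast Real.pi_ne_zero
  field_simp

lemma bumpG_lower {x y : ℝ} (hx : |x| ≤ 1) (hy0 : 0 ≤ y) (hy1 : y ≤ 1) :
    (∫ s : ℝ, bumpPsi s) * (Real.exp (-1) * Real.cos 1) ≤ ‖bumpG (x + y * Complex.I)‖ := by
  refine le_trans ?_ (Complex.re_le_norm _)
  have hint := bumpPsi_integrable_mul
    (h := fun s : ℝ => Complex.exp (Complex.I * s * (x + y * Complex.I))) (by fun_prop)
  have h1 : (bumpG (x + y * Complex.I)).re =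
      ∫ s : ℝ, ((bumpPsi s : ℂ) * Complex.exp (Complex.I * s * (x + y * Complex.I))).re :=
    (Complex.reCLM.integral_comp_comm hint).symm
  rw [h1, ← integral_mul_const]
  refine integral_mono (bumpPsi.integrable.mul_const _) hint.re fun s => ?_
  change bumpPsi s * _ ≤ ((bumpPsi s : ℂ) * Complex.exp (Complex.I * s * (x + y * Complex.I))).re
  rw [Complex.re_ofReal_mul]
  by_cases h : bumpPsi s = 0
  · simp [h]
  obtain ⟨h0, h1⟩ := bumpPsi_supp h
  refine mul_le_mul_of_nonneg_left ?_ bumpPsi.nonneg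
  rw [Complex.exp_re]
  have e1 : (Complex.I * s * (x + y * Complex.I)).re = -(s * y) := by simp
  have e2 : (Complex.I * s * (x + y * Complex.I)).im = s * x := by simp
  rw [e1, e2]
  have hc1 : 0 ≤ Real.cos 1 := Real.cos_one_pos.le
  refine mul_le_mul (Real.exp_le_exp.mpr (by nlinarith)) ?_ hc1 (Real.exp_pos _).le
  rw [← Real.cos_abs (s * x)]
  refine Real.cos_le_cos_of_nonneg_of_le_pi (abs_nonneg _) (by linarith [Real.pi_gt_three]) ?_
  rw [abs_mul, abs_of_nonneg h0]
  nlinarith [abs_nonneg x]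

lemma lintegral_scale_s14 (h : ℝ → ℝ≥0∞) (hm : Measurable h) {ε : ℝ} (hε : 0 < ε) :
    ∫⁻ x : ℝ, ENNReal.ofReal ε * h (ε * x) = ∫⁻ x, h x := by
  rw [lintegral_const_mul' _ _ ENNReal.ofReal_ne_top,
    ← lintegral_map hm (measurable_const_mul ε), Real.map_volume_mul_left hε.ne',
    lintegral_smul_measure, smul_eq_mul, ← mul_assoc, ← ENNReal.ofReal_mul hε.le,
    abs_of_pos (inv_pos.mpr hε), mul_inv_cancel₀ hε.ne', ENNReal.ofReal_one, one_mul]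

/-- The function `f` for the parameter `ε`. -/
noncomputable def bumpF (ε : ℝ) (z : ℂ) : ℂ :=
  ε * (Complex.exp (-(Complex.I * π * z)) * bumpG (ε * z))

lemma bumpF_eq {ε : ℝ} (hε : 0 < ε) (z : ℂ) :
    bumpF ε z = ∫ t : ℝ, (bumpPsi (ε⁻¹ * (t + π)) : ℂ) * Complex.exp (Complex.I * t * z) := by
  have hε' : (ε : ℂ) ≠ 0 := by exact_mod_cast hε.ne'
  have hshift := integral_add_right_eq_self (μ := volume) (fun t : ℝ => (bumpPsi (ε⁻¹ * t) : ℂ) *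
    Complex.exp (Complex.I * ((t - π : ℝ) : ℂ) * z)) π
  simp only [add_sub_cancel_right] at hshift
  rw [hshift]
  · simp only [bumpF, bumpG]
    have := Measure.integral_comp_inv_mul_left (fun s : ℝ => (bumpPsi s : ℂ) *
      Complex.exp (Complex.I * ((ε * s - π : ℝ) : ℂ) * z)) ε
    rw [abs_of_pos hε] at this
    trans ∫ t : ℝ, (bumpPsi (ε⁻¹ * t) : ℂ) *
      Complex.exp (Complex.I * ((ε * (ε⁻¹ * t) - π : ℝ) : ℂ) * z)
    · rw [this, Complex.real_smul]
      congr 1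
      rw [← integral_const_mul]
      congr 1
      ext s
      rw [mul_left_comm, ← Complex.exp_add]
      congr 2
      push_cast
      ring
    · simp_rw [mul_inv_cancel_left₀ hε.ne']

lemma bumpF_norm {ε : ℝ} (hε : 0 < ε) (x y : ℝ) :
    (‖bumpF ε (x + y * Complex.I)‖₊ : ℝ≥0∞) = ENNReal.ofReal (Real.exp (π * y)) *
      (ENNReal.ofReal ε * (‖bumpG (((ε * x : ℝ) : ℂ) + ((ε * y : ℝ) : ℂ) * Complex.I)‖₊ : ℝ≥0∞)) := by
  have h1 : ‖Complex.exp (-(Complex.I * π * (x + y * Complex.I)))‖ = Real.exp (π * y) := by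
    rw [Complex.norm_exp]; simp
  have h2 : (ε : ℂ) * (x + y * Complex.I) =
      ((ε * x : ℝ) : ℂ) + ((ε * y : ℝ) : ℂ) * Complex.I := by push_cast; ring
  rw [← enorm_eq_nnnorm, ← enorm_eq_nnnorm, ← ofReal_norm, ← ofReal_norm,
    ← ENNReal.ofReal_mul hε.le, ← ENNReal.ofReal_mul (Real.exp_pos _).le, bumpF, norm_mul, norm_mul,
    h1, h2, Complex.norm_real, Real.norm_of_nonneg hε.le]
  congr 1
  ring

lemma bumpF_lintegral {ε : ℝ} (hε : 0 < ε) (y : ℝ) :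
    ∫⁻ x : ℝ, (‖bumpF ε (x + y * Complex.I)‖₊ : ℝ≥0∞) = ENNReal.ofReal (Real.exp (π * y)) *
      ∫⁻ x : ℝ, (‖bumpG (x + ((ε * y : ℝ) : ℂ) * Complex.I)‖₊ : ℝ≥0∞) := by
  have hm : Measurable (fun x : ℝ =>
      (‖bumpG (x + ((ε * y : ℝ) : ℂ) * Complex.I)‖₊ : ℝ≥0∞)) := by
    have : Continuous (fun x : ℝ => bumpG (x + ((ε * y : ℝ) : ℂ) * Complex.I)) :=
      bumpG_diff.continuous.comp (by fun_prop)
    exact this.measurable.nnnorm.coe_nnreal_ennreal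
  simp_rw [bumpF_norm hε]
  rw [lintegral_const_mul' _ _ ENNReal.ofReal_ne_top]
  congr 1
  exact lintegral_scale_s14 _ hm hε

lemma bumpF_diff (ε : ℝ) : Differentiable ℂ (bumpF ε) := by
  unfold bumpF
  have h : Differentiable ℂ (fun z : ℂ => bumpG (ε * z)) :=
    bumpG_diff.comp (by fun_prop)
  fun_prop

lemma bumpF_type {ε : ℝ} (hε : 0 < ε) (hε1 : ε ≤ 1) (z : ℂ) :
    ‖bumpF ε z‖ ≤ (∫ t : ℝ, bumpPsi (ε⁻¹ * (t + π))) * Real.exp (π * ‖z‖) := by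
  have hint : Integrable (fun t : ℝ => bumpPsi (ε⁻¹ * (t + π))) :=
    (bumpPsi.integrable.comp_mul_left' (inv_ne_zero hε.ne')).comp_add_right π
  rw [bumpF_eq hε, ← integral_mul_const]
  refine norm_integral_le_of_norm_le (hint.mul_const _) (Filter.Eventually.of_forall fun t => ?_)
  rw [norm_mul, Complex.norm_real, Real.norm_of_nonneg bumpPsi.nonneg]
  by_cases h : bumpPsi (ε⁻¹ * (t + π)) = 0
  · simp [h]
  refine mul_le_mul_of_nonneg_left ?_ bumpPsi.nonneg
  obtain ⟨h0, h1⟩ := bumpPsi_supp h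
  rw [inv_mul_eq_div] at h0 h1
  rw [div_le_one hε] at h1
  have h0' : 0 ≤ t + π := by
    by_contra hcon
    have := div_neg_of_neg_of_pos (not_le.mp hcon) hε
    linarith
  rw [Complex.norm_exp]
  apply Real.exp_le_exp.mpr
  refine (Complex.re_le_norm _).trans ?_
  rw [norm_mul, norm_mul, Complex.norm_I, Complex.norm_real, one_mul]
  refine mul_le_mul_of_nonneg_right ?_ (norm_nonneg z)
  rw [Real.norm_eq_abs, abs_le]
  constructor <;> linarith [Real.pi_gt_three]

/-- There is `C > 0` so that for every `y₀ > 0` there is a nonzero `f ∈ E¹` with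
`∫_ℝ |f(x+iy)| dx ≥ C e^{πy} ∫_ℝ |f(x)| dx` for all `y ∈ [0, y₀]`; moreover `f` can be
taken of the form `f(z) = ∫ φ(t) e^{itz} dt` with `φ` Schwartz and supported in
`[-π, -π+ε]` for suitably small `ε > 0`. -/
theorem exists_E1_function_with_large_growth :
    ∃ C : ℝ, 0 < C ∧ ∀ y₀ : ℝ, 0 < y₀ → ∃ f : ℂ → ℂ,
      f ≠ 0 ∧ ExpTypePi f ∧ Integrable (fun x : ℝ => f x) ∧
      (∀ y ∈ Set.Icc (0 : ℝ) y₀,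
        ENNReal.ofReal (C * Real.exp (Real.pi * y)) * (∫⁻ x : ℝ, (‖f x‖₊ : ℝ≥0∞)) ≤
          ∫⁻ x : ℝ, (‖f (x + y * Complex.I)‖₊ : ℝ≥0∞)) ∧
      ∃ ε : ℝ, 0 < ε ∧ ∃ φ : SchwartzMap ℝ ℂ,
        Function.support (⇑φ) ⊆ Set.Icc (-Real.pi) (-Real.pi + ε) ∧
        f = fun z => ∫ t : ℝ, φ t * Complex.exp (Complex.I * t * z) := by
  have hP : 0 < ∫ s : ℝ, bumpPsi s := bumpPsi.integral_pos
  set B : ℝ := (∫ s : ℝ, bumpPsi s) * (Real.exp (-1) * Real.cos 1) with hB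
  have hB0 : 0 < B := mul_pos hP (mul_pos (Real.exp_pos _) Real.cos_one_pos)
  set A : ℝ := ∫ x : ℝ, ‖bumpG x‖ with hA
  have hA0 : 0 ≤ A := integral_nonneg fun _ => norm_nonneg _
  have hAl : ∫⁻ x : ℝ, (‖bumpG x‖₊ : ℝ≥0∞) = ENNReal.ofReal A :=
    (ofReal_integral_norm_eq_lintegral_enorm bumpG_integrable).symm
  refine ⟨B / (A + 1), by positivity, fun y₀ hy₀ => ?_⟩
  set ε : ℝ := min 1 y₀⁻¹ with hεdef
  have hε : 0 < ε := lt_min one_pos (inv_pos.mpr hy₀)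
  have hε1 : ε ≤ 1 := min_le_left _ _
  have hεy : ε * y₀ ≤ 1 := by
    calc ε * y₀ ≤ y₀⁻¹ * y₀ := mul_le_mul_of_nonneg_right (min_le_right _ _) hy₀.le
      _ = 1 := inv_mul_cancel₀ hy₀.ne'
  have hF0 : ∫⁻ x : ℝ, (‖bumpF ε x‖₊ : ℝ≥0∞) = ENNReal.ofReal A := by
    have := bumpF_lintegral hε 0
    simp only [Complex.ofReal_zero, zero_mul, add_zero, mul_zero, Real.exp_zero,
      ENNReal.ofReal_one, one_mul] at this
    rw [this, hAl]
  have hlow : ∀ y ∈ Set.Icc (0 : ℝ) y₀, ENNReal.ofReal B ≤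
      ∫⁻ x : ℝ, (‖bumpG (x + ((ε * y : ℝ) : ℂ) * Complex.I)‖₊ : ℝ≥0∞) := by
    intro y hy
    calc ENNReal.ofReal B ≤ ENNReal.ofReal B * volume (Set.Icc (-1 : ℝ) 1) := by
          rw [Real.volume_Icc, ← ENNReal.ofReal_mul hB0.le]
          apply ENNReal.ofReal_le_ofReal
          linarith
      _ = ∫⁻ x in Set.Icc (-1 : ℝ) 1, ENNReal.ofReal B := by rw [setLIntegral_const]
      _ ≤ ∫⁻ x in Set.Icc (-1 : ℝ) 1,
            (‖bumpG (x + ((ε * y : ℝ) : ℂ) * Complex.I)‖₊ : ℝ≥0∞) := by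
          refine setLIntegral_mono' measurableSet_Icc fun x hx => ?_
          rw [← enorm_eq_nnnorm, ← ofReal_norm]
          apply ENNReal.ofReal_le_ofReal
          refine bumpG_lower (abs_le.mpr hx) (mul_nonneg hε.le hy.1) ?_
          exact (mul_le_mul_of_nonneg_left hy.2 hε.le).trans hεy
      _ ≤ _ := setLIntegral_le_lintegral _ _
  refine ⟨bumpF ε, ?_, ⟨bumpF_diff ε, ?_⟩, ?_, ?_, ε, hε, ?_⟩
  · intro h
    have h1 := hlow 0 ⟨le_rfl, hy₀.le⟩
    have h2 := bumpF_lintegral hε 0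
    rw [h] at h2
    simp only [Pi.zero_apply, nnnorm_zero, ENNReal.coe_zero, lintegral_zero, mul_zero,
      Real.exp_zero, ENNReal.ofReal_one, one_mul] at h1 h2
    rw [← h2] at h1
    exact absurd (ENNReal.ofReal_pos.mpr hB0) (not_lt.mpr h1)
  · intro δ hδ
    have hn : 0 ≤ ∫ t : ℝ, bumpPsi (ε⁻¹ * (t + π)) := integral_nonneg fun _ => bumpPsi.nonneg
    refine ⟨(∫ t : ℝ, bumpPsi (ε⁻¹ * (t + π))) + 1, by linarith, fun z => ?_⟩
    refine (bumpF_type hε hε1 z).trans ?_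
    refine mul_le_mul (by linarith) (Real.exp_le_exp.mpr ?_) (Real.exp_pos _).le (by linarith)
    exact mul_le_mul_of_nonneg_right (by linarith) (norm_nonneg z)
  · refine ⟨((bumpF_diff ε).continuous.comp Complex.continuous_ofReal).aestronglyMeasurable, ?_⟩
    change ∫⁻ x : ℝ, (‖bumpF ε x‖₊ : ℝ≥0∞) < ⊤
    rw [hF0]
    exact ENNReal.ofReal_lt_top
  · intro y hy
    rw [hF0, bumpF_lintegral hε, mul_comm (B / (A + 1)), ENNReal.ofReal_mul (Real.exp_pos _).le,
      mul_assoc]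
    refine mul_le_mul_right ?_ _
    refine le_trans ?_ (hlow y hy)
    rw [← ENNReal.ofReal_mul (by positivity)]
    apply ENNReal.ofReal_le_ofReal
    rw [div_mul_eq_mul_div, div_le_iff₀ (by linarith)]
    nlinarith
  · have hs : ContDiff ℝ (⊤ : ℕ∞) (fun t : ℝ => (bumpPsi (ε⁻¹ * (t + π)) : ℂ)) :=
      Complex.ofRealCLM.contDiff.comp (bumpPsi.contDiff.comp (by fun_prop))
    have hsupp : Function.support (fun t : ℝ => (bumpPsi (ε⁻¹ * (t + π)) : ℂ)) ⊆
        Set.Icc (-π) (-π + ε) := by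
      intro t ht
      have ht' : bumpPsi (ε⁻¹ * (t + π)) ≠ 0 := by
        intro h
        exact ht (by simp [h])
      obtain ⟨h0, h1⟩ := bumpPsi_supp ht'
      have h2 : t + π = ε * (ε⁻¹ * (t + π)) := (mul_inv_cancel_left₀ hε.ne' _).symm
      have h3 := mul_nonneg hε.le h0
      have h4 := mul_le_mul_of_nonneg_left h1 hε.le
      rw [← h2] at h3 h4
      constructor <;> linarith
    have hc : HasCompactSupport (fun t : ℝ => (bumpPsi (ε⁻¹ * (t + π)) : ℂ)) :=
      HasCompactSupport.of_support_subset_isCompact isCompact_Icc hsupp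
    refine ⟨hc.toSchwartzMap hs, hsupp, ?_⟩
    funext z
    exact bumpF_eq hε z
end
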